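/- Let F be a singular holomorphic foliation of codimension one on CP^n, n ≥ 2, and suppose M is a nonempty nontrivial minimal set of F. Then there exists a point p ∈ M such that the leaf L_p of F through p has hyperbolic holonomy, i.e., the holonomy group of L_p contains a germ of diffeomorphism f of (C, 0) with |f'(0)| < 1. Moreover, the following dichotomy holds: either (1) M is a real-analytic Levi-flat hypersurface, or (2) the holonomy representation Hol: π_1(L_p, p) → Diff(C, 0) has image a linearizable abelian group. -/

import Mathlib

/- STATEMENT 14 (Cerveau): Let F be a singular holomorphic foliation of codimension one
on ℂℙⁿ, n ≥ 2, and let M be a nonempty nontrivial minimal set of F.  Then there is a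
point p ∈ M whose leaf L_p has hyperbolic holonomy: the holonomy group of L_p contains a
germ f of a diffeomorphism of (ℂ,0) with |f'(0)| < 1.  Moreover either (1) M is a real
analytic Levi-flat hypersurface, or (2) the image of the holonomy representation
Hol : π₁(L_p, p) → Diff(ℂ,0) is a linearizable abelian group.

Foliations on ℂℙⁿ are described in homogeneous coordinates; subsets of ℂℙⁿ are encoded
by cones in ℂ^{n+1} ∖ {0}.  The holonomy of a loop γ in the leaf L_p, computed on the
transversal {p + s·v}, is encoded as a germ h of a holomorphic map fixing 0 which is
realized by a continuous family H(t,s) following the leaves of nearby points along γ.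
Linearizability of the holonomy group means all its germs are simultaneously conjugated
to linear maps by one local biholomorphism φ, and abelianness means any two of its germs
commute. -/

open MvPolynomial

/-- A (singular) holomorphic foliation of codimension one and degree `d` on `ℂℙⁿ`,
described in homogeneous coordinates by the integrable 1-form `ω = ∑ aᵢ dzᵢ` on
`ℂ^{n+1}`, whose coefficients are homogeneous polynomials of degree `d+1` satisfying the
Euler condition, with singular set of codimension at least 2. -/
structure ProjFoliation (n d : ℕ) where
  /-- coefficients of the defining 1-form `∑ aᵢ dzᵢ` -/
  a : Fin (n + 1) → MvPolynomial (Fin (n + 1)) ℂ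
  /-- the coefficients are homogeneous of degree `d+1` -/
  homog : ∀ i, (a i).IsHomogeneous (d + 1)
  /-- the form is not identically zero -/
  nonzero : ∃ i, a i ≠ 0
  /-- integrability `ω ∧ dω = 0`, componentwise -/
  integrable : ∀ i j k,
    a i * (pderiv j (a k) - pderiv k (a j)) +
    a j * (pderiv k (a i) - pderiv i (a k)) +
    a k * (pderiv i (a j) - pderiv j (a i)) = 0
  /-- Euler condition `∑ zᵢ aᵢ = 0` -/
  euler : ∑ i, X i * a i = 0
  /-- the zero set has codimension at least 2: the coefficients have no common
  nonconstant factor -/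
  codim2 : ¬ ∃ q : MvPolynomial (Fin (n + 1)) ℂ, q.totalDegree ≠ 0 ∧ ∀ i, q ∣ a i

/-- The singular locus of the foliation, as a cone in `ℂ^{n+1} ∖ {0}`. -/
def ProjFoliation.singCone {n d : ℕ} (F : ProjFoliation n d) : Set (Fin (n + 1) → ℂ) :=
  {z | z ≠ 0 ∧ ∀ i, eval z (F.a i) = 0}

open Complex Set

noncomputable section

/-- The Levi form (up to a positive factor) of the defining function `ρ` at `p`,
evaluated at `w`: `D²ρ(p)(w,w) + D²ρ(p)(Jw,Jw) = 4 ∑ ∂²ρ/∂zⱼ∂z̄ₖ wⱼ w̄ₖ`. -/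
def leviForm {m : ℕ} (ρ : (Fin m → ℂ) → ℝ) (p w : Fin m → ℂ) : ℝ :=
  iteratedFDeriv ℝ 2 ρ p ![w, w] + iteratedFDeriv ℝ 2 ρ p ![Complex.I • w, Complex.I • w]

/-- `w` belongs to the complex tangent space at `p` of the hypersurface `{ρ = 0}`. -/
def IsComplexTangent {m : ℕ} (ρ : (Fin m → ℂ) → ℝ) (p w : Fin m → ℂ) : Prop :=
  fderiv ℝ ρ p w = 0 ∧ fderiv ℝ ρ p (Complex.I • w) = 0

/-- `M` is a real analytic Levi-flat real hypersurface: near each of its points it is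
the zero set of a real analytic defining function with nonvanishing gradient whose Levi
form vanishes identically on complex tangent vectors. -/
def IsAnalyticLeviFlatHypersurface {m : ℕ} (M : Set (Fin m → ℂ)) : Prop :=
  ∀ p ∈ M, ∃ V : Set (Fin m → ℂ), IsOpen V ∧ p ∈ V ∧ ∃ ρ : (Fin m → ℂ) → ℝ,
    AnalyticOnNhd ℝ ρ V ∧ (∀ q ∈ V, fderiv ℝ ρ q ≠ 0) ∧
    (∀ q ∈ V, q ∈ M ↔ ρ q = 0) ∧
    (∀ q ∈ V, ρ q = 0 → ∀ w, IsComplexTangent ρ q w → leviForm ρ q w = 0)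

/-- `S` is a cone: it is invariant under multiplication by nonzero complex scalars.
Subsets of `ℂℙⁿ` are encoded by the cones over them in `ℂ^{n+1} ∖ {0}`. -/
def IsCone {m : ℕ} (S : Set (Fin m → ℂ)) : Prop :=
  ∀ c : ℂ, c ≠ 0 → ∀ z ∈ S, c • z ∈ S

/-- The cone `S ⊆ ℂ^{n+1} ∖ {0}` represents a closed (= compact) subset of `ℂℙⁿ`:
it is closed in the punctured space `ℂ^{n+1} ∖ {0}`. -/
def IsClosedInPunctured {m : ℕ} (S : Set (Fin m → ℂ)) : Prop :=
  ∀ z ∈ closure S, z ≠ 0 → z ∈ S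

/-- The cone over a closed subset of `ℂℙⁿ`. -/
def IsProjectiveClosedSet {m : ℕ} (S : Set (Fin m → ℂ)) : Prop :=
  S.Nonempty ∧ (∀ z ∈ S, z ≠ 0) ∧ IsCone S ∧ IsClosedInPunctured S

/-- Two points are related if they lie on a common plaque of the foliation `F`: a
connected piece of a level set of a local holomorphic first integral `f` (a holomorphic
submersion with `df ∧ ω = 0`), away from the singular locus and the origin. -/
def ProjFoliation.PlaqueRel {n d : ℕ} (F : ProjFoliation n d)
    (p q : Fin (n + 1) → ℂ) : Prop :=
  ∃ U : Set (Fin (n + 1) → ℂ), IsOpen U ∧ (∀ z ∈ U, z ≠ 0) ∧ Disjoint U F.singCone ∧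
    ∃ f : (Fin (n + 1) → ℂ) → ℂ, DifferentiableOn ℂ f U ∧
      (∀ z ∈ U, fderiv ℂ f z ≠ 0) ∧
      (∀ z ∈ U, ∀ v w : Fin (n + 1) → ℂ,
        (∑ i, eval z (F.a i) * v i) * fderiv ℂ f z w =
        (∑ i, eval z (F.a i) * w i) * fderiv ℂ f z v) ∧
      p ∈ U ∧ q ∈ connectedComponentIn {z ∈ U | f z = f p} p

/-- The leaf of `F` through `p`: the set of points reachable from `p` by chains of
plaques.  (Leaves are cones over the leaves of the foliation induced on `ℂℙⁿ`.) -/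
def ProjFoliation.leaf {n d : ℕ} (F : ProjFoliation n d) (p : Fin (n + 1) → ℂ) :
    Set (Fin (n + 1) → ℂ) :=
  {q | Relation.ReflTransGen F.PlaqueRel p q}

/-- `S` is invariant under `F`: it is a union of leaves. -/
def ProjFoliation.IsInvariant {n d : ℕ} (F : ProjFoliation n d)
    (S : Set (Fin (n + 1) → ℂ)) : Prop :=
  ∀ p ∈ S, F.leaf p ⊆ S

/-- A nontrivial minimal set of `F`, encoded as a cone in `ℂ^{n+1} ∖ {0}` (so that it
represents a compact subset of `ℂℙⁿ`): a nonempty closed invariant set, minimal among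
nonempty closed invariant subsets, and disjoint from the singular locus. -/
def ProjFoliation.IsNontrivialMinimalSet {n d : ℕ} (F : ProjFoliation n d)
    (Y : Set (Fin (n + 1) → ℂ)) : Prop :=
  Y.Nonempty ∧ (∀ z ∈ Y, z ≠ 0) ∧ IsCone Y ∧ IsClosedInPunctured Y ∧
  F.IsInvariant Y ∧ Disjoint Y F.singCone ∧
  (∀ Y' ⊆ Y, Y'.Nonempty → IsClosedInPunctured Y' → F.IsInvariant Y' → Y' = Y)

/-- `h` is (a representative of the germ of) the holonomy of some loop in the leaf of
`F` through `p`, computed on the transversal `s ↦ p + s • v`: there is a loop `γ` at `p`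
inside the leaf, and a continuous family `H(t,s)` with `H(·,0) = γ`, starting at
`H(0,s) = p + s•v`, ending at `H(1,s) = p + h(s)•v`, such that each path `H(·,s)` stays
in the leaf of `p + s•v`. -/
def ProjFoliation.IsHolonomyAt {n d : ℕ} (F : ProjFoliation n d)
    (p v : Fin (n + 1) → ℂ) (r : ℝ) (h : ℂ → ℂ) : Prop :=
  ∃ γ : ℝ → (Fin (n + 1) → ℂ), ContinuousOn γ (Icc (0:ℝ) 1) ∧
    γ 0 = p ∧ γ 1 = p ∧ (∀ t ∈ Icc (0:ℝ) 1, γ t ∈ F.leaf p) ∧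
    ∃ H : ℝ × ℂ → (Fin (n + 1) → ℂ),
      ContinuousOn H (Icc (0:ℝ) 1 ×ˢ Metric.ball (0:ℂ) r) ∧
      (∀ t ∈ Icc (0:ℝ) 1, H (t, 0) = γ t) ∧
      (∀ s ∈ Metric.ball (0:ℂ) r, H (0, s) = p + s • v ∧ H (1, s) = p + h s • v) ∧
      (∀ t ∈ Icc (0:ℝ) 1, ∀ s ∈ Metric.ball (0:ℂ) r, H (t, s) ∈ F.leaf (p + s • v))

namespace MvPolynomial

/-- The Fréchet derivative of a polynomial function is given by its partial derivatives. -/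
theorem hasFDerivAt_eval {m : ℕ} (p : MvPolynomial (Fin m) ℂ) (z : Fin m → ℂ) :
    HasFDerivAt (fun z : Fin m → ℂ => eval z p)
      (∑ j, eval z (pderiv j p) • (ContinuousLinearMap.proj j : (Fin m → ℂ) →L[ℂ] ℂ)) z := by
  induction p using MvPolynomial.induction_on with
  | C a =>
    simp only [eval_C]
    refine (hasFDerivAt_const a z).congr_fderiv ?_
    ext v
    simp
  | add p q hp hq =>
    simp only [map_add]
    refine (hp.fun_add hq).congr_fderiv ?_
    ext v
    simp [add_mul, Finset.sum_add_distrib]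
  | mul_X p i hp =>
    have hX : HasFDerivAt (fun z : Fin m → ℂ => z i)
      (ContinuousLinearMap.proj i : (Fin m → ℂ) →L[ℂ] ℂ) z :=
      (ContinuousLinearMap.proj i : (Fin m → ℂ) →L[ℂ] ℂ).hasFDerivAt
    simp only [map_mul, eval_X]
    refine (hp.mul hX).congr_fderiv ?_
    ext v
    simp only [add_apply, smul_apply, ContinuousLinearMap.proj_apply, FunLike.coe_sum,
      Finset.sum_apply, Derivation.leibniz, pderiv_X, smul_eq_mul, map_add, map_mul, eval_X,
      add_mul, Finset.sum_add_distrib, Finset.mul_sum]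
    congr 1
    · rw [Finset.sum_eq_single i]
      · simp
      · intro j _ hj
        simp [hj.symm]
      · simp
    · exact Finset.sum_congr rfl fun j _ => by ring

end MvPolynomial

/-- Scaling behaviour of the values of a homogeneous polynomial. -/
theorem MvPolynomial.IsHomogeneous.eval_smul {m k : ℕ} {p : MvPolynomial (Fin m) ℂ}
    (hp : p.IsHomogeneous k) (c : ℂ) (z : Fin m → ℂ) :
    eval (c • z) p = c ^ k * eval z p := by
  simp only [eval_eq', Finset.mul_sum]
  refine Finset.sum_congr rfl fun e he => ?_
  have hk : ∑ i, e i = k := by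
    have := hp (mem_support_iff.1 he)
    rw [← Finsupp.degree_eq_sum]
    exact (DFunLike.congr_fun (Finsupp.degree_eq_weight_one (R := ℕ)) e).trans this
  simp only [Pi.smul_apply, smul_eq_mul, mul_pow, Finset.prod_mul_distrib,
    Finset.prod_pow_eq_pow_sum, hk]
  ring

namespace ProjFoliation

section
variable {n d : ℕ} (F : ProjFoliation n d)

/-- The defining one-form of the foliation, as a covector depending on the point. -/
def form (z : Fin (n + 1) → ℂ) : (Fin (n + 1) → ℂ) →L[ℂ] ℂ :=
  ∑ i, eval z (F.a i) • (ContinuousLinearMap.proj i : (Fin (n + 1) → ℂ) →L[ℂ] ℂ)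

/-- The exterior derivative of the defining one-form. -/
def dform (z u v : Fin (n + 1) → ℂ) : ℂ :=
  fderiv ℂ F.form z u v - fderiv ℂ F.form z v u

theorem form_apply (z v : Fin (n + 1) → ℂ) : F.form z v = ∑ i, eval z (F.a i) * v i := by
  simp [form]

theorem hasFDerivAt_form (z : Fin (n + 1) → ℂ) :
    HasFDerivAt F.form (∑ i, (∑ j, eval z (pderiv j (F.a i)) •
      (ContinuousLinearMap.proj j : (Fin (n + 1) → ℂ) →L[ℂ] ℂ)).smulRight
      (ContinuousLinearMap.proj i : (Fin (n + 1) → ℂ) →L[ℂ] ℂ)) z := by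
  have : F.form = fun z => ∑ i, eval z (F.a i) •
      (ContinuousLinearMap.proj i : (Fin (n + 1) → ℂ) →L[ℂ] ℂ) := rfl
  rw [this]
  refine HasFDerivAt.fun_sum fun i _ => ?_
  exact (hasFDerivAt_eval (F.a i) z).smul_const
    (ContinuousLinearMap.proj i : (Fin (n + 1) → ℂ) →L[ℂ] ℂ)

theorem analyticAt_eval {m : ℕ} (p : MvPolynomial (Fin m) ℂ) (z : Fin m → ℂ) :
    AnalyticAt ℂ (fun z => eval z p) z :=
  AnalyticOnNhd.eval_mvPolynomial p z (mem_univ z)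

theorem analyticAt_form (z : Fin (n + 1) → ℂ) : AnalyticAt ℂ F.form z := by
  have : F.form = fun z => ∑ i, eval z (F.a i) •
      (ContinuousLinearMap.proj i : (Fin (n + 1) → ℂ) →L[ℂ] ℂ) := rfl
  rw [this]
  exact Finset.analyticAt_fun_sum _ fun i _ => (analyticAt_eval (F.a i) z).smul analyticAt_const

theorem continuous_form : Continuous F.form :=
  continuous_iff_continuousAt.2 fun z => (F.analyticAt_form z).continuousAt

theorem fderiv_form_apply (z u v : Fin (n + 1) → ℂ) :
    fderiv ℂ F.form z u v = ∑ i, (∑ j, eval z (pderiv j (F.a i)) * u j) * v i := by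
  rw [(F.hasFDerivAt_form z).fderiv]
  simp

theorem form_smul_left (c : ℂ) (z v : Fin (n + 1) → ℂ) :
    F.form (c • z) v = c ^ (d + 1) * F.form z v := by
  simp only [form_apply, Finset.mul_sum]
  refine Finset.sum_congr rfl fun i _ => ?_
  rw [(F.homog i).eval_smul, mul_assoc]

theorem form_self (z : Fin (n + 1) → ℂ) : F.form z z = 0 := by
  have h := congrArg (eval z) F.euler
  simp only [map_sum, map_mul, eval_X, map_zero] at h
  rw [form_apply, ← h]
  exact Finset.sum_congr rfl fun i _ => mul_comm _ _

theorem fderiv_form_self_left (z v : Fin (n + 1) → ℂ) :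
    fderiv ℂ F.form z z v = (d + 1) * F.form z v := by
  rw [fderiv_form_apply, form_apply, Finset.mul_sum]
  refine Finset.sum_congr rfl fun i _ => ?_
  have h := congrArg (eval z) (F.homog i).sum_X_mul_pderiv
  simp only [map_sum, map_mul, eval_X, nsmul_eq_mul, map_natCast] at h
  push_cast at h
  rw [← mul_assoc, ← h]
  congr 1
  exact Finset.sum_congr rfl fun i _ => mul_comm _ _

theorem fderiv_form_self_right (z v : Fin (n + 1) → ℂ) :
    fderiv ℂ F.form z v z = - F.form z v := by
  have h1 : HasFDerivAt (fun z => F.form z z)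
      ((F.form z).comp (ContinuousLinearMap.id ℂ _) + (fderiv ℂ F.form z).flip z) z :=
    (F.analyticAt_form z).differentiableAt.hasFDerivAt.clm_apply (hasFDerivAt_id z)
  have h2 : HasFDerivAt (fun z => F.form z z) (0 : (Fin (n + 1) → ℂ) →L[ℂ] ℂ) z := by
    simp only [form_self]
    exact hasFDerivAt_const _ _
  have h := DFunLike.congr_fun (h1.unique h2) v
  simp only [add_apply, ContinuousLinearMap.comp_id, ContinuousLinearMap.flip_apply,
    zero_apply] at h
  linear_combination h

/-- Contraction of the exterior derivative with the radial vector field. -/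
theorem dform_self_left (z v : Fin (n + 1) → ℂ) : F.dform z z v = (d + 2) * F.form z v := by
  rw [dform, fderiv_form_self_left, fderiv_form_self_right]
  ring

theorem dform_integrable (z u v w : Fin (n + 1) → ℂ) :
    F.form z u * F.dform z v w + F.form z v * F.dform z w u + F.form z w * F.dform z u v = 0 := by
  have key : ∀ x y : Fin (n + 1) → ℂ, F.dform z x y =
      ∑ j, ∑ k, (eval z (pderiv j (F.a k)) - eval z (pderiv k (F.a j))) * x j * y k := by
    intro x y
    simp only [dform, fderiv_form_apply, sub_mul, Finset.sum_sub_distrib, Finset.sum_mul]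
    rw [Finset.sum_comm]
    congr 1
    refine Finset.sum_congr rfl fun j _ => Finset.sum_congr rfl fun k _ => by ring
  have h : ∀ i j k, _ := fun i j k => congrArg (eval z) (F.integrable i j k)
  simp only [map_add, map_mul, map_sub, map_zero] at h
  have h1 : F.form z u * F.dform z v w = ∑ i, ∑ j, ∑ k, (eval z (F.a i) *
      (eval z (pderiv j (F.a k)) - eval z (pderiv k (F.a j)))) * (u i * v j * w k) := by
    rw [form_apply, key, Finset.sum_mul]
    simp only [Finset.mul_sum]
    exact Finset.sum_congr rfl fun i _ => Finset.sum_congr rfl fun j _ =>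
      Finset.sum_congr rfl fun k _ => by ring
  have h2 : F.form z v * F.dform z w u = ∑ i, ∑ j, ∑ k, (eval z (F.a j) *
      (eval z (pderiv k (F.a i)) - eval z (pderiv i (F.a k)))) * (u i * v j * w k) := by
    rw [form_apply, key, Finset.sum_mul]
    simp only [Finset.mul_sum]
    rw [Finset.sum_comm (γ := Fin (n + 1))]
    conv_rhs => rw [Finset.sum_comm]; enter [2, j]; rw [Finset.sum_comm]
    rw [Finset.sum_comm]
    exact Finset.sum_congr rfl fun i _ => Finset.sum_congr rfl fun j _ =>
      Finset.sum_congr rfl fun k _ => by ring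
  have h3 : F.form z w * F.dform z u v = ∑ i, ∑ j, ∑ k, (eval z (F.a k) *
      (eval z (pderiv i (F.a j)) - eval z (pderiv j (F.a i)))) * (u i * v j * w k) := by
    rw [form_apply, key, Finset.sum_mul]
    simp only [Finset.mul_sum]
    rw [Finset.sum_comm]
    refine Finset.sum_congr rfl fun i _ => ?_
    rw [Finset.sum_comm]
    exact Finset.sum_congr rfl fun j _ =>
      Finset.sum_congr rfl fun k _ => by ring
  rw [h1, h2, h3]
  simp only [← Finset.sum_add_distrib]
  refine Finset.sum_eq_zero fun i _ => Finset.sum_eq_zero fun j _ =>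
    Finset.sum_eq_zero fun k _ => ?_
  rw [← add_mul, ← add_mul, h i j k, zero_mul]

theorem dform_swap (z u v : Fin (n + 1) → ℂ) : F.dform z u v = - F.dform z v u := by
  simp [dform]

end

end ProjFoliation

section Primitive

/-- The primitive vanishing at `0` of a continuous function on the unit interval. -/
def unitIntervalPrimitive (g : C(unitInterval, ℂ)) (t : ℝ) : ℂ :=
  ∫ s in (0:ℝ)..t, IccExtend zero_le_one g s

theorem hasDerivAt_unitIntervalPrimitive (g : C(unitInterval, ℂ)) (t : ℝ) :
    HasDerivAt (unitIntervalPrimitive g) (IccExtend zero_le_one g t) t := by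
  have hc : Continuous (IccExtend (zero_le_one (α := ℝ)) g) := g.continuous.Icc_extend'
  exact intervalIntegral.integral_hasDerivAt_right (hc.intervalIntegrable _ _)
    (hc.stronglyMeasurableAtFilter _ _) hc.continuousAt

theorem unitIntervalPrimitive_zero (g : C(unitInterval, ℂ)) : unitIntervalPrimitive g 0 = 0 := by
  simp [unitIntervalPrimitive]

/-- The Volterra operator on continuous functions on the unit interval. -/
def volterra : C(unitInterval, ℂ) →L[ℂ] C(unitInterval, ℂ) :=
  LinearMap.mkContinuous
    { toFun := fun g => ⟨fun t => unitIntervalPrimitive g t,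
        (continuous_iff_continuousAt.2 fun t =>
          (hasDerivAt_unitIntervalPrimitive g t).continuousAt).comp continuous_subtype_val⟩
      map_add' := fun g h => by
        ext t
        have hg : Continuous (IccExtend (zero_le_one (α := ℝ)) g) := g.continuous.Icc_extend'
        have hh : Continuous (IccExtend (zero_le_one (α := ℝ)) h) := h.continuous.Icc_extend'
        exact intervalIntegral.integral_add (hg.intervalIntegrable _ _)
          (hh.intervalIntegrable _ _)
      map_smul' := fun c g => by
        ext t
        exact intervalIntegral.integral_smul c _ } 1
    (fun g => by
      rw [one_mul, ContinuousMap.norm_le _ (norm_nonneg _)]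
      intro t
      refine (intervalIntegral.norm_integral_le_of_norm_le_const (C := ‖g‖) fun s _ =>
        g.norm_coe_le_norm _).trans ?_
      rw [sub_zero, abs_of_nonneg t.2.1]
      exact mul_le_of_le_one_right (norm_nonneg _) t.2.2)

theorem volterra_apply (g : C(unitInterval, ℂ)) (t : unitInterval) :
    volterra g t = unitIntervalPrimitive g t := rfl

end Primitive

/-- A solution of a scalar linear differential equation vanishes at one end of the interval
if and only if it vanishes at the other end. -/
theorem exists_eq_mul_of_hasDerivAt_mul {φ κ : ℝ → ℂ} (hκ : ContinuousOn κ (Icc 0 1))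
    (hφ : ∀ t ∈ Icc (0:ℝ) 1, HasDerivAt φ (κ t * φ t) t) : ∃ c ≠ 0, φ 1 = c * φ 0 := by
  set g : C(unitInterval, ℂ) := ⟨(Icc (0:ℝ) 1).domRestrict κ, hκ.domRestrict⟩
  have hg : ∀ t (ht : t ∈ Icc (0:ℝ) 1), IccExtend zero_le_one g t = κ t := fun t ht => by
    rw [IccExtend_of_mem _ _ ht]; rfl
  set K := unitIntervalPrimitive g
  have hK : ∀ t ∈ Icc (0:ℝ) 1, HasDerivAt K (κ t) t := fun t ht => by
    rw [← hg t ht]; exact hasDerivAt_unitIntervalPrimitive g t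
  have hd : ∀ t ∈ Icc (0:ℝ) 1, HasDerivAt (fun t => φ t * Complex.exp (-K t)) 0 t := by
    intro t ht
    exact ((hφ t ht).fun_mul (hK t ht).fun_neg.cexp).congr_deriv (by ring)
  have h := constant_of_has_deriv_right_zero
    (fun t ht => (hd t ht).continuousAt.continuousWithinAt)
    (fun t ht => (hd t (Ico_subset_Icc_self ht)).hasDerivWithinAt) 1 (right_mem_Icc.2 zero_le_one)
  refine ⟨Complex.exp (K 1), Complex.exp_ne_zero _, ?_⟩
  have h0 : K 0 = 0 := unitIntervalPrimitive_zero g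
  simp only [h0, neg_zero, Complex.exp_zero, mul_one] at h
  rw [← h, mul_comm, mul_assoc, ← Complex.exp_add]
  simp

namespace ProjFoliation

section
variable {n d : ℕ} (F : ProjFoliation n d)

/-- Infinitesimal propagation of tangency along a curve tangent to the foliation. -/
theorem exists_form_eq_mul_of_tangent {P Q τ τ' : ℝ → Fin (n + 1) → ℂ} {v₀ : Fin (n + 1) → ℂ}
    (hP : ∀ t ∈ Icc (0:ℝ) 1, HasDerivAt P (τ t) t)
    (hQ : ∀ t ∈ Icc (0:ℝ) 1, HasDerivAt Q (τ' t) t)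
    (hτc : ContinuousOn τ (Icc 0 1))
    (hτ : ∀ t ∈ Icc (0:ℝ) 1, F.form (P t) (τ t) = 0)
    (hv₀ : ∀ t ∈ Icc (0:ℝ) 1, F.form (P t) v₀ ≠ 0)
    (hτ' : ∀ t ∈ Icc (0:ℝ) 1,
      F.form (P t) (τ' t) + fderiv ℂ F.form (P t) (Q t) (τ t) = 0) :
    ∃ c ≠ 0, F.form (P 1) (Q 1) = c * F.form (P 0) (Q 0) := by
  have hPc : ContinuousOn P (Icc 0 1) := fun t ht => (hP t ht).continuousAt.continuousWithinAt
  have hfc : ContinuousOn (fun t => F.form (P t)) (Icc 0 1) :=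
    F.continuous_form.comp_continuousOn hPc
  have hf'c : ContinuousOn (fun t => fderiv ℂ F.form (P t)) (Icc 0 1) :=
    (continuous_iff_continuousAt.2 fun z =>
      (F.analyticAt_form z).fderiv.continuousAt).comp_continuousOn hPc
  refine exists_eq_mul_of_hasDerivAt_mul
    (φ := fun t => F.form (P t) (Q t)) (κ := fun t => - F.dform (P t) v₀ (τ t) / F.form (P t) v₀)
    ?_ ?_
  · refine ContinuousOn.div ?_ (hfc.clm_apply continuousOn_const) hv₀
    exact (((hf'c.clm_apply continuousOn_const).clm_apply hτc).sub
      ((hf'c.clm_apply hτc).clm_apply continuousOn_const)).neg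
  · intro t ht
    have h1 : HasDerivAt (fun t => F.form (P t)) (fderiv ℂ F.form (P t) (τ t)) t := by
      have h2 : HasFDerivAt F.form ((fderiv ℂ F.form (P t)).restrictScalars ℝ) (P t) :=
        (F.analyticAt_form (P t)).differentiableAt.hasFDerivAt.restrictScalars ℝ
      exact h2.comp_hasDerivAt t (hP t ht)
    have h3 : HasDerivAt (fun t => F.form (P t) (Q t))
        (fderiv ℂ F.form (P t) (τ t) (Q t) + F.form (P t) (τ' t)) t := by
      have := HasDerivAt.clm_apply (𝕜 := ℝ)
        (c := fun t => (F.form (P t)).restrictScalars ℝ)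
        (c' := (fderiv ℂ F.form (P t) (τ t)).restrictScalars ℝ) ?_ (hQ t ht)
      · exact this
      · exact ((ContinuousLinearMap.restrictScalarsL ℂ (Fin (n + 1) → ℂ) ℂ ℝ
          ℝ).hasFDerivAt.comp_hasDerivAt t h1)
    refine h3.congr_deriv ?_
    have hi := F.dform_integrable (P t) (τ t) (Q t) v₀
    rw [hτ t ht, zero_mul, zero_add] at hi
    have h4 : fderiv ℂ F.form (P t) (τ t) (Q t) + F.form (P t) (τ' t) =
        F.dform (P t) (τ t) (Q t) := by
      rw [dform]; linear_combination hτ' t ht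
    rw [h4, div_mul_eq_mul_div, eq_div_iff (hv₀ t ht)]
    linear_combination hi

end

end ProjFoliation

namespace ProjFoliation

section
variable {n d : ℕ} (F : ProjFoliation n d)

/-- The defining form evaluated along a path, in the algebra of continuous functions. -/
def formAlong (P : Fin (n + 1) → C(unitInterval, ℂ)) (u : Fin (n + 1) → ℂ) :
    C(unitInterval, ℂ) :=
  ∑ i, u i • aeval P (F.a i)

theorem formAlong_apply (P : Fin (n + 1) → C(unitInterval, ℂ)) (u : Fin (n + 1) → ℂ)
    (t : unitInterval) : F.formAlong P u t = F.form (fun i => P i t) u := by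
  have key : ∀ p : MvPolynomial (Fin (n + 1)) ℂ, aeval P p t = eval (fun i => P i t) p := by
    intro p
    induction p using MvPolynomial.induction_on with
    | C a => simp
    | add p q hp hq => simp [hp, hq]
    | mul_X p i hp => simp [hp]
  rw [form_apply, formAlong]
  simp only [ContinuousMap.coe_sum, Finset.sum_apply, ContinuousMap.coe_smul, Pi.smul_apply,
    smul_eq_mul, key]
  exact Finset.sum_congr rfl fun i _ => mul_comm _ _

theorem _root_.AnalyticAt.formAlong {G : Type*} [NormedAddCommGroup G] [NormedSpace ℂ G]
    {P : G → Fin (n + 1) → C(unitInterval, ℂ)} {u : G → Fin (n + 1) → ℂ} {x : G}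
    (hP : ∀ i, AnalyticAt ℂ (fun y => P y i) x) (hu : ∀ i, AnalyticAt ℂ (fun y => u y i) x) :
    AnalyticAt ℂ (fun y => F.formAlong (P y) (u y)) x := by
  unfold ProjFoliation.formAlong
  exact Finset.analyticAt_fun_sum _ fun i _ => (hu i).smul (AnalyticAt.aeval_mvPolynomial hP _)

theorem exists_implicit_path {z₀ v₀ : Fin (n + 1) → ℂ} (hv : F.form z₀ v₀ ≠ 0)
    (L : (Fin (n + 1) → ℂ) →L[ℂ] (Fin (n + 1) → ℂ)) :
    ∃ (q : (Fin (n + 1) → ℂ) → C(unitInterval, ℂ)), AnalyticAt ℂ q z₀ ∧ q z₀ = 0 ∧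
      ∀ᶠ z in nhds z₀, ∀ t : unitInterval,
        F.form (z + (t : ℝ) • L (z - z₀) - unitIntervalPrimitive (q z) t • v₀) v₀ ≠ 0 ∧
        F.form (z + (t : ℝ) • L (z - z₀) - unitIntervalPrimitive (q z) t • v₀)
          (L (z - z₀) - q z t • v₀) = 0 ∧ (L (z - z₀) = 0 → q z = 0) := by
  let tid : C(unitInterval, ℂ) := ⟨fun t => ((t : ℝ) : ℂ), by fun_prop⟩
  let P : (Fin (n + 1) → ℂ) × C(unitInterval, ℂ) → Fin (n + 1) → C(unitInterval, ℂ) := fun p i =>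
    (p.1 i) • (1 : C(unitInterval, ℂ)) + (L (p.1 - z₀) i) • tid - (v₀ i) • volterra p.2
  have hPt : ∀ z q (t : unitInterval), (fun i => P (z, q) i t) =
      z + (t : ℝ) • L (z - z₀) - unitIntervalPrimitive q t • v₀ := by
    intro z q t
    ext i
    simp [P, tid, volterra_apply, mul_comm]
  have hz : ∀ p : (Fin (n + 1) → ℂ) × C(unitInterval, ℂ), ∀ i, AnalyticAt ℂ
      (fun p : (Fin (n + 1) → ℂ) × C(unitInterval, ℂ) => p.1 i) p := fun p i =>
    ((ContinuousLinearMap.proj i : (Fin (n + 1) → ℂ) →L[ℂ] ℂ).comp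
      (ContinuousLinearMap.fst ℂ (Fin (n + 1) → ℂ) C(unitInterval, ℂ))).analyticAt p
  have hL : ∀ p : (Fin (n + 1) → ℂ) × C(unitInterval, ℂ), ∀ i, AnalyticAt ℂ
      (fun p : (Fin (n + 1) → ℂ) × C(unitInterval, ℂ) => L (p.1 - z₀) i) p := fun p i => by
    simp only [map_sub, Pi.sub_apply]
    exact (((ContinuousLinearMap.proj i : (Fin (n + 1) → ℂ) →L[ℂ] ℂ).comp (L.comp
      (ContinuousLinearMap.fst ℂ (Fin (n + 1) → ℂ) C(unitInterval, ℂ)))).analyticAt p).sub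
      analyticAt_const
  have hP : ∀ p i, AnalyticAt ℂ (fun p => P p i) p := fun p i =>
    (((hz p i).smul analyticAt_const).add ((hL p i).smul analyticAt_const)).sub
      ((volterra.comp (ContinuousLinearMap.snd ℂ (Fin (n + 1) → ℂ)
        C(unitInterval, ℂ))).analyticAt p |>.fun_const_smul)
  let N : (Fin (n + 1) → ℂ) × C(unitInterval, ℂ) → C(unitInterval, ℂ) := fun p =>
    F.formAlong (P p) (L (p.1 - z₀))
  let D : (Fin (n + 1) → ℂ) × C(unitInterval, ℂ) → C(unitInterval, ℂ) := fun p =>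
    F.formAlong (P p) v₀
  have hN : ∀ p, AnalyticAt ℂ N p := fun p => AnalyticAt.formAlong F (hP p) (hL p)
  have hD : ∀ p, AnalyticAt ℂ D p := fun p => AnalyticAt.formAlong F (hP p) fun _ =>
    analyticAt_const
  have hD0 : D (z₀, 0) = F.form z₀ v₀ • 1 := by
    ext t
    simp only [D, formAlong_apply, hPt]
    have h0 : unitIntervalPrimitive 0 t = 0 := by rw [← volterra_apply]; simp
    simp [h0]
  have hu : IsUnit (D (z₀, 0)) := by
    rw [hD0]
    exact ⟨⟨F.form z₀ v₀ • 1, (F.form z₀ v₀)⁻¹ • 1, by simp [smul_smul, hv],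
      by simp [smul_smul, hv]⟩, rfl⟩
  let G : (Fin (n + 1) → ℂ) × C(unitInterval, ℂ) → C(unitInterval, ℂ) := fun p =>
    p.2 - N p * Ring.inverse (D p)
  have hG : AnalyticAt ℂ G (z₀, 0) := by
    refine (analyticAt_snd).sub ((hN _).mul ?_)
    refine AnalyticAt.fun_comp (g := Ring.inverse) ?_ (hD _)
    obtain ⟨u, hu⟩ := hu
    rw [← hu]
    exact analyticAt_inverse u
  have hN0 : ∀ z q, L (z - z₀) = 0 → N (z, q) = 0 := fun z q h => by
    simp only [N, h]; exact Finset.sum_eq_zero fun i _ => by ext t; exact zero_mul _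
  have hG0 : ∀ q, G (z₀, q) = q := fun q => by simp [G, hN0]
  have hfd : (fderiv ℂ G (z₀, 0) ∘L .inr ℂ (Fin (n + 1) → ℂ) C(unitInterval, ℂ)) =
      ContinuousLinearMap.id ℂ C(unitInterval, ℂ) := by
    have h1 : HasFDerivAt (fun q : C(unitInterval, ℂ) => G (z₀, q))
        (fderiv ℂ G (z₀, 0) ∘L .inr ℂ (Fin (n + 1) → ℂ) C(unitInterval, ℂ)) 0 :=
      hG.differentiableAt.hasFDerivAt.comp (0 : C(unitInterval, ℂ))
        (hasFDerivAt_prodMk_right z₀ (0 : C(unitInterval, ℂ)))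
    simp only [hG0] at h1
    exact h1.unique (hasFDerivAt_id _)
  have hinv : (fderiv ℂ G (z₀, 0) ∘L .inr ℂ (Fin (n + 1) → ℂ) C(unitInterval, ℂ)).IsInvertible := by
    rw [hfd]; exact ⟨ContinuousLinearEquiv.refl ℂ C(unitInterval, ℂ), rfl⟩
  have hcd : ContDiffAt ℂ ⊤ G (z₀, (0 : C(unitInterval, ℂ))) := hG.contDiffAt
  have htop : (⊤ : WithTop ℕ∞) ≠ 0 := by simp
  set q := hcd.implicitFunction htop hinv with hq
  have hq0 : q z₀ = 0 := hcd.implicitFunction_apply_self htop hinv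
  have hqa : AnalyticAt ℂ q z₀ := (hcd.contDiffAt_implicitFunction htop hinv).analyticAt
  refine ⟨q, hqa, hq0, ?_⟩
  have e1 : ∀ᶠ z in nhds z₀, G (z, q z) = G (z₀, 0) :=
    hcd.eventually_apply_implicitFunction htop hinv
  have hc : ContinuousAt (fun z => D (z, q z)) z₀ := by
    refine ContinuousAt.comp (g := D) ?_ (continuousAt_id.prodMk hqa.continuousAt)
    rw [hq0]; exact (hD _).continuousAt
  have e2 : ∀ᶠ z in nhds z₀, IsUnit (D (z, q z)) := by
    refine hc.eventually (Units.isOpen.mem_nhds ?_)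
    change IsUnit (D (z₀, q z₀))
    rw [hq0]; exact hu
  filter_upwards [e1, e2] with z h1 h2 t
  rw [hG0] at h1
  have h3 : q z = N (z, q z) * Ring.inverse (D (z, q z)) := sub_eq_zero.1 h1
  have h4 : q z * D (z, q z) = N (z, q z) := by
    refine (congrArg (· * D (z, q z)) h3).trans ?_
    simp only [mul_assoc, Ring.inverse_mul_cancel _ h2, mul_one]
  have h5 := DFunLike.congr_fun h4 t
  simp only [ContinuousMap.mul_apply, N, D, formAlong_apply, hPt] at h5
  refine ⟨?_, ?_, ?_⟩
  · have h6 : D (z, q z) t ≠ 0 := (h2.map (ContinuousMap.evalAlgHom ℂ ℂ t)).ne_zero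
    simpa only [D, formAlong_apply, hPt] using h6
  · rw [map_sub, map_smul, ← h5, smul_eq_mul, sub_self]
  · intro h
    rw [h3, hN0 _ _ h, zero_mul]

end

end ProjFoliation

namespace ProjFoliation

section
variable {n d : ℕ} (F : ProjFoliation n d)

theorem hasFDerivAt_affinePath (L : (Fin (n + 1) → ℂ) →L[ℂ] (Fin (n + 1) → ℂ))
    (z₀ v₀ : Fin (n + 1) → ℂ) {g : (Fin (n + 1) → ℂ) → ℂ} {g' : (Fin (n + 1) → ℂ) →L[ℂ] ℂ}
    {z : Fin (n + 1) → ℂ} (hg : HasFDerivAt g g' z) (t : ℝ) :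
    HasFDerivAt (fun z => z + t • L (z - z₀) - g z • v₀)
      (ContinuousLinearMap.id ℂ _ + (t : ℂ) • L - g'.smulRight v₀) z := by
  have h1 : HasFDerivAt (fun z => L (z - z₀)) L z :=
    L.hasFDerivAt.comp z ((hasFDerivAt_id z).sub_const z₀)
  have h2 : HasFDerivAt (fun z => z + (t : ℂ) • L (z - z₀) - g z • v₀)
      (ContinuousLinearMap.id ℂ _ + (t : ℂ) • L - g'.smulRight v₀) z :=
    ((hasFDerivAt_id z).fun_add (h1.fun_const_smul (t : ℂ))).fun_sub (hg.smul_const v₀)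
  exact h2

theorem hasFDerivAt_affineVelocity (L : (Fin (n + 1) → ℂ) →L[ℂ] (Fin (n + 1) → ℂ))
    (z₀ v₀ : Fin (n + 1) → ℂ) {g : (Fin (n + 1) → ℂ) → ℂ} {g' : (Fin (n + 1) → ℂ) →L[ℂ] ℂ}
    {z : Fin (n + 1) → ℂ} (hg : HasFDerivAt g g' z) :
    HasFDerivAt (fun z => L (z - z₀) - g z • v₀) (L - g'.smulRight v₀) z := by
  have h1 : HasFDerivAt (fun z => L (z - z₀)) L z :=
    L.hasFDerivAt.comp z ((hasFDerivAt_id z).sub_const z₀)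
  exact h1.fun_sub (hg.smul_const v₀)

theorem form_variation {A B : (Fin (n + 1) → ℂ) → (Fin (n + 1) → ℂ)}
    {A' B' : (Fin (n + 1) → ℂ) →L[ℂ] (Fin (n + 1) → ℂ)} {z : Fin (n + 1) → ℂ}
    (hA : HasFDerivAt A A' z) (hB : HasFDerivAt B B' z)
    (h : ∀ᶠ y in nhds z, F.form (A y) (B y) = 0) (v : Fin (n + 1) → ℂ) :
    F.form (A z) (B' v) + fderiv ℂ F.form (A z) (A' v) (B z) = 0 := by
  have hC : HasFDerivAt (fun z => F.form (A z)) ((fderiv ℂ F.form (A z)).comp A') z :=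
    (F.analyticAt_form _).differentiableAt.hasFDerivAt.comp z hA
  exact DFunLike.congr_fun ((hC.clm_apply hB).unique
    ((hasFDerivAt_const (0:ℂ) z).congr_of_eventuallyEq h)) v

set_option maxHeartbeats 1000000 in
/-- Frobenius theorem: near a point where the form does not vanish on `v₀` there is a
holomorphic first integral, together with paths in its level sets joining each point to the
transversal line through `z₀` in the direction `v₀`. -/
theorem exists_flowBox {z₀ v₀ : Fin (n + 1) → ℂ} (hz₀ : z₀ ≠ 0) (hv : F.form z₀ v₀ ≠ 0) :
    ∃ (W W' : Set (Fin (n + 1) → ℂ)) (f : (Fin (n + 1) → ℂ) → ℂ)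
      (Z : (Fin (n + 1) → ℂ) × ℝ → (Fin (n + 1) → ℂ)),
      IsOpen W ∧ IsOpen W' ∧ z₀ ∈ W' ∧ W' ⊆ W ∧ (∀ z ∈ W, z ≠ 0 ∧ F.form z v₀ ≠ 0) ∧
      AnalyticOnNhd ℂ f W ∧
      (∀ z ∈ W, fderiv ℂ f z v₀ ≠ 0 ∧ ∀ v, F.form z v = 0 → fderiv ℂ f z v = 0) ∧
      (∀ s : ℂ, z₀ + s • v₀ ∈ W → f (z₀ + s • v₀) = s) ∧
      ContinuousOn Z (W' ×ˢ Icc 0 1) ∧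
      ∀ z ∈ W', Z (z, 0) = z ∧ Z (z, 1) = z₀ + f z • v₀ ∧
        ∀ t ∈ Icc (0:ℝ) 1, Z (z, t) ∈ W ∧ f (Z (z, t)) = f z := by
  set ℓ : (Fin (n + 1) → ℂ) →L[ℂ] ℂ := (F.form z₀ v₀)⁻¹ • F.form z₀ with hℓ
  have hℓv : ℓ v₀ = 1 := by simp [hℓ, hv]
  set L : (Fin (n + 1) → ℂ) →L[ℂ] (Fin (n + 1) → ℂ) :=
    ℓ.smulRight v₀ - ContinuousLinearMap.id ℂ _ with hL
  have hLa : ∀ v, L v = ℓ v • v₀ - v := fun v => by simp [hL]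
  obtain ⟨q, hqa, hq0, hq⟩ := F.exists_implicit_path hv L
  have hev : ∀ᶠ z in nhds z₀, AnalyticAt ℂ q z ∧ z ≠ 0 ∧ F.form z v₀ ≠ 0 ∧
      (∀ t : unitInterval,
        F.form (z + (t : ℝ) • L (z - z₀) - unitIntervalPrimitive (q z) t • v₀) v₀ ≠ 0 ∧
        F.form (z + (t : ℝ) • L (z - z₀) - unitIntervalPrimitive (q z) t • v₀)
          (L (z - z₀) - q z t • v₀) = 0 ∧ (L (z - z₀) = 0 → q z = 0)) :=
    hqa.eventually_analyticAt.and ((eventually_ne_nhds hz₀).and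
      (((F.continuous_form.clm_apply continuous_const).continuousAt.eventually_ne hv).and hq))
  obtain ⟨W, hWp, hWo, hzW⟩ := eventually_nhds_iff.1 hev
  set P : (Fin (n + 1) → ℂ) → ℝ → (Fin (n + 1) → ℂ) := fun z t =>
    z + t • L (z - z₀) - unitIntervalPrimitive (q z) t • v₀ with hPdef
  set f : (Fin (n + 1) → ℂ) → ℂ := fun z => ℓ (z - z₀) - volterra (q z) 1 with hf
  have hPd : ∀ z t, t ∈ Icc (0:ℝ) 1 →
      HasDerivAt (P z) (L (z - z₀) - IccExtend zero_le_one (q z) t • v₀) t := by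
    intro z t _
    have h1 : HasDerivAt (fun t : ℝ => t • L (z - z₀)) (L (z - z₀)) t := by
      simpa using (hasDerivAt_id t).smul_const (L (z - z₀))
    exact ((h1.const_add z).sub
      ((hasDerivAt_unitIntervalPrimitive (q z) t).smul_const v₀))
  have hP1 : ∀ z, P z 1 = z₀ + f z • v₀ := by
    intro z
    have : volterra (q z) 1 = unitIntervalPrimitive (q z) 1 := rfl
    simp only [hPdef, hf, hLa, this]
    module
  have hP0 : ∀ z, P z 0 = z := by
    intro z; simp [hPdef, unitIntervalPrimitive_zero]
  have htan : ∀ z ∈ W, ∀ t ∈ Icc (0:ℝ) 1, F.form (P z t) v₀ ≠ 0 ∧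
      F.form (P z t) (L (z - z₀) - IccExtend zero_le_one (q z) t • v₀) = 0 := by
    intro z hz t ht
    rw [IccExtend_of_mem _ _ ht]
    exact ⟨((hWp z hz).2.2.2 ⟨t, ht⟩).1, ((hWp z hz).2.2.2 ⟨t, ht⟩).2.1⟩
  have hfa : AnalyticOnNhd ℂ f W := fun z hz =>
    ((ℓ.analyticAt _).fun_comp (analyticAt_id.sub analyticAt_const)).sub
      ((((ContinuousMap.evalCLM ℂ (1 : unitInterval)).comp volterra).analyticAt _).fun_comp
        (hWp z hz).1)
  have hfd : ∀ z ∈ W, ∀ v, fderiv ℂ f z v = ℓ v - volterra (fderiv ℂ q z v) 1 := by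
    intro z hz v
    have h1 : HasFDerivAt f (ℓ - ((ContinuousMap.evalCLM ℂ (1 : unitInterval)).comp
        volterra).comp (fderiv ℂ q z)) z := by
      refine HasFDerivAt.fun_sub ?_ ?_
      · exact ℓ.hasFDerivAt.comp z ((hasFDerivAt_id z).sub_const z₀)
      · exact ((ContinuousMap.evalCLM ℂ (1 : unitInterval)).comp
          volterra).hasFDerivAt.comp z (hWp z hz).1.differentiableAt.hasFDerivAt
    rw [h1.fderiv]; rfl
  have hkey : ∀ z ∈ W, ∀ v, ∃ c ≠ 0,
      fderiv ℂ f z v * F.form (P z 1) v₀ = c * F.form z v := by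
    intro z hz v
    have hex := F.exists_form_eq_mul_of_tangent (P := P z)
      (Q := fun t => v + t • L v - unitIntervalPrimitive (fderiv ℂ q z v) t • v₀)
      (τ := fun t => L (z - z₀) - IccExtend zero_le_one (q z) t • v₀)
      (τ' := fun t => L v - IccExtend zero_le_one (fderiv ℂ q z v) t • v₀) (v₀ := v₀)
      (hPd z) ?hQ ?hc (fun t ht => (htan z hz t ht).2) (fun t ht => (htan z hz t ht).1) ?hd
    case hQ =>
      intro t _
      have h1 : HasDerivAt (fun t : ℝ => t • L v) (L v) t := by
        simpa using (hasDerivAt_id t).smul_const (L v)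
      exact ((h1.const_add v).sub
        ((hasDerivAt_unitIntervalPrimitive (fderiv ℂ q z v) t).smul_const v₀))
    case hc =>
      exact (continuous_const.sub ((q z).continuous.Icc_extend'.smul
        continuous_const)).continuousOn
    case hd =>
      intro t ht
      rw [IccExtend_of_mem _ _ ht, IccExtend_of_mem _ _ ht]
      set t' : unitInterval := ⟨t, ht⟩
      have hqd : HasFDerivAt q (fderiv ℂ q z) z := (hWp z hz).1.differentiableAt.hasFDerivAt
      have hA := hasFDerivAt_affinePath L z₀ v₀ ((((ContinuousMap.evalCLM ℂ t').comp
        volterra).hasFDerivAt (x := q z)).comp z hqd) t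
      have hB := hasFDerivAt_affineVelocity L z₀ v₀
        (((ContinuousMap.evalCLM ℂ t').hasFDerivAt (x := q z)).comp z hqd)
      have h0 : ∀ᶠ z in nhds z, F.form (P z t) (L (z - z₀) - q z t' • v₀) = 0 := by
        filter_upwards [hWo.mem_nhds hz] with y hy
        have := (htan y hy t ht).2
        rwa [IccExtend_of_mem _ _ ht] at this
      have h1 := F.form_variation hA hB h0 v
      simp only [add_apply, sub_apply, smul_apply, ContinuousLinearMap.smulRight_apply,
        ContinuousLinearMap.id_apply, ContinuousLinearMap.comp_apply] at h1
      exact h1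
    obtain ⟨c, hc, h⟩ := hex
    refine ⟨c, hc, ?_⟩
    rw [hP0] at h
    simp only [unitIntervalPrimitive_zero, zero_smul, add_zero, sub_zero, one_smul] at h
    rw [← h, hfd z hz]
    have : volterra (fderiv ℂ q z v) 1 = unitIntervalPrimitive (fderiv ℂ q z v) 1 := rfl
    rw [this, hLa, ← smul_eq_mul, ← map_smul]
    exact congrArg _ (by module)
  set Z : (Fin (n + 1) → ℂ) × ℝ → (Fin (n + 1) → ℂ) := fun p =>
    p.1 + p.2 • L (p.1 - z₀) - volterra (q p.1) (projIcc 0 1 zero_le_one p.2) • v₀ with hZ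
  have hZP : ∀ z, ∀ t ∈ Icc (0:ℝ) 1, Z (z, t) = P z t := by
    intro z t ht
    simp only [hZ, hPdef, projIcc_of_mem _ ht]
    rfl
  obtain ⟨ε, hε, hball⟩ := Metric.isOpen_iff.1 hWo z₀ hzW
  have hg : ContinuousAt (fun z => ‖L (z - z₀)‖ + ‖volterra (q z)‖ * ‖v₀‖ + dist z z₀) z₀ := by
    have : ContinuousAt q z₀ := hqa.continuousAt
    fun_prop
  have hg0 : ∀ᶠ z in nhds z₀, ‖L (z - z₀)‖ + ‖volterra (q z)‖ * ‖v₀‖ + dist z z₀ < ε := by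
    refine hg.eventually_lt continuousAt_const ?_
    simpa [hq0] using hε
  obtain ⟨W', hWp', hWo', hzW'⟩ := eventually_nhds_iff.1 hg0
  have hZW : ∀ z ∈ W', ∀ t ∈ Icc (0:ℝ) 1, Z (z, t) ∈ W := by
    intro z hz t ht
    apply hball
    rw [Metric.mem_ball]
    refine lt_of_le_of_lt ?_ (hWp' z hz)
    rw [dist_eq_norm, dist_eq_norm]
    have e1 : Z (z, t) - z₀ = (t • L (z - z₀) -
      volterra (q z) (projIcc 0 1 zero_le_one t) • v₀) + (z - z₀) := by simp only [hZ]; abel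
    rw [e1]
    refine (norm_add_le _ _).trans (add_le_add_left ((norm_sub_le _ _).trans ?_) _)
    refine add_le_add ?_ ?_
    · rw [norm_smul, Real.norm_of_nonneg ht.1]
      exact mul_le_of_le_one_left (norm_nonneg _) ht.2
    · rw [norm_smul]
      exact mul_le_mul_of_nonneg_right (ContinuousMap.norm_coe_le_norm _ _) (norm_nonneg _)
  have hWW : W' ⊆ W := by
    intro z hz
    have := hZW z hz 0 (left_mem_Icc.2 zero_le_one)
    rwa [hZP _ _ (left_mem_Icc.2 zero_le_one), hP0] at this
  have hfd' : ∀ z ∈ W, fderiv ℂ f z v₀ ≠ 0 ∧ ∀ v, F.form z v = 0 → fderiv ℂ f z v = 0 := by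
    intro z hz
    have h1 := (htan z hz 1 (right_mem_Icc.2 zero_le_one)).1
    constructor
    · obtain ⟨c, hc, h⟩ := hkey z hz v₀
      intro h0
      rw [h0, zero_mul] at h
      exact mul_ne_zero hc (hWp z hz).2.2.1 h.symm
    · intro v hv
      obtain ⟨c, hc, h⟩ := hkey z hz v
      rw [hv, mul_zero] at h
      exact (mul_eq_zero.1 h).resolve_right h1
  refine ⟨W, W', f, Z, hWo, hWo', hzW', hWW, fun z hz => ⟨(hWp z hz).2.1, (hWp z hz).2.2.1⟩,
    hfa, hfd', ?_, ?_, ?_⟩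
  · intro s hs
    have h0 : L (z₀ + s • v₀ - z₀) = 0 := by simp [hLa, hℓv]
    have h1 := ((hWp _ hs).2.2.2 0).2.2 h0
    simp [hf, h1, hℓv]
  · have hqc : ContinuousOn q W' := fun z hz =>
      (hWp z (hWW hz)).1.continuousAt.continuousWithinAt
    have h1 : ContinuousOn (fun p : (Fin (n + 1) → ℂ) × ℝ => volterra (q p.1)) (W' ×ˢ Icc 0 1) :=
      volterra.continuous.comp_continuousOn (hqc.comp continuousOn_fst fun p hp => hp.1)
    have h3 : Continuous (projIcc (0:ℝ) 1 zero_le_one) := continuous_projIcc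
    have h2 : ContinuousOn (fun p : (Fin (n + 1) → ℂ) × ℝ =>
        volterra (q p.1) (projIcc 0 1 zero_le_one p.2)) (W' ×ˢ Icc 0 1) :=
      ContinuousOn.eval h1 (h3.comp continuous_snd).continuousOn
    refine ContinuousOn.sub ?_ (h2.smul continuousOn_const)
    fun_prop
  · intro z hz
    refine ⟨by rw [hZP _ _ (left_mem_Icc.2 zero_le_one), hP0],
      by rw [hZP _ _ (right_mem_Icc.2 zero_le_one), hP1], fun t ht => ⟨hZW z hz t ht, ?_⟩⟩
    have hd : ∀ t ∈ Icc (0:ℝ) 1, HasDerivAt (fun t => f (P z t)) 0 t := by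
      intro t ht
      have hPW : P z t ∈ W := by rw [← hZP z t ht]; exact hZW z hz t ht
      have h2 : HasFDerivAt f ((fderiv ℂ f (P z t)).restrictScalars ℝ) (P z t) :=
        (hfa _ hPW).differentiableAt.hasFDerivAt.restrictScalars ℝ
      refine (h2.comp_hasDerivAt t (hPd z t ht)).congr_deriv ?_
      exact (hfd' _ hPW).2 _ (htan z (hWW hz) t ht).2
    have h := constant_of_has_deriv_right_zero
      (fun t ht => (hd t ht).continuousAt.continuousWithinAt)
      (fun t ht => (hd t (Ico_subset_Icc_self ht)).hasDerivWithinAt) t ht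
    rw [hZP z t ht, h, hP0]

end

end ProjFoliation

/-- A local section of a submersion: the level set `{f = c}` is met by the line through `z` in the
direction `w` at the parameter `σ (z, w, c)`. -/
theorem exists_transverse_parameter {E : Type*} [NormedAddCommGroup E] [NormedSpace ℂ E]
    [CompleteSpace E] {f : E → ℂ} {q v : E} (hf : AnalyticAt ℂ f q) (hv : fderiv ℂ f q v ≠ 0) :
    ∃ σ : E × E × ℂ → ℂ, AnalyticAt ℂ σ (q, v, f q) ∧ σ (q, v, f q) = 0 ∧
      (∀ᶠ x : E × E × ℂ in nhds (q, v, f q), f (x.1 + σ x • x.2.1) = x.2.2) ∧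
      ∀ᶠ x : (E × E × ℂ) × ℂ in nhds ((q, v, f q), 0),
        f (x.1.1 + x.2 • x.1.2.1) = x.1.2.2 ↔ σ x.1 = x.2 := by
  let G : (E × E × ℂ) × ℂ → ℂ := fun x => f (x.1.1 + x.2 • x.1.2.1) - x.1.2.2
  have hz : ∀ p : (E × E × ℂ) × ℂ, AnalyticAt ℂ (fun x : (E × E × ℂ) × ℂ =>
      x.1.1 + x.2 • x.1.2.1) p := fun p =>
    (analyticAt_fst.fun_comp analyticAt_fst).add
      (analyticAt_snd.smul ((analyticAt_fst.fun_comp analyticAt_snd).fun_comp analyticAt_fst))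
  have hG : AnalyticAt ℂ G ((q, v, f q), 0) := by
    refine AnalyticAt.sub (AnalyticAt.fun_comp (g := f) (by simpa using hf) (hz _)) ?_
    exact (analyticAt_snd.fun_comp analyticAt_snd).fun_comp analyticAt_fst
  have hG0 : G ((q, v, f q), 0) = 0 := by simp [G]
  have hfd : (fderiv ℂ G ((q, v, f q), 0) ∘L .inr ℂ (E × E × ℂ) ℂ) =
      ContinuousLinearMap.toSpanSingleton ℂ (fderiv ℂ f q v) := by
    have h1 : HasFDerivAt (fun s : ℂ => G ((q, v, f q), s))
        (fderiv ℂ G ((q, v, f q), 0) ∘L .inr ℂ (E × E × ℂ) ℂ) 0 :=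
      hG.differentiableAt.hasFDerivAt.comp (0 : ℂ) (hasFDerivAt_prodMk_right _ (0 : ℂ))
    have h3 : HasFDerivAt f (fderiv ℂ f q) (q + (0:ℂ) • v) := by
      simpa using hf.differentiableAt.hasFDerivAt
    have h2 : HasDerivAt (fun s : ℂ => f (q + s • v)) (fderiv ℂ f q v) 0 := by
      refine HasFDerivAt.comp_hasDerivAt (0:ℂ) h3 ?_
      simpa using ((hasDerivAt_id (0:ℂ)).smul_const v).const_add q
    exact h1.unique (h2.sub_const (f q)).hasFDerivAt
  have hinv : (fderiv ℂ G ((q, v, f q), 0) ∘L .inr ℂ (E × E × ℂ) ℂ).IsInvertible := by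
    rw [hfd]
    refine ⟨ContinuousLinearEquiv.unitsEquivAut ℂ (Units.mk0 _ hv), ?_⟩
    ext
    simp
  have hcd : ContDiffAt ℂ ⊤ G ((q, v, f q), (0:ℂ)) := hG.contDiffAt
  have htop : (⊤ : WithTop ℕ∞) ≠ 0 := by simp
  refine ⟨hcd.implicitFunction htop hinv,
    (hcd.contDiffAt_implicitFunction htop hinv).analyticAt,
    hcd.implicitFunction_apply_self htop hinv, ?_, ?_⟩
  · filter_upwards [hcd.eventually_apply_implicitFunction htop hinv] with x hx
    rw [hG0] at hx
    exact sub_eq_zero.1 hx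
  · filter_upwards [hcd.eventually_apply_eq_iff_implicitFunction htop hinv] with x hx
    rw [hG0] at hx
    rw [← hx, ← sub_eq_zero]

/-- A function whose differential vanishes on the kernel of the differential of a submersion `g`
is locally a function of `g`. -/
theorem exists_eventually_eq_comp {E : Type*} [NormedAddCommGroup E] [NormedSpace ℂ E]
    [CompleteSpace E] {f g : E → ℂ} {q v : E} (hg : AnalyticAt ℂ g q) (hv : fderiv ℂ g q v ≠ 0)
    (hf : ∀ᶠ z in nhds q, DifferentiableAt ℂ f z ∧
      ∀ u, fderiv ℂ g z u = 0 → fderiv ℂ f z u = 0) :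
    ∃ κ : ℂ → ℂ, AnalyticAt ℂ κ (g q) ∧ ∀ᶠ z in nhds q, f z = κ (g z) := by
  obtain ⟨σ, hσ, hσ0, hσ1, hσ2⟩ := exists_transverse_parameter hg hv
  have hga : ∀ᶠ z in nhds q, AnalyticAt ℂ g z := hg.eventually_analyticAt
  set Y : E × ℂ → E := fun x => x.1 + σ (x.1, v, x.2) • v with hY
  have hι : Filter.Tendsto (fun x : E × ℂ => (x.1, v, x.2)) (nhds (q, g q))
      (nhds (q, v, g q)) :=
    Continuous.tendsto' (by fun_prop) _ _ rfl
  have hYc : Filter.Tendsto Y (nhds (q, g q)) (nhds q) := by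
    have h1 : ContinuousAt Y (q, g q) := by
      refine continuousAt_fst.add (ContinuousAt.smul ?_ continuousAt_const)
      exact ContinuousAt.comp (g := σ) hσ.continuousAt hι
    simpa [hY, hσ0] using h1.tendsto
  have hall : ∀ᶠ x : E × ℂ in nhds (q, g q), AnalyticAt ℂ σ (x.1, v, x.2) ∧
      (AnalyticAt ℂ g (Y x) ∧ DifferentiableAt ℂ f (Y x) ∧
        ∀ u, fderiv ℂ g (Y x) u = 0 → fderiv ℂ f (Y x) u = 0) ∧ g (Y x) = x.2 :=
    (hι.eventually hσ.eventually_analyticAt).and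
      ((hYc.eventually (hga.and hf)).and (hι.eventually hσ1))
  obtain ⟨ε, hε, hball⟩ := Metric.eventually_nhds_iff_ball.1 hall
  have hmem : ∀ z ∈ Metric.ball q ε, ∀ c ∈ Metric.ball (g q) ε,
      (z, c) ∈ Metric.ball (q, g q) ε := by
    intro z hz c hc
    rw [← ball_prod_same]
    exact ⟨hz, hc⟩
  have hYd : ∀ x ∈ Metric.ball (q, g q) ε, DifferentiableAt ℂ Y x := by
    intro x hx
    have h1 : DifferentiableAt ℂ (fun x : E × ℂ => (x.1, v, x.2)) x := by fun_prop
    exact differentiableAt_fst.add ((DifferentiableAt.comp x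
      (hball x hx).1.differentiableAt h1).smul_const v)
  have hconst : ∀ c ∈ Metric.ball (g q) ε, ∀ z ∈ Metric.ball q ε,
      f (Y (z, c)) = f (Y (q, c)) := by
    intro c hc z hz
    have hYz : ∀ z ∈ Metric.ball q ε, HasFDerivAt (fun z => Y (z, c))
        (fderiv ℂ Y (z, c) ∘L .inl ℂ E ℂ) z := fun z hz =>
      HasFDerivAt.comp (g := Y) (f := fun z => (z, c)) z (hYd _ (hmem z hz c hc)).hasFDerivAt
        (hasFDerivAt_prodMk_left z c)
    refine (convex_ball q ε).is_const_of_fderivWithin_eq_zero (𝕜 := ℂ)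
      (f := fun z => f (Y (z, c))) ?_ ?_ hz (Metric.mem_ball_self hε)
    · intro z hz
      exact (((hball _ (hmem z hz c hc)).2.1.2.1).comp z
        (hYz z hz).differentiableAt).differentiableWithinAt
    · intro z hz
      rw [fderivWithin_of_isOpen Metric.isOpen_ball hz]
      have hb := hball _ (hmem z hz c hc)
      have h1 : HasFDerivAt (fun z => f (Y (z, c))) _ z :=
        hb.2.1.2.1.hasFDerivAt.comp z (hYz z hz)
      have h2 : HasFDerivAt (fun z => g (Y (z, c))) _ z :=
        hb.2.1.1.differentiableAt.hasFDerivAt.comp z (hYz z hz)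
      have h3 : HasFDerivAt (fun z => g (Y (z, c))) (0 : E →L[ℂ] ℂ) z := by
        refine (hasFDerivAt_const c z).congr_of_eventuallyEq ?_
        filter_upwards [Metric.isOpen_ball.mem_nhds hz] with y hy
        exact (hball _ (hmem y hy c hc)).2.2
      rw [h1.fderiv]
      ext u
      exact hb.2.1.2.2 _ (DFunLike.congr_fun (h2.unique h3) u)
  have hκ : AnalyticAt ℂ (fun c => f (Y (q, c))) (g q) := by
    refine DifferentiableOn.analyticAt (s := Metric.ball (g q) ε) ?_
      (Metric.ball_mem_nhds _ hε)
    intro c hc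
    have h1 := hmem q (Metric.mem_ball_self hε) c hc
    have h2 : DifferentiableAt ℂ (fun c : ℂ => (q, c)) c := by fun_prop
    exact ((hball _ h1).2.1.2.1.comp c ((hYd _ h1).comp c h2)).differentiableWithinAt
  refine ⟨_, hκ, ?_⟩
  have hgq : ∀ᶠ z in nhds q, g z ∈ Metric.ball (g q) ε :=
    hg.continuousAt.eventually (Metric.ball_mem_nhds _ hε)
  have hι2 : Filter.Tendsto (fun z : E => ((z, v, g z), (0:ℂ))) (nhds q)
      (nhds ((q, v, g q), 0)) := by
    have : ContinuousAt (fun z : E => ((z, v, g z), (0:ℂ))) q :=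
      (continuousAt_id.prodMk (continuousAt_const.prodMk hg.continuousAt)).prodMk
        continuousAt_const
    exact this
  filter_upwards [hgq, Metric.ball_mem_nhds _ hε, hι2.eventually hσ2] with z h1 h2 h3
  have h4 : σ (z, v, g z) = 0 := h3.1 (by simp)
  rw [← hconst _ h1 z h2]
  simp [hY, h4]

namespace ProjFoliation

section
variable {n d : ℕ} (F : ProjFoliation n d)

/-- `f` is a holomorphic submersion on the open set `U` of regular points, constant along the
leaves of `F`. -/
structure IsFirstIntegral (f : (Fin (n + 1) → ℂ) → ℂ) (U : Set (Fin (n + 1) → ℂ)) : Prop where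
  isOpen : IsOpen U
  ne_zero : ∀ z ∈ U, z ≠ 0
  form_ne_zero : ∀ z ∈ U, F.form z ≠ 0
  differentiableAt : ∀ z ∈ U, DifferentiableAt ℂ f z
  fderiv_ne_zero : ∀ z ∈ U, fderiv ℂ f z ≠ 0
  fderiv_eq_zero : ∀ z ∈ U, ∀ v, F.form z v = 0 → fderiv ℂ f z v = 0

variable {F}
variable {f g : (Fin (n + 1) → ℂ) → ℂ} {U V : Set (Fin (n + 1) → ℂ)} {p q x y z : Fin (n + 1) → ℂ}

theorem form_eq_zero_iff : F.form z = 0 ↔ ∀ i, eval z (F.a i) = 0 := by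
  constructor
  · intro h i
    have := DFunLike.congr_fun h (Pi.single i 1)
    simpa [form_apply, Pi.single_apply] using this
  · intro h
    ext v
    simp [form_apply, h]

theorem not_mem_singCone (hz : F.form z ≠ 0) : z ∉ F.singCone := fun h =>
  hz (form_eq_zero_iff.2 h.2)

theorem IsFirstIntegral.fderiv_mul (hf : F.IsFirstIntegral f U) (hz : z ∈ U)
    (v w : Fin (n + 1) → ℂ) :
    F.form z v * fderiv ℂ f z w = F.form z w * fderiv ℂ f z v := by
  have h := hf.fderiv_eq_zero z hz (F.form z v • w - F.form z w • v) (by simp [mul_comm])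
  simpa [sub_eq_zero] using h

theorem IsFirstIntegral.fderiv_apply_eq_zero_iff (hf : F.IsFirstIntegral f U) (hz : z ∈ U)
    {v : Fin (n + 1) → ℂ} : fderiv ℂ f z v = 0 ↔ F.form z v = 0 := by
  refine ⟨fun h => ?_, hf.fderiv_eq_zero z hz v⟩
  by_contra h1
  apply hf.fderiv_ne_zero z hz
  ext w
  have := hf.fderiv_mul hz v w
  rw [h, mul_zero] at this
  simpa using (mul_eq_zero.1 this).resolve_left h1

theorem plaqueRel_iff : F.PlaqueRel p q ↔ ∃ U f, F.IsFirstIntegral f U ∧ p ∈ U ∧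
    q ∈ connectedComponentIn {z ∈ U | f z = f p} p := by
  constructor
  · rintro ⟨U, hU, h0, hs, f, hd, hf, hw, hp, hq⟩
    have hreg : ∀ z ∈ U, F.form z ≠ 0 := fun z hz h =>
      disjoint_left.1 hs hz ⟨h0 z hz, form_eq_zero_iff.1 h⟩
    refine ⟨U, f, ⟨hU, h0, hreg, fun z hz => (hd z hz).differentiableAt (hU.mem_nhds hz), hf, ?_⟩,
      hp, hq⟩
    intro z hz v hv
    obtain ⟨w, hw'⟩ : ∃ w, F.form z w ≠ 0 := by
      by_contra! h
      exact hreg z hz (by ext w; exact h w)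
    have := hw z hz v w
    rw [← form_apply, ← form_apply, hv, zero_mul] at this
    exact (mul_eq_zero.1 this.symm).resolve_left hw'
  · rintro ⟨U, f, hf, hp, hq⟩
    refine ⟨U, hf.isOpen, hf.ne_zero, ?_, f, fun z hz =>
      (hf.differentiableAt z hz).differentiableWithinAt, hf.fderiv_ne_zero, ?_, hp, hq⟩
    · exact disjoint_left.2 fun z hz => not_mem_singCone (hf.form_ne_zero z hz)
    · intro z hz v w
      rw [← form_apply, ← form_apply]
      exact hf.fderiv_mul hz v w

theorem PlaqueRel.symm (h : F.PlaqueRel p q) : F.PlaqueRel q p := by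
  rw [plaqueRel_iff] at h ⊢
  obtain ⟨U, f, hf, hp, hq⟩ := h
  have h1 := connectedComponentIn_subset _ _ hq
  refine ⟨U, f, hf, h1.1, ?_⟩
  rw [h1.2, ← connectedComponentIn_eq hq]
  exact mem_connectedComponentIn ⟨hp, rfl⟩

theorem mem_leaf_self : p ∈ F.leaf p := Relation.ReflTransGen.refl

theorem mem_leaf_trans (h : q ∈ F.leaf p) (h' : x ∈ F.leaf q) : x ∈ F.leaf p :=
  Relation.ReflTransGen.trans h h'

theorem mem_leaf_symm (h : q ∈ F.leaf p) : p ∈ F.leaf q := by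
  have : Std.Symm F.PlaqueRel := ⟨fun _ _ h => h.symm⟩
  exact Std.Symm.symm (r := Relation.ReflTransGen F.PlaqueRel) _ _ h

theorem isPreconnected_image_path {Z : (Fin (n + 1) → ℂ) × ℝ → Fin (n + 1) → ℂ}
    {W : Set (Fin (n + 1) → ℂ)} (hZ : ContinuousOn Z (W ×ˢ Icc 0 1)) (hx : x ∈ W) :
    IsPreconnected ((fun t => Z (x, t)) '' Icc 0 1) := by
  refine isPreconnected_Icc.image _ (hZ.comp (by fun_prop) fun t ht => ⟨hx, ht⟩)

/-- Near a regular point there is an analytic first integral whose level sets are plaques. -/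
theorem exists_firstIntegral (hz : z ≠ 0) (hz' : F.form z ≠ 0) :
    ∃ W f, F.IsFirstIntegral f W ∧ z ∈ W ∧ AnalyticOnNhd ℂ f W ∧
      ∃ W' ∈ nhds z, ∀ x ∈ W', ∀ y ∈ W', f x = f y → F.PlaqueRel x y := by
  obtain ⟨v₀, hv₀⟩ : ∃ w, F.form z w ≠ 0 := by
    by_contra! h
    exact hz' (by ext w; exact h w)
  obtain ⟨W, W', f, Z, hW, hW', hzW', hWW, hreg, hfa, hfd, -, hZc, hZ⟩ :=
    F.exists_flowBox hz hv₀
  have hf : F.IsFirstIntegral f W := ⟨hW, fun z hz => (hreg z hz).1,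
    fun z hz h => (hreg z hz).2 (by simp [h]), fun z hz => (hfa z hz).differentiableAt,
    fun z hz h => (hfd z hz).1 (by simp [h]), fun z hz => (hfd z hz).2⟩
  refine ⟨W, f, hf, hWW hzW', hfa, W', hW'.mem_nhds hzW', fun x hx y hy hxy => ?_⟩
  refine plaqueRel_iff.2 ⟨W, f, hf, hWW hx, ?_⟩
  have hsub : ∀ x ∈ W', (fun t => Z (x, t)) '' Icc 0 1 ⊆ {z ∈ W | f z = f x} := by
    rintro x hx _ ⟨t, ht, rfl⟩
    exact (hZ x hx).2.2 t ht
  have h0 : ∀ x ∈ W', x ∈ (fun t => Z (x, t)) '' Icc 0 1 := fun x hx =>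
    ⟨0, by simp, (hZ x hx).1⟩
  have h1 : ∀ x ∈ W', z + f x • v₀ ∈ (fun t => Z (x, t)) '' Icc 0 1 := fun x hx =>
    ⟨1, by simp, (hZ x hx).2.1⟩
  have hy' := hsub y hy
  rw [← hxy] at hy'
  have hpre := (isPreconnected_image_path hZc hx).union (z + f x • v₀) (h1 x hx)
    (by rw [hxy]; exact h1 y hy) (isPreconnected_image_path hZc hy)
  exact hpre.subset_connectedComponentIn (Or.inl (h0 x hx)) (union_subset (hsub x hx) hy')
    (Or.inr (h0 y hy))

theorem IsFirstIntegral.exists_form_ne_zero (hf : F.IsFirstIntegral f U) (hz : z ∈ U) :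
    ∃ v, F.form z v ≠ 0 := by
  by_contra! h
  exact hf.form_ne_zero z hz (by ext w; exact h w)

/-- First integrals are analytic. -/
theorem IsFirstIntegral.analyticAt (hf : F.IsFirstIntegral f U) (hz : z ∈ U) :
    AnalyticAt ℂ f z := by
  obtain ⟨W, g, hg, hzW, hga, -⟩ :=
    exists_firstIntegral (hf.ne_zero z hz) (hf.form_ne_zero z hz)
  obtain ⟨v, hv⟩ := hf.exists_form_ne_zero hz
  obtain ⟨κ, hκ, h⟩ := exists_eventually_eq_comp (f := f) (hga z hzW)
    (mt (hg.fderiv_apply_eq_zero_iff hzW).1 hv) (by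
      filter_upwards [hf.isOpen.mem_nhds hz, hg.isOpen.mem_nhds hzW] with y hy hy'
      exact ⟨hf.differentiableAt y hy, fun u hu =>
        hf.fderiv_eq_zero y hy u ((hg.fderiv_apply_eq_zero_iff hy').1 hu)⟩)
  exact (hκ.comp (hga z hzW)).congr (h.mono fun _ h => h.symm)

/-- Two first integrals differ locally by a biholomorphism of the target. -/
theorem IsFirstIntegral.exists_comp (hf : F.IsFirstIntegral f U) (hg : F.IsFirstIntegral g V)
    (hzU : z ∈ U) (hzV : z ∈ V) :
    ∃ κ : ℂ → ℂ, AnalyticAt ℂ κ (g z) ∧ deriv κ (g z) ≠ 0 ∧ ∀ᶠ y in nhds z, f y = κ (g y) := by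
  obtain ⟨v, hv⟩ := hf.exists_form_ne_zero hzU
  obtain ⟨κ, hκ, h⟩ := exists_eventually_eq_comp (f := f) (hg.analyticAt hzV)
    (mt (hg.fderiv_apply_eq_zero_iff hzV).1 hv) (by
      filter_upwards [hf.isOpen.mem_nhds hzU, hg.isOpen.mem_nhds hzV] with y hy hy'
      exact ⟨hf.differentiableAt y hy, fun u hu =>
        hf.fderiv_eq_zero y hy u ((hg.fderiv_apply_eq_zero_iff hy').1 hu)⟩)
  refine ⟨κ, hκ, fun h0 => ?_, h⟩
  have h1 : HasFDerivAt (fun y => κ (g y)) (deriv κ (g z) • fderiv ℂ g z) z :=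
    hκ.differentiableAt.hasDerivAt.comp_hasFDerivAt z (hg.differentiableAt z hzV).hasFDerivAt
  apply hf.fderiv_ne_zero z hzU
  rw [Filter.EventuallyEq.fderiv_eq h, h1.fderiv, h0]
  ext u
  exact zero_mul _

theorem _root_.AnalyticAt.eventually_eq_iff {κ : ℂ → ℂ} {c : ℂ} (hκ : AnalyticAt ℂ κ c)
    (hκ' : deriv κ c ≠ 0) : ∀ᶠ p : ℂ × ℂ in nhds (c, c), κ p.1 = κ p.2 ↔ p.1 = p.2 := by
  have h : HasStrictDerivAt κ (deriv κ c) c := hκ.hasStrictDerivAt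
  have h1 := h.hasStrictFDerivAt_equiv hκ'
  rw [nhds_prod_eq]
  have hs := (h1.toOpenPartialHomeomorph κ).open_source.mem_nhds
    h1.mem_toOpenPartialHomeomorph_source
  filter_upwards [Filter.prod_mem_prod hs hs] with p hp
  exact ⟨fun h => (h1.toOpenPartialHomeomorph κ).injOn hp.1 hp.2 h, fun h => h ▸ rfl⟩

/-- Near a point, the level sets of a first integral are contained in plaques. -/
theorem IsFirstIntegral.exists_nhds_plaqueRel (hf : F.IsFirstIntegral f U) (hz : z ∈ U) :
    ∃ N ∈ nhds z, ∀ x ∈ N, ∀ y ∈ N, f x = f y → F.PlaqueRel x y := by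
  obtain ⟨W, g, hg, hzW, -, W', hW', h⟩ :=
    exists_firstIntegral (hf.ne_zero z hz) (hf.form_ne_zero z hz)
  obtain ⟨κ, hκ, hκ', hfκ⟩ := hf.exists_comp hg hz hzW
  have hinj := hκ.eventually_eq_iff hκ'
  rw [nhds_prod_eq] at hinj
  obtain ⟨p, hp, p', hp', hpp⟩ := Filter.eventually_prod_iff.1 hinj
  have hc := (hg.differentiableAt z hzW).continuousAt
  refine ⟨_, Filter.inter_mem (Filter.inter_mem hW' hfκ)
    (Filter.inter_mem (hc.eventually hp) (hc.eventually hp')), ?_⟩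
  rintro x ⟨⟨hx1, hx2⟩, hx3, hx4⟩ y ⟨⟨hy1, hy2⟩, hy3, hy4⟩ hxy
  refine h x hx1 y hy1 ((hpp hx3 hy4).1 ?_)
  simp only [mem_ofPred_eq] at hx2 hy2
  rw [← hx2, ← hy2, hxy]

end

end ProjFoliation

theorem AnalyticAt.exists_local_inverse {κ : ℂ → ℂ} {c : ℂ} (hκ : AnalyticAt ℂ κ c)
    (hκ' : deriv κ c ≠ 0) : ∃ τ : ℂ → ℂ, AnalyticAt ℂ τ (κ c) ∧ τ (κ c) = c ∧
      deriv τ (κ c) ≠ 0 ∧ (∀ᶠ x in nhds c, τ (κ x) = x) ∧ ∀ᶠ y in nhds (κ c), κ (τ y) = y := by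
  have h := hκ.hasStrictDerivAt
  refine ⟨h.localInverse _ _ _ hκ', hκ.analyticAt_localInverse hκ',
    HasStrictFDerivAt.localInverse_apply_image .., ?_, h.eventually_left_inverse hκ',
    h.eventually_right_inverse hκ'⟩
  rw [(h.to_localInverse hκ').hasDerivAt.deriv]
  exact inv_ne_zero hκ'

namespace ProjFoliation

section
variable {n d : ℕ} {F : ProjFoliation n d}
variable {f g : (Fin (n + 1) → ℂ) → ℂ} {U V : Set (Fin (n + 1) → ℂ)} {p q x y z : Fin (n + 1) → ℂ}

theorem IsFirstIntegral.analyticAt_comp_line (hf : F.IsFirstIntegral f U) (hz : z ∈ U)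
    (v : Fin (n + 1) → ℂ) : AnalyticAt ℂ (fun s : ℂ => f (z + s • v)) 0 := by
  refine AnalyticAt.fun_comp (g := f) (by simpa using hf.analyticAt hz) ?_
  exact analyticAt_const.add (analyticAt_id.smul analyticAt_const)

theorem IsFirstIntegral.deriv_comp_line (hf : F.IsFirstIntegral f U) (hz : z ∈ U)
    (v : Fin (n + 1) → ℂ) : deriv (fun s : ℂ => f (z + s • v)) 0 = fderiv ℂ f z v := by
  have h3 : HasFDerivAt f (fderiv ℂ f z) (z + (0:ℂ) • v) := by
    simpa using (hf.differentiableAt z hz).hasFDerivAt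
  refine (HasFDerivAt.comp_hasDerivAt (0:ℂ) h3 ?_).deriv
  simpa using ((hasDerivAt_id (0:ℂ)).smul_const v).const_add z

/-- A transversal to the leaves meets every nearby level of a first integral. -/
theorem IsFirstIntegral.exists_section (hf : F.IsFirstIntegral f U) (hz : z ∈ U)
    {v : Fin (n + 1) → ℂ} (hv : F.form z v ≠ 0) :
    ∃ σ : ℂ → ℂ, AnalyticAt ℂ σ (f z) ∧ σ (f z) = 0 ∧ deriv σ (f z) ≠ 0 ∧
      (∀ᶠ c in nhds (f z), f (z + σ c • v) = c) ∧
      ∀ᶠ s in nhds (0:ℂ), σ (f (z + s • v)) = s := by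
  have h := (hf.analyticAt_comp_line hz v).exists_local_inverse
    (by rw [hf.deriv_comp_line hz]; exact mt (hf.fderiv_apply_eq_zero_iff hz).1 hv)
  obtain ⟨σ, h1, h2, h3, h4, h5⟩ := h
  simp only [zero_smul, add_zero] at h1 h2 h3 h5
  exact ⟨σ, h1, h2, h3, h5, h4⟩

variable (F) in
/-- Points near `p` and near `q` lie on the same leaf as soon as the values of first integrals
correspond under a suitable local biholomorphism of `ℂ`. -/
def GermRel (p q : Fin (n + 1) → ℂ) : Prop :=
  ∀ f U g V, F.IsFirstIntegral f U → p ∈ U → F.IsFirstIntegral g V → q ∈ V →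
    ∃ ψ : ℂ → ℂ, AnalyticAt ℂ ψ (f p) ∧ ψ (f p) = g q ∧ deriv ψ (f p) ≠ 0 ∧
      ∀ᶠ x : (Fin (n + 1) → ℂ) × (Fin (n + 1) → ℂ) in nhds (p, q),
        g x.2 = ψ (f x.1) → x.2 ∈ F.leaf x.1

/-- Points of a common leaf inside a set on which a first integral is defined. -/
theorem IsFirstIntegral.germRel (hf : F.IsFirstIntegral f U) {N : Set (Fin (n + 1) → ℂ)}
    (hN : IsOpen N) (hNf : ∀ x ∈ N, ∀ y ∈ N, f x = f y → y ∈ F.leaf x) (hp : p ∈ N) (hq : q ∈ N)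
    (hpU : p ∈ U) (hqU : q ∈ U) (hpq : f p = f q) : F.GermRel p q := by
  intro f₁ U₁ f₂ U₂ hf₁ hp₁ hf₂ hq₂
  obtain ⟨κ₁, h₁, h₁', he₁⟩ := hf.exists_comp hf₁ hpU hp₁
  obtain ⟨κ₂, h₂, h₂', he₂⟩ := hf₂.exists_comp hf hq₂ hqU
  have hκ₁ : κ₁ (f₁ p) = f q := by rw [← he₁.self_of_nhds, hpq]
  have hinj := h₂.eventually_eq_iff h₂'
  refine ⟨fun c => κ₂ (κ₁ c), AnalyticAt.fun_comp (g := κ₂) (by rwa [hκ₁]) h₁, ?_, ?_, ?_⟩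
  · simp only [hκ₁, he₂.self_of_nhds]
  · have := (((hκ₁ ▸ h₂ :).differentiableAt).hasDerivAt.comp _ h₁.differentiableAt.hasDerivAt).deriv
    change deriv (κ₂ ∘ κ₁) _ ≠ 0
    rw [this, hκ₁]
    exact mul_ne_zero h₂' h₁'
  · have hc : Filter.Tendsto (fun x : (Fin (n + 1) → ℂ) × (Fin (n + 1) → ℂ) => (f x.2, f x.1))
        (nhds (p, q)) (nhds (f q, f q)) := by
      rw [nhds_prod_eq, nhds_prod_eq]
      have e1 := (hf.differentiableAt q hqU).continuousAt
      have e2 := (hf.differentiableAt p hpU).continuousAt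
      rw [ContinuousAt, hpq] at e2
      exact (e1.tendsto.comp Filter.tendsto_snd).prodMk (e2.comp Filter.tendsto_fst)
    have hx1 : ∀ᶠ x : (Fin (n + 1) → ℂ) × (Fin (n + 1) → ℂ) in nhds (p, q),
        x.1 ∈ N ∧ f x.1 = κ₁ (f₁ x.1) :=
      Filter.Tendsto.eventually (p := fun x => x ∈ N ∧ f x = κ₁ (f₁ x)) continuousAt_fst
        ((hN.eventually_mem hp).and he₁)
    have hx2 : ∀ᶠ x : (Fin (n + 1) → ℂ) × (Fin (n + 1) → ℂ) in nhds (p, q),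
        x.2 ∈ N ∧ f₂ x.2 = κ₂ (f x.2) :=
      Filter.Tendsto.eventually (p := fun x => x ∈ N ∧ f₂ x = κ₂ (f x)) continuousAt_snd
        ((hN.eventually_mem hq).and he₂)
    filter_upwards [hc.eventually hinj, hx1, hx2] with x h3 h4 h5 h6
    refine hNf _ h4.1 _ h5.1 (h3.1 ?_).symm
    rw [← h5.2, h6, h4.2]

theorem GermRel.trans (h₁ : F.GermRel p q) (h₂ : F.GermRel q z) (hq : q ≠ 0)
    (hq' : F.form q ≠ 0) : F.GermRel p z := by
  intro f U g V hf hp hg hz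
  obtain ⟨W, k, hk, hqW, -⟩ := exists_firstIntegral hq hq'
  obtain ⟨v, hv⟩ := hk.exists_form_ne_zero hqW
  obtain ⟨ψ₁, a₁, b₁, c₁, e₁⟩ := h₁ f U k W hf hp hk hqW
  obtain ⟨ψ₂, a₂, b₂, c₂, e₂⟩ := h₂ k W g V hk hqW hg hz
  obtain ⟨σ, hσ, hσ0, -, hσ1, -⟩ := hk.exists_section hqW hv
  rw [← b₁] at a₂ c₂ hσ1 hσ
  refine ⟨fun c => ψ₂ (ψ₁ c), AnalyticAt.fun_comp (g := ψ₂) a₂ a₁, by simp only [b₁, b₂], ?_, ?_⟩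
  · have := (a₂.differentiableAt.hasDerivAt.comp _ a₁.differentiableAt.hasDerivAt).deriv
    change deriv (ψ₂ ∘ ψ₁) _ ≠ 0
    rw [this]
    exact mul_ne_zero c₂ c₁
  · have hfc : Filter.Tendsto (fun x : Fin (n + 1) → ℂ => ψ₁ (f x)) (nhds p)
        (nhds (ψ₁ (f p))) :=
      a₁.continuousAt.tendsto.comp (hf.differentiableAt p hp).continuousAt
    have hyc : Filter.Tendsto (fun x : Fin (n + 1) → ℂ => q + σ (ψ₁ (f x)) • v) (nhds p)
        (nhds q) := by
      have h1 : ContinuousAt (fun c => q + σ c • v) (ψ₁ (f p)) :=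
        continuousAt_const.add (hσ.continuousAt.smul continuousAt_const)
      have h2 : q + σ (ψ₁ (f p)) • v = q := by rw [b₁, hσ0]; simp
      rw [ContinuousAt, h2] at h1
      exact h1.comp hfc
    have hc1 : Filter.Tendsto (fun x : (Fin (n + 1) → ℂ) × (Fin (n + 1) → ℂ) =>
        (x.1, q + σ (ψ₁ (f x.1)) • v)) (nhds (p, z)) (nhds (p, q)) := by
      rw [nhds_prod_eq, nhds_prod_eq]
      exact Filter.tendsto_fst.prodMk (hyc.comp Filter.tendsto_fst)
    have hc2 : Filter.Tendsto (fun x : (Fin (n + 1) → ℂ) × (Fin (n + 1) → ℂ) =>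
        (q + σ (ψ₁ (f x.1)) • v, x.2)) (nhds (p, z)) (nhds (q, z)) := by
      rw [nhds_prod_eq, nhds_prod_eq]
      exact (hyc.comp Filter.tendsto_fst).prodMk Filter.tendsto_snd
    filter_upwards [hc1.eventually e₁, hc2.eventually e₂,
      continuousAt_fst.eventually (hfc.eventually hσ1)] with x h1 h2 h3 h4
    refine mem_leaf_trans (h1 h3) (h2 ?_)
    rw [h3, h4]

theorem PlaqueRel.regular (h : F.PlaqueRel p q) : q ≠ 0 ∧ F.form q ≠ 0 := by
  obtain ⟨U, f, hf, hp, hq⟩ := plaqueRel_iff.1 h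
  have h1 := connectedComponentIn_subset _ _ hq
  exact ⟨hf.ne_zero q h1.1, hf.form_ne_zero q h1.1⟩

theorem GermRel.of_plaqueRel (h : F.PlaqueRel p q) : F.GermRel p q := by
  obtain ⟨U, f, hf, hp, hq⟩ := plaqueRel_iff.1 h
  have hp' : p ∈ {z ∈ U | f z = f p} := ⟨hp, rfl⟩
  have hS := connectedComponentIn_subset {z ∈ U | f z = f p} p
  refine (isPreconnected_connectedComponentIn (F := {z ∈ U | f z = f p})
    (x := p)).induction₂' F.GermRel ?_ ?_ (mem_connectedComponentIn hp') hq
  · intro x hx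
    obtain ⟨N, hN, hNf⟩ := hf.exists_nhds_plaqueRel (hS hx).1
    obtain ⟨O, hON, hO, hxO⟩ := mem_nhds_iff.1 hN
    have hl : ∀ x ∈ O, ∀ y ∈ O, f x = f y → y ∈ F.leaf x := fun x hx y hy hxy =>
      Relation.ReflTransGen.single (hNf x (hON hx) y (hON hy) hxy)
    filter_upwards [self_mem_nhdsWithin, nhdsWithin_le_nhds (hO.mem_nhds hxO)] with y hy hyO
    have e : f x = f y := (hS hx).2.trans (hS hy).2.symm
    exact ⟨hf.germRel hO hl hxO hyO (hS hx).1 (hS hy).1 e,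
      hf.germRel hO hl hyO hxO (hS hy).1 (hS hx).1 e.symm⟩
  · intro x y z _ hy _ h1 h2
    exact h1.trans h2 (hf.ne_zero _ (hS hy).1) (hf.form_ne_zero _ (hS hy).1)

theorem germRel_self : F.GermRel p p := by
  intro f U g V hf hp hg hp'
  obtain ⟨N, hN, hNf⟩ := hf.exists_nhds_plaqueRel hp
  obtain ⟨O, hON, hO, hxO⟩ := mem_nhds_iff.1 hN
  exact hf.germRel hO (fun x hx y hy hxy =>
      Relation.ReflTransGen.single (hNf x (hON hx) y (hON hy) hxy)) hxO hxO hp hp rfl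
    f U g V hf hp hg hp'

theorem GermRel.of_mem_leaf (h : q ∈ F.leaf p) : F.GermRel p q := by
  change Relation.ReflTransGen F.PlaqueRel p q at h
  induction h with
  | refl => exact germRel_self
  | @tail b c hb hc ih =>
    have := (PlaqueRel.symm hc).regular
    exact ih.trans (.of_plaqueRel hc) this.1 this.2

/-- Nearby leaves follow a given leaf. -/
theorem eventually_exists_mem_leaf (h : q ∈ F.leaf p) (hq : q ≠ 0) (hq' : F.form q ≠ 0)
    {N : Set (Fin (n + 1) → ℂ)} (hN : N ∈ nhds q) :
    ∀ᶠ x in nhds p, ∃ y ∈ N, y ∈ F.leaf x := by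
  rcases Relation.ReflTransGen.cases_head h with rfl | ⟨b, hb, -⟩
  · filter_upwards [hN] with x hx
    exact ⟨x, hx, mem_leaf_self⟩
  · have hreg := (PlaqueRel.symm hb).regular
    obtain ⟨U, f, hf, hp, -⟩ := exists_firstIntegral hreg.1 hreg.2
    obtain ⟨V, g, hg, hqV, -⟩ := exists_firstIntegral hq hq'
    obtain ⟨v, hv⟩ := hg.exists_form_ne_zero hqV
    obtain ⟨ψ, a, b, c, e⟩ := GermRel.of_mem_leaf h f U g V hf hp hg hqV
    obtain ⟨σ, hσ, hσ0, -, hσ1, -⟩ := hg.exists_section hqV hv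
    rw [← b] at hσ hσ1
    have hfc : Filter.Tendsto (fun x : Fin (n + 1) → ℂ => ψ (f x)) (nhds p)
        (nhds (ψ (f p))) :=
      a.continuousAt.tendsto.comp (hf.differentiableAt p hp).continuousAt
    have hyc : Filter.Tendsto (fun x : Fin (n + 1) → ℂ => q + σ (ψ (f x)) • v) (nhds p)
        (nhds q) := by
      have h1 : ContinuousAt (fun c => q + σ c • v) (ψ (f p)) :=
        continuousAt_const.add (hσ.continuousAt.smul continuousAt_const)
      have h2 : q + σ (ψ (f p)) • v = q := by rw [b, hσ0]; simp
      rw [ContinuousAt, h2] at h1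
      exact h1.comp hfc
    have hc1 : Filter.Tendsto (fun x : Fin (n + 1) → ℂ =>
        (x, q + σ (ψ (f x)) • v)) (nhds p) (nhds (p, q)) := by
      rw [nhds_prod_eq]
      exact Filter.tendsto_id.prodMk hyc
    filter_upwards [hc1.eventually e, hyc.eventually hN, hfc.eventually hσ1] with x h1 h2 h3
    exact ⟨_, h2, h1 h3⟩

variable {M : Set (Fin (n + 1) → ℂ)}

theorem IsNontrivialMinimalSet.form_ne_zero (hM : F.IsNontrivialMinimalSet M) (hz : z ∈ M) :
    F.form z ≠ 0 := fun h =>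
  disjoint_left.1 hM.2.2.2.2.2.1 hz ⟨hM.2.1 z hz, form_eq_zero_iff.1 h⟩

theorem IsNontrivialMinimalSet.mem_iff_of_mem_leaf (hM : F.IsNontrivialMinimalSet M)
    (hxy : y ∈ F.leaf x) :
    x ∈ M ↔ y ∈ M :=
  ⟨fun h => hM.2.2.2.2.1 x h hxy, fun h => hM.2.2.2.2.1 y h (mem_leaf_symm hxy)⟩

/-- Every leaf of a minimal set is dense in it. -/
theorem IsNontrivialMinimalSet.subset_closure_leaf (hM : F.IsNontrivialMinimalSet M) (hz : z ∈ M) :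
    M ⊆ closure (F.leaf z) := by
  have hsub : F.leaf z ⊆ M := hM.2.2.2.2.1 z hz
  have hsub' : closure (F.leaf z) ∩ {x | x ≠ 0} ⊆ M := fun x hx =>
    hM.2.2.2.1 x (closure_mono hsub hx.1) hx.2
  have h := hM.2.2.2.2.2.2 _ hsub' ⟨z, subset_closure mem_leaf_self, hM.2.1 z hz⟩ ?_ ?_
  · rw [← h]
    exact inter_subset_left
  · intro x hx hx0
    refine ⟨?_, hx0⟩
    simpa using closure_mono inter_subset_left hx
  · intro x hx y hy
    have hyM : y ∈ M := (hM.mem_iff_of_mem_leaf hy).1 (hsub' hx)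
    refine ⟨mem_closure_iff_nhds.2 fun N hN => ?_, hM.2.1 y hyM⟩
    obtain ⟨x', h1, h2⟩ := mem_closure_iff_nhds.1 hx.1 _ (eventually_exists_mem_leaf hy
      (hM.2.1 y hyM) (hM.form_ne_zero hyM) hN)
    obtain ⟨y', hy', hy''⟩ := h1
    exact ⟨y', hy', mem_leaf_trans h2 hy''⟩

/-- A minimal set is open or has empty interior. -/
theorem IsNontrivialMinimalSet.isOpen_of_interior_nonempty (hM : F.IsNontrivialMinimalSet M)
    (h : (interior M).Nonempty) :
    IsOpen M := by
  by_contra hopen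
  have hne : (M \ interior M).Nonempty := by
    rw [nonempty_iff_ne_empty, Ne, sdiff_eq_empty]
    exact fun h => hopen (interior_eq_iff_isOpen.1 (interior_subset.antisymm h))
  have := hM.2.2.2.2.2.2 _ sdiff_subset hne ?_ ?_
  · obtain ⟨x, hx⟩ := h
    have h1 := interior_subset hx
    rw [← this] at h1
    exact h1.2 hx
  · intro x hx hx0
    refine ⟨hM.2.2.2.1 x (closure_mono sdiff_subset hx) hx0, fun hxi => ?_⟩
    obtain ⟨y, hy, hy'⟩ := mem_closure_iff_nhds.1 hx _ (isOpen_interior.mem_nhds hxi)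
    exact hy'.2 hy
  · intro x hx y hy
    have hyM := (hM.mem_iff_of_mem_leaf hy).1 hx.1
    refine ⟨hyM, fun hyi => hx.2 (mem_interior_iff_mem_nhds.2 ?_)⟩
    filter_upwards [eventually_exists_mem_leaf hy (hM.2.1 y hyM) (hM.form_ne_zero hyM)
      (isOpen_interior.mem_nhds hyi)] with x' ⟨y', h1, h2⟩
    exact (hM.mem_iff_of_mem_leaf h2).2 (interior_subset h1)

end

end ProjFoliation

namespace ProjFoliation

section
variable {n d : ℕ} {F : ProjFoliation n d}
variable {f g : (Fin (n + 1) → ℂ) → ℂ} {U V : Set (Fin (n + 1) → ℂ)} {p q x y z : Fin (n + 1) → ℂ}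

theorem form_smul_ne_zero {c : ℂ} (hc : c ≠ 0) (hz : F.form z ≠ 0) : F.form (c • z) ≠ 0 := by
  intro h
  apply hz
  ext v
  have := F.form_smul_left c z v
  rw [h] at this
  simpa [hc] using this.symm

/-- Leaves are cones. -/
theorem smul_mem_leaf {c : ℂ} (hc : c ≠ 0) (hz : z ≠ 0) (hz' : F.form z ≠ 0) :
    c • z ∈ F.leaf z := by
  have hpre : IsPreconnected ({0}ᶜ : Set ℂ) :=
    (isConnected_compl_singleton_of_one_lt_rank (by simp) 0).isPreconnected
  have := hpre.induction₂ (fun a b => b • z ∈ F.leaf (a • z)) ?_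
    (fun x y w _ _ _ h1 h2 => mem_leaf_trans h1 h2) (fun x y _ _ h => mem_leaf_symm h)
    (x := 1) (y := c) (by simp) hc
  · simpa using this
  · intro a ha
    obtain ⟨U, f, hf, hU, -⟩ := exists_firstIntegral (F := F) (smul_ne_zero ha hz)
      (form_smul_ne_zero ha hz')
    obtain ⟨N, hN, hNf⟩ := hf.exists_nhds_plaqueRel hU
    have hc : ContinuousAt (fun b : ℂ => b • z) a := by fun_prop
    have hev : ∀ᶠ b in nhds a, b • z ∈ N ∧ b • z ∈ U ∧ b ≠ 0 :=
      (hc.eventually hN).and ((hc.eventually (hf.isOpen.mem_nhds hU)).and (isOpen_ne.mem_nhds ha))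
    obtain ⟨ε, hε, hball⟩ := Metric.eventually_nhds_iff_ball.1 hev
    have hconst : ∀ b ∈ Metric.ball a ε, f (b • z) = f (a • z) := by
      intro b hb
      have hd : ∀ b ∈ Metric.ball a ε, HasDerivAt (fun b : ℂ => f (b • z)) 0 b := by
        intro b hb
        have h1 := (hf.differentiableAt _ (hball b hb).2.1).hasFDerivAt.comp_hasDerivAt b
          ((hasDerivAt_id b).smul_const z)
        refine h1.congr_deriv ?_
        rw [one_smul]
        refine hf.fderiv_eq_zero _ (hball b hb).2.1 _ ?_
        rw [form_smul_left, form_self, mul_zero]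
      exact (convex_ball a ε).is_const_of_fderivWithin_eq_zero (𝕜 := ℂ)
        (fun b hb => (hd b hb).differentiableAt.differentiableWithinAt)
        (fun b hb => by
          rw [fderivWithin_of_isOpen Metric.isOpen_ball hb, (hd b hb).hasFDerivAt.fderiv]
          ext
          simp) hb (Metric.mem_ball_self hε)
    refine nhdsWithin_le_nhds ?_
    filter_upwards [Metric.ball_mem_nhds a hε] with b hb
    exact .single (hNf _ (hball a (Metric.mem_ball_self hε)).1 _ (hball b hb).1 (hconst b hb).symm)

variable (F) in
/-- `α` can be moved continuously to `β` along the leaves. -/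
def LeafHomotopy (D : Set ℂ) (α β : ℂ → Fin (n + 1) → ℂ) : Prop :=
  ∃ H : ℝ × ℂ → Fin (n + 1) → ℂ, ContinuousOn H (Icc 0 1 ×ˢ D) ∧
    ∀ s ∈ D, H (0, s) = α s ∧ H (1, s) = β s ∧ ∀ t ∈ Icc (0:ℝ) 1, H (t, s) ∈ F.leaf (α s)

variable {D D' : Set ℂ} {α β δ : ℂ → Fin (n + 1) → ℂ}

theorem LeafHomotopy.mem_leaf (h : F.LeafHomotopy D α β) {s : ℂ} (hs : s ∈ D) :
    β s ∈ F.leaf (α s) := by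
  obtain ⟨H, -, h⟩ := h
  rw [← (h s hs).2.1]
  exact (h s hs).2.2 1 (right_mem_Icc.2 zero_le_one)

theorem LeafHomotopy.comp (h : F.LeafHomotopy D α β) {τ : ℂ → ℂ} (hτ : ContinuousOn τ D')
    (hD : MapsTo τ D' D) : F.LeafHomotopy D' (fun s => α (τ s)) (fun s => β (τ s)) := by
  obtain ⟨H, hH, h⟩ := h
  refine ⟨fun p => H (p.1, τ p.2), hH.comp ?_ fun p hp => ⟨hp.1, hD hp.2⟩, fun s hs => h _ (hD hs)⟩
  exact continuousOn_fst.prodMk (hτ.comp continuousOn_snd fun p hp => hp.2)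

theorem LeafHomotopy.mono (h : F.LeafHomotopy D α β) (hD : D' ⊆ D) : F.LeafHomotopy D' α β :=
  h.comp continuousOn_id hD

theorem LeafHomotopy.congr {α' β' : ℂ → Fin (n + 1) → ℂ} (h : F.LeafHomotopy D α β)
    (hα : EqOn α α' D) (hβ : EqOn β β' D) : F.LeafHomotopy D α' β' := by
  obtain ⟨H, hH, h⟩ := h
  refine ⟨H, hH, fun s hs => ?_⟩
  rw [← hα hs, ← hβ hs]
  exact h s hs

theorem LeafHomotopy.symm (h : F.LeafHomotopy D α β) : F.LeafHomotopy D β α := by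
  have hm := fun s (hs : s ∈ D) => h.mem_leaf hs
  obtain ⟨H, hH, h⟩ := h
  refine ⟨fun p => H (1 - p.1, p.2), hH.comp (by fun_prop) fun p hp =>
    ⟨⟨by linarith [hp.1.2], by linarith [hp.1.1]⟩, hp.2⟩, fun s hs => ⟨?_, ?_, fun t ht => ?_⟩⟩
  · simpa using (h s hs).2.1
  · simpa using (h s hs).1
  · exact mem_leaf_trans (mem_leaf_symm (hm s hs))
      ((h s hs).2.2 _ ⟨by linarith [ht.2], by linarith [ht.1]⟩)

theorem LeafHomotopy.trans (h₁ : F.LeafHomotopy D α β) (h₂ : F.LeafHomotopy D β δ) :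
    F.LeafHomotopy D α δ := by
  have hm := fun s (hs : s ∈ D) => h₁.mem_leaf hs
  obtain ⟨H, hH, h⟩ := h₁
  obtain ⟨K, hK, k⟩ := h₂
  have hmin : ∀ t ∈ Icc (0:ℝ) 1, min (2 * t) 1 ∈ Icc (0:ℝ) 1 := fun t ht =>
    ⟨le_min (by linarith [ht.1]) zero_le_one, min_le_right _ _⟩
  have hmax : ∀ t ∈ Icc (0:ℝ) 1, max (2 * t - 1) 0 ∈ Icc (0:ℝ) 1 := fun t ht =>
    ⟨le_max_right _ _, max_le (by linarith [ht.2]) zero_le_one⟩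
  refine ⟨fun p => H (min (2 * p.1) 1, p.2) + K (max (2 * p.1 - 1) 0, p.2) - H (1, p.2),
    ContinuousOn.sub (ContinuousOn.add ?_ ?_) ?_, fun s hs => ⟨?_, ?_, fun t ht => ?_⟩⟩
  · exact hH.comp (by fun_prop) fun p hp => ⟨hmin _ hp.1, hp.2⟩
  · exact hK.comp (by fun_prop) fun p hp => ⟨hmax _ hp.1, hp.2⟩
  · exact hH.comp (by fun_prop) fun p hp => ⟨by simp, hp.2⟩
  · simp [(h s hs).1, (h s hs).2.1, (k s hs).1]
  · simp only [(h s hs).2.1]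
    norm_num [(h s hs).2.1, (k s hs).2.1]
  · rcases le_total (2 * t) 1 with h2 | h2
    · have e1 : max (2 * t - 1) 0 = 0 := max_eq_right (by linarith)
      simp only [e1, (h s hs).2.1, (k s hs).1, add_sub_cancel_right]
      exact (h s hs).2.2 _ (hmin t ht)
    · have e1 : min (2 * t) 1 = 1 := min_eq_right h2
      simp only [e1, (h s hs).2.1, add_sub_cancel_left]
      exact mem_leaf_trans (hm s hs) ((k s hs).2.2 _ (hmax t ht))

theorem LeafHomotopy.smul_right {c : ℝ} (hc : 0 < c) (h : F.LeafHomotopy D α β)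
    (hβ : ∀ s ∈ D, β s ≠ 0 ∧ F.form (β s) ≠ 0) :
    F.LeafHomotopy D α (fun s => (c : ℂ) • β s) := by
  refine h.trans ?_
  obtain ⟨H, hH, h⟩ := h
  refine ⟨fun p => (((1 - p.1) + p.1 * c : ℝ) : ℂ) • H (1, p.2), ?_, fun s hs =>
    ⟨?_, ?_, fun t ht => ?_⟩⟩
  · have h1 : ContinuousOn (fun p : ℝ × ℂ => H (1, p.2)) (Icc 0 1 ×ˢ D) :=
      hH.comp (by fun_prop) fun p hp => ⟨by simp, hp.2⟩
    have h2 : Continuous fun p : ℝ × ℂ => (((1 - p.1) + p.1 * c : ℝ) : ℂ) := by fun_prop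
    exact h2.continuousOn.smul h1
  · simp [(h s hs).2.1]
  · simp [(h s hs).2.1]
  · simp only [(h s hs).2.1]
    refine smul_mem_leaf ?_ (hβ s hs).1 (hβ s hs).2
    rw [Complex.ofReal_ne_zero]
    rcases eq_or_lt_of_le ht.1 with rfl | h0
    · simp
    · have := mul_pos h0 hc
      linarith [ht.2]

/-- In a flow box, maps into a common level of the first integral are homotopic along the
leaves. -/
theorem exists_firstIntegral_leafHomotopy (hz : z ≠ 0) (hz' : F.form z ≠ 0) :
    ∃ W f, F.IsFirstIntegral f W ∧ z ∈ W ∧ ∃ W' ⊆ W, IsOpen W' ∧ z ∈ W' ∧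
      ∀ (D : Set ℂ) (α β : ℂ → Fin (n + 1) → ℂ), ContinuousOn α D → ContinuousOn β D →
        MapsTo α D W' → MapsTo β D W' → (∀ s ∈ D, f (α s) = f (β s)) → F.LeafHomotopy D α β := by
  obtain ⟨v₀, hv₀⟩ : ∃ w, F.form z w ≠ 0 := by
    by_contra! h
    exact hz' (by ext w; exact h w)
  obtain ⟨W, W', f, Z, hW, hW', hzW', hWW, hreg, hfa, hfd, -, hZc, hZ⟩ :=
    F.exists_flowBox hz hv₀
  have hf : F.IsFirstIntegral f W := ⟨hW, fun z hz => (hreg z hz).1,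
    fun z hz h => (hreg z hz).2 (by simp [h]), fun z hz => (hfa z hz).differentiableAt,
    fun z hz h => (hfd z hz).1 (by simp [h]), fun z hz => (hfd z hz).2⟩
  have key : ∀ (D : Set ℂ) (α : ℂ → Fin (n + 1) → ℂ), ContinuousOn α D → MapsTo α D W' →
      F.LeafHomotopy D α (fun s => z + f (α s) • v₀) := by
    intro D α hα hD
    refine ⟨fun p => Z (α p.2, p.1), hZc.comp ?_ fun p hp => ⟨hD hp.2, hp.1⟩, fun s hs =>
      ⟨(hZ _ (hD hs)).1, (hZ _ (hD hs)).2.1, fun t ht => .single ?_⟩⟩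
    · exact (hα.comp continuousOn_snd fun p hp => hp.2).prodMk continuousOn_fst
    · refine plaqueRel_iff.2 ⟨W, f, hf, hWW (hD hs), ?_⟩
      refine (isPreconnected_image_path hZc (hD hs)).subset_connectedComponentIn
        ⟨0, by simp, (hZ _ (hD hs)).1⟩ ?_ ⟨t, ht, rfl⟩
      rintro _ ⟨t, ht, rfl⟩
      exact (hZ _ (hD hs)).2.2 t ht
  refine ⟨W, f, hf, hWW hzW', W', hWW, hW', hzW', fun D α β hα hβ hαD hβD h => ?_⟩
  refine (key D α hα hαD).trans ((key D β hβ hβD).symm.congr (fun s hs => ?_) fun _ _ => rfl)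
  simp only [h s hs]

end

end ProjFoliation

namespace ProjFoliation

section
variable {n d : ℕ} {F : ProjFoliation n d}
variable {f g : (Fin (n + 1) → ℂ) → ℂ} {U V : Set (Fin (n + 1) → ℂ)} {p q x y z : Fin (n + 1) → ℂ}

/-- The data `(x₁, w₁, x₂, w₂)` of two parametrized complex lines `s ↦ xᵢ + s • wᵢ`. -/
abbrev LinePair (n : ℕ) : Type :=
  (Fin (n + 1) → ℂ) × (Fin (n + 1) → ℂ) × (Fin (n + 1) → ℂ) × (Fin (n + 1) → ℂ)

/-- Transport along the leaves between the transversals `s ↦ x₁ + s • w₁` and `s ↦ x₂ + s • w₂`,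
with parameters `(x₁, w₁, x₂, w₂)` near a given position in a flow box. -/
theorem exists_transport {W W' : Set (Fin (n + 1) → ℂ)} (hf : F.IsFirstIntegral f W)
    (hWW : W' ⊆ W) (hW' : IsOpen W')
    (hL : ∀ (D : Set ℂ) (α β : ℂ → Fin (n + 1) → ℂ), ContinuousOn α D → ContinuousOn β D →
        MapsTo α D W' → MapsTo β D W' → (∀ s ∈ D, f (α s) = f (β s)) → F.LeafHomotopy D α β)
    {x₁ w₁ x₂ w₂ : Fin (n + 1) → ℂ} (hx₁ : x₁ ∈ W') (hx₂ : x₂ ∈ W') (hx : f x₁ = f x₂)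
    (hw₁ : F.form x₁ w₁ ≠ 0) (hw₂ : F.form x₂ w₂ ≠ 0) :
    ∃ T : LinePair n × ℂ → ℂ,
      AnalyticAt ℂ T ((x₁, w₁, x₂, w₂), 0) ∧ T ((x₁, w₁, x₂, w₂), 0) = 0 ∧
      fderiv ℂ T ((x₁, w₁, x₂, w₂), 0) (0, 1) * fderiv ℂ f x₂ w₂ = fderiv ℂ f x₁ w₁ ∧
      ∃ N ∈ nhds (x₁, w₁, x₂, w₂), ∃ δ > 0, ∀ P ∈ N,
        F.LeafHomotopy (Metric.ball 0 δ) (fun s => P.1 + s • P.2.1)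
          (fun s => P.2.2.1 + T (P, s) • P.2.2.2) ∧
        (f P.1 = f P.2.2.1 → T (P, 0) = 0) ∧
        ∀ s ∈ Metric.ball (0:ℂ) δ, AnalyticAt ℂ T (P, s) ∧ fderiv ℂ T (P, s) (0, 1) ≠ 0 ∧
          P.2.2.1 + T (P, s) • P.2.2.2 ∈ W' := by
  obtain ⟨S, hS, hS0, hS1, hS2⟩ := exists_transverse_parameter (hf.analyticAt (hWW hx₂))
    (mt (hf.fderiv_apply_eq_zero_iff (hWW hx₂)).1 hw₂)
  let P₀ : LinePair n := (x₁, w₁, x₂, w₂)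
  let ι : LinePair n × ℂ →
      (Fin (n + 1) → ℂ) × (Fin (n + 1) → ℂ) × ℂ := fun x =>
    (x.1.2.2.1, x.1.2.2.2, f (x.1.1 + x.2 • x.1.2.1))
  let T : LinePair n × ℂ → ℂ := fun x => S (ι x)
  have hι0 : ι (P₀, 0) = (x₂, w₂, f x₂) := by simp [ι, P₀, hx]
  have hA : ∀ x : LinePair n × ℂ,
      AnalyticAt ℂ (fun x : LinePair n × ℂ => x.1.1 + x.2 • x.1.2.1) x := fun x =>
    (analyticAt_fst.fun_comp analyticAt_fst).add
      (analyticAt_snd.smul ((analyticAt_fst.fun_comp analyticAt_snd).fun_comp analyticAt_fst))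
  have hA0 : P₀.1 + (0:ℂ) • P₀.2.1 = x₁ := by simp [P₀]
  have hιa : AnalyticAt ℂ ι (P₀, 0) := by
    refine AnalyticAt.prod ?_ (AnalyticAt.prod ?_ ?_)
    · exact ((analyticAt_fst.fun_comp analyticAt_snd).fun_comp analyticAt_snd).fun_comp
        analyticAt_fst
    · exact ((analyticAt_snd.fun_comp analyticAt_snd).fun_comp analyticAt_snd).fun_comp
        analyticAt_fst
    · refine AnalyticAt.fun_comp (g := f) ?_ (hA _)
      simp only [hA0]
      exact hf.analyticAt (hWW hx₁)
  have hT : AnalyticAt ℂ T (P₀, 0) :=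
    AnalyticAt.fun_comp (g := S) (by rw [hι0]; exact hS) hιa
  have hT0 : T (P₀, 0) = 0 := by simp only [T, hι0, hS0]
  have hιc : Filter.Tendsto ι (nhds (P₀, 0)) (nhds (x₂, w₂, f x₂)) := by
    rw [← hι0]; exact hιa.continuousAt
  have hYa : AnalyticAt ℂ (fun x : LinePair n × ℂ => x.1.2.2.1 + T x • x.1.2.2.2)
      (P₀, 0) :=
    (((analyticAt_fst.fun_comp analyticAt_snd).fun_comp analyticAt_snd).fun_comp
        analyticAt_fst).add (hT.smul (((analyticAt_snd.fun_comp analyticAt_snd).fun_comp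
        analyticAt_snd).fun_comp analyticAt_fst))
  have hY0 : P₀.2.2.1 + T (P₀, 0) • P₀.2.2.2 = x₂ := by rw [hT0]; simp [P₀]
  have e1 : ∀ᶠ x in nhds (P₀, (0:ℂ)), x.1.1 + x.2 • x.1.2.1 ∈ W' :=
    (hA (P₀, 0)).continuousAt.eventually_mem (by simp only [hA0]; exact hW'.mem_nhds hx₁)
  have e2 : ∀ᶠ x in nhds (P₀, (0:ℂ)), x.1.2.2.1 + T x • x.1.2.2.2 ∈ W' :=
    hYa.continuousAt.eventually_mem (by simp only [hY0]; exact hW'.mem_nhds hx₂)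
  have e3 : ∀ᶠ x in nhds (P₀, (0:ℂ)), f (x.1.2.2.1 + T x • x.1.2.2.2) =
      f (x.1.1 + x.2 • x.1.2.1) := hιc.eventually hS1
  have e4 : ∀ᶠ x in nhds (P₀, (0:ℂ)), f x.1.1 = f x.1.2.2.1 → T (x.1, 0) = 0 := by
    have h1 : Filter.Tendsto (fun x : LinePair n × ℂ => (ι (x.1, 0), (0:ℂ)))
        (nhds (P₀, 0)) (nhds ((x₂, w₂, f x₂), 0)) := by
      have h2 : Filter.Tendsto (fun x : LinePair n × ℂ => (x.1, (0:ℂ))) (nhds (P₀, 0))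
        (nhds (P₀, 0)) := Continuous.tendsto' (by fun_prop) _ _ rfl
      exact (hιc.comp h2).prodMk_nhds tendsto_const_nhds
    filter_upwards [h1.eventually hS2] with x hx h
    exact hx.1 (by simp [ι, h])
  have hdT : ∀ x : LinePair n × ℂ, DifferentiableAt ℂ T x →
      HasDerivAt (fun s => T (x.1, s)) (fderiv ℂ T x (0, 1)) x.2 := by
    intro x hx
    have h1 : HasDerivAt (fun s : ℂ => (x.1, s)) ((0 : LinePair n), (1 : ℂ)) x.2 :=
      (hasDerivAt_const x.2 x.1).prodMk (hasDerivAt_id x.2)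
    exact HasFDerivAt.comp_hasDerivAt (f := fun s => (x.1, s)) x.2 hx.hasFDerivAt h1
  have hkey : ∀ᶠ x in nhds (P₀, (0:ℂ)), fderiv ℂ T x (0, 1) *
      fderiv ℂ f (x.1.2.2.1 + T x • x.1.2.2.2) x.1.2.2.2 =
      fderiv ℂ f (x.1.1 + x.2 • x.1.2.1) x.1.2.1 := by
    filter_upwards [e1, e2, eventually_eventually_nhds.2 e3, hT.eventually_analyticAt]
      with x h1 h2 h3 h4
    have hl : HasDerivAt (fun s => f (x.1.2.2.1 + T (x.1, s) • x.1.2.2.2))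
        (fderiv ℂ f (x.1.2.2.1 + T x • x.1.2.2.2) (fderiv ℂ T x (0, 1) • x.1.2.2.2)) x.2 :=
      HasFDerivAt.comp_hasDerivAt (f := fun s => x.1.2.2.1 + T (x.1, s) • x.1.2.2.2) x.2
        (hf.differentiableAt _ (hWW h2)).hasFDerivAt
        (((hdT x h4.differentiableAt).smul_const _).const_add _)
    have hr : HasDerivAt (fun s => f (x.1.1 + s • x.1.2.1))
        (fderiv ℂ f (x.1.1 + x.2 • x.1.2.1) ((1:ℂ) • x.1.2.1)) x.2 :=
      HasFDerivAt.comp_hasDerivAt (f := fun s => x.1.1 + s • x.1.2.1) x.2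
        (hf.differentiableAt _ (hWW h1)).hasFDerivAt
        (((hasDerivAt_id x.2).smul_const _).const_add _)
    have hc : Filter.Tendsto (fun s : ℂ => (x.1, s)) (nhds x.2) (nhds x) :=
      Continuous.tendsto' (by fun_prop) _ _ rfl
    have := hl.unique (hr.congr_of_eventuallyEq (hc.eventually h3))
    simpa using this
  have e5 : ∀ᶠ x in nhds (P₀, (0:ℂ)), F.form (x.1.1 + x.2 • x.1.2.1) x.1.2.1 ≠ 0 := by
    have hc : Continuous fun x : LinePair n × ℂ =>
        F.form (x.1.1 + x.2 • x.1.2.1) x.1.2.1 :=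
      (F.continuous_form.comp (by fun_prop)).clm_apply (by fun_prop)
    refine hc.continuousAt.eventually_ne ?_
    simp only [hA0]
    exact hw₁
  have hall := (((e1.and e2).and (e3.and e4)).and (hkey.and e5)).and hT.eventually_analyticAt
  rw [nhds_prod_eq] at hall
  obtain ⟨a, ha, b, hb, hab⟩ := Filter.eventually_prod_iff.1 hall
  obtain ⟨δ, hδ, hball⟩ := Metric.eventually_nhds_iff_ball.1 hb
  refine ⟨T, hT, hT0, ?_, {P | a P}, ha, δ, hδ, fun P hP => ?_⟩
  · have := hkey.self_of_nhds
    simp only [hA0, hY0] at this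
    exact this
  · have h := fun s (hs : s ∈ Metric.ball (0:ℂ) δ) => hab hP (hball s hs)
    have hTc : ContinuousOn (fun s => T (P, s)) (Metric.ball 0 δ) := fun s hs =>
      (hdT (P, s) (h s hs).2.differentiableAt).continuousAt.continuousWithinAt
    refine ⟨hL _ _ _ (by fun_prop) ?_ (fun s hs => (h s hs).1.1.1.1)
      (fun s hs => (h s hs).1.1.1.2) fun s hs => (h s hs).1.1.2.1.symm,
      (h 0 (Metric.mem_ball_self hδ)).1.1.2.2, fun s hs => ⟨(h s hs).2, fun h0 => ?_,
        (h s hs).1.1.1.2⟩⟩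
    · exact continuousOn_const.add (hTc.smul continuousOn_const)
    · have h1 := (h s hs).1.2.1
      rw [h0, zero_mul] at h1
      exact (h s hs).1.2.2 ((hf.fderiv_apply_eq_zero_iff (hWW (h s hs).1.1.1.1)).1 h1.symm)

end

end ProjFoliation

/-- The Hermitian norm on `ℂᵐ`. -/
def hermitianNorm {m : ℕ} (z : Fin m → ℂ) : ℝ := ‖(WithLp.toLp 2 z : EuclideanSpace ℂ (Fin m))‖

section
variable {m : ℕ} {z x : Fin m → ℂ}

theorem continuous_hermitianNorm : Continuous (hermitianNorm (m := m)) :=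
  (PiLp.continuous_toLp 2 _).norm

theorem hermitianNorm_pos (hz : z ≠ 0) : 0 < hermitianNorm z := by
  rw [hermitianNorm, norm_pos_iff]
  simpa using hz

theorem hermitianNorm_smul (c : ℂ) (z : Fin m → ℂ) :
    hermitianNorm (c • z) = ‖c‖ * hermitianNorm z := by
  rw [hermitianNorm, WithLp.toLp_smul, norm_smul, hermitianNorm]

theorem hermitianNorm_inv_smul (hz : z ≠ 0) :
    hermitianNorm (((hermitianNorm z)⁻¹ : ℂ) • z) = 1 := by
  have h := hermitianNorm_pos hz
  rw [hermitianNorm_smul, norm_inv, Complex.norm_real, Real.norm_of_nonneg h.le,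
    inv_mul_cancel₀ h.ne']

theorem isCompact_hermitianSphere : IsCompact {z : Fin m → ℂ | hermitianNorm z = 1} := by
  have h := (isCompact_sphere (0 : EuclideanSpace ℂ (Fin m)) 1).image
    (PiLp.continuous_ofLp 2 (fun _ : Fin m => ℂ))
  convert h using 1
  ext z
  simp only [mem_image, mem_sphere_zero_iff_norm]
  exact ⟨fun h => ⟨WithLp.toLp 2 z, h, rfl⟩, by rintro ⟨y, hy, rfl⟩; exact hy⟩

/-- The strict Cauchy–Schwarz inequality. -/
theorem exists_hermitian_functional (hz : hermitianNorm z = 1) :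
    ∃ ℓ : (Fin m → ℂ) →L[ℂ] ℂ, ℓ z = 1 ∧
      ∀ x, (∀ r : ℂ, x ≠ r • z) → ‖ℓ x‖ < hermitianNorm x := by
  refine ⟨(innerSL ℂ (WithLp.toLp 2 z : EuclideanSpace ℂ (Fin m))).comp
    ((PiLp.continuousLinearEquiv 2 ℂ (fun _ : Fin m => ℂ)).symm :
      (Fin m → ℂ) →L[ℂ] EuclideanSpace ℂ (Fin m)), ?_, fun x hx => ?_⟩
  · change inner ℂ (WithLp.toLp 2 z : EuclideanSpace ℂ (Fin m)) (WithLp.toLp 2 z) = 1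
    rw [inner_self_eq_norm_sq_to_K]
    change ((hermitianNorm z : ℝ) : ℂ) ^ 2 = 1
    simp [hz]
  · change ‖inner ℂ (WithLp.toLp 2 z : EuclideanSpace ℂ (Fin m)) (WithLp.toLp 2 x)‖ < _
    have hz0 : (WithLp.toLp 2 z : EuclideanSpace ℂ (Fin m)) ≠ 0 := by
      rw [← norm_pos_iff]
      change 0 < hermitianNorm z
      simp [hz]
    have hx0 : (WithLp.toLp 2 x : EuclideanSpace ℂ (Fin m)) ≠ 0 := by
      have := hx 0
      rw [zero_smul] at this
      rw [← norm_pos_iff]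
      exact hermitianNorm_pos this
    have h1 := norm_inner_le_norm (𝕜 := ℂ) (WithLp.toLp 2 z : EuclideanSpace ℂ (Fin m))
      (WithLp.toLp 2 x)
    have h2 : ‖(WithLp.toLp 2 z : EuclideanSpace ℂ (Fin m))‖ *
        ‖(WithLp.toLp 2 x : EuclideanSpace ℂ (Fin m))‖ = hermitianNorm x := by
      change hermitianNorm z * hermitianNorm x = _
      rw [hz, one_mul]
    rw [h2] at h1
    refine lt_of_le_of_ne h1 fun h => ?_
    obtain ⟨r, -, hr⟩ := (norm_inner_eq_norm_iff (𝕜 := ℂ) hz0 hx0).1 (h.trans h2.symm)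
    exact hx r (by simpa using congrArg WithLp.ofLp hr)

end

theorem frequently_norm_le_of_differentiableAt {f : ℂ → ℂ} {c : ℂ}
    (hf : ∀ᶠ z in nhds c, DifferentiableAt ℂ f z) : ∃ᶠ z in nhdsWithin c {c}ᶜ, ‖f c‖ ≤ ‖f z‖ := by
  intro h
  simp only [not_le] at h
  have hmax : IsLocalMax (norm ∘ f) c := by
    rw [eventually_nhdsWithin_iff] at h
    filter_upwards [h] with z hz
    by_cases hzc : z = c
    · rw [hzc]
    · exact (hz hzc).le
  have h2 := Complex.eventually_eq_of_isLocalMax_norm hf hmax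
  obtain ⟨z, hz, hz'⟩ := (h.and (h2.filter_mono nhdsWithin_le_nhds)).exists
  simp [hz'] at hz

namespace ProjFoliation

section
variable {n d : ℕ} {F : ProjFoliation n d}
variable {f g : (Fin (n + 1) → ℂ) → ℂ} {U V : Set (Fin (n + 1) → ℂ)} {p q x y z : Fin (n + 1) → ℂ}

variable (F) in
/-- The vector Hermitian-orthogonal to the leaf on which the defining form takes the value `1`. -/
def normalVec (z : Fin (n + 1) → ℂ) : Fin (n + 1) → ℂ :=
  ((∑ i, ‖eval z (F.a i)‖ ^ 2 : ℝ) : ℂ)⁻¹ • fun i => (starRingEnd ℂ) (eval z (F.a i))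

theorem sum_norm_sq_ne_zero (hz : F.form z ≠ 0) : ∑ i, ‖eval z (F.a i)‖ ^ 2 ≠ 0 := by
  rw [Ne, form_eq_zero_iff, not_forall] at hz
  obtain ⟨i, hi⟩ := hz
  have : 0 < ‖eval z (F.a i)‖ ^ 2 := by positivity
  exact (this.trans_le (Finset.single_le_sum (f := fun i => ‖eval z (F.a i)‖ ^ 2)
    (fun i _ => by positivity) (Finset.mem_univ i))).ne'

theorem form_normalVec (hz : F.form z ≠ 0) : F.form z (F.normalVec z) = 1 := by
  rw [normalVec, map_smul, form_apply, smul_eq_mul]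
  have : ∑ i, eval z (F.a i) * (starRingEnd ℂ) (eval z (F.a i)) =
      ((∑ i, ‖eval z (F.a i)‖ ^ 2 : ℝ) : ℂ) := by
    push_cast
    exact Finset.sum_congr rfl fun i _ => by rw [Complex.mul_conj, Complex.normSq_eq_norm_sq]; simp
  rw [this, inv_mul_cancel₀]
  exact_mod_cast sum_norm_sq_ne_zero hz

theorem continuousAt_normalVec (hz : F.form z ≠ 0) : ContinuousAt F.normalVec z := by
  have hc : ∀ i, Continuous fun z : Fin (n + 1) → ℂ => eval z (F.a i) := fun i =>
    MvPolynomial.continuous_eval _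
  have h1 : ContinuousAt (fun z : Fin (n + 1) → ℂ => ((∑ i, ‖eval z (F.a i)‖ ^ 2 : ℝ) : ℂ)) z :=
    (Complex.continuous_ofReal.comp
      (continuous_finsetSum _ fun i _ => ((hc i).norm.pow 2))).continuousAt
  have h2 : Continuous fun z : Fin (n + 1) → ℂ => fun i => (starRingEnd ℂ) (eval z (F.a i)) :=
    continuous_pi fun i => Complex.continuous_conj.comp (hc i)
  refine (h1.inv₀ ?_).smul h2.continuousAt
  exact_mod_cast sum_norm_sq_ne_zero hz

theorem exists_not_mem_span_pair (hn : 2 ≤ n) (x y : Fin (n + 1) → ℂ) :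
    ∃ w, w ∉ Submodule.span ℂ {x, y} := by
  by_contra! h
  have h1 : Submodule.span ℂ {x, y} = ⊤ := by
    ext w
    simp [h w]
  have h2 : Module.finrank ℂ (Submodule.span ℂ {x, y}) ≤ 2 := by
    classical
    have := finrank_span_finset_le_card (R := ℂ) ({x, y} : Finset (Fin (n + 1) → ℂ))
    simp only [Finset.coe_insert, Finset.coe_singleton] at this
    exact this.trans Finset.card_le_two
  rw [h1, finrank_top, Module.finrank_fin_fun] at h2
  omega

/-- Along a leaf the transverse metric `|ω| / |z|^(d+2)` is nowhere locally minimal. -/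
theorem IsFirstIntegral.exists_contraction (hf : F.IsFirstIntegral f U) (hn : 2 ≤ n) (hz : z ∈ U)
    (hz1 : hermitianNorm z = 1) {N : Set (Fin (n + 1) → ℂ)} (hN : N ∈ nhds z)
    {v : Fin (n + 1) → ℂ} (hv : F.form z v = 1) :
    ∃ x ∈ N, x ≠ 0 ∧ F.form x ≠ 0 ∧ f x = f z ∧ ∀ u, F.form x u = hermitianNorm x ^ (d + 2) →
      ‖fderiv ℂ f z v‖ < ‖fderiv ℂ f x u‖ := by
  have hvf : fderiv ℂ f z v ≠ 0 := mt (hf.fderiv_apply_eq_zero_iff hz).1 (by simp [hv])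
  obtain ⟨σ, hσ, hσ0, hσ1, -⟩ := exists_transverse_parameter (hf.analyticAt hz) hvf
  obtain ⟨w, hw⟩ := exists_not_mem_span_pair hn z v
  obtain ⟨ℓ, hℓ, hℓ'⟩ := exists_hermitian_functional hz1
  let ι : ℂ → (Fin (n + 1) → ℂ) × (Fin (n + 1) → ℂ) × ℂ := fun ζ => (z + ζ • w, v, f z)
  have hι : AnalyticAt ℂ ι 0 := by
    refine AnalyticAt.prod ?_ (analyticAt_const.prod analyticAt_const)
    exact analyticAt_const.add (analyticAt_id.smul analyticAt_const)
  have hι0 : ι 0 = (z, v, f z) := by simp [ι]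
  let X : ℂ → Fin (n + 1) → ℂ := fun ζ => z + ζ • w + σ (ι ζ) • v
  have hX : AnalyticAt ℂ X 0 := by
    refine (analyticAt_const.add (analyticAt_id.smul analyticAt_const)).add
      ((AnalyticAt.fun_comp (g := σ) (by rwa [hι0]) hι).smul analyticAt_const)
  have hX0 : X 0 = z := by simp [X, hι0, hσ0]
  have hXt : Filter.Tendsto X (nhds 0) (nhds z) := by
    rw [← hX0]
    exact hX.continuousAt
  let G : ℂ → ℂ := fun ζ => ℓ (X ζ) ^ (d + 2) * fderiv ℂ f (X ζ) v / F.form (X ζ) v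
  have hG : AnalyticAt ℂ G 0 := by
    refine AnalyticAt.div (AnalyticAt.mul ?_ ?_) ?_ ?_
    · exact (AnalyticAt.fun_comp (g := ℓ) (ℓ.analyticAt _) hX).pow _
    · have h1 : AnalyticAt ℂ (fun ζ => fderiv ℂ f (X ζ)) 0 :=
        AnalyticAt.fun_comp (g := fderiv ℂ f) (by rw [hX0]; exact (hf.analyticAt hz).fderiv) hX
      exact AnalyticAt.fun_comp (g := ContinuousLinearMap.apply ℂ ℂ v)
        (ContinuousLinearMap.analyticAt _ _) h1
    · have h1 : AnalyticAt ℂ (fun ζ => F.form (X ζ)) 0 :=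
        AnalyticAt.fun_comp (g := F.form) (F.analyticAt_form _) hX
      exact AnalyticAt.fun_comp (g := ContinuousLinearMap.apply ℂ ℂ v)
        (ContinuousLinearMap.analyticAt _ _) h1
    · simp [hX0, hv]
  have hG0 : G 0 = fderiv ℂ f z v := by simp [G, hX0, hv, hℓ]
  have e1 : ∀ᶠ ζ in nhds (0:ℂ), X ζ ∈ N ∧ X ζ ∈ U := hXt.eventually
    (Filter.inter_mem hN (hf.isOpen.mem_nhds hz))
  have e2 : ∀ᶠ ζ in nhds (0:ℂ), f (X ζ) = f z := by
    have : Filter.Tendsto ι (nhds 0) (nhds (z, v, f z)) := by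
      rw [← hι0]
      exact hι.continuousAt
    exact this.eventually hσ1
  have e3 : ∀ᶠ ζ in nhds (0:ℂ), F.form (X ζ) v ≠ 0 := by
    have h1 : ContinuousAt (fun ζ => F.form (X ζ) v) 0 :=
      (F.continuous_form.continuousAt.comp hX.continuousAt).clm_apply continuousAt_const
    exact h1.eventually_ne (by simp [hX0, hv])
  have hfreq := frequently_norm_le_of_differentiableAt
    (hG.eventually_analyticAt.mono fun _ h => h.differentiableAt)
  obtain ⟨ζ, h1, ⟨⟨h2N, h2U⟩, h3, h4⟩, h5⟩ := (hfreq.and_eventually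
    (((e1.and (e2.and e3)).filter_mono nhdsWithin_le_nhds).and self_mem_nhdsWithin)).exists
  have hx0 := hf.ne_zero _ h2U
  refine ⟨X ζ, h2N, hx0, hf.form_ne_zero _ h2U, h3, fun u hu => ?_⟩
  rw [hG0] at h1
  have hlt : ‖ℓ (X ζ)‖ < hermitianNorm (X ζ) := by
    refine hℓ' _ fun r hr => hw ?_
    rw [Submodule.mem_span_pair]
    refine ⟨ζ⁻¹ * (r - 1), -ζ⁻¹ * σ (ι ζ), ?_⟩
    have hζ : ζ ≠ 0 := h5
    have : ζ • w = (r - 1) • z + (-σ (ι ζ)) • v := by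
      have h6 : z + ζ • w + σ (ι ζ) • v = r • z := hr
      rw [sub_smul, one_smul, neg_smul, ← h6]
      abel
    rw [mul_smul, neg_mul, ← mul_neg, mul_smul, ← smul_add, ← this, smul_smul, inv_mul_cancel₀ hζ,
      one_smul]
  have hpos := hermitianNorm_pos hx0
  have hfu : fderiv ℂ f (X ζ) u = hermitianNorm (X ζ) ^ (d + 2) * fderiv ℂ f (X ζ) v /
      F.form (X ζ) v := by
    rw [eq_div_iff h4, mul_comm, hf.fderiv_mul h2U, hu]
  have hGζ : ‖G ζ‖ = ‖ℓ (X ζ)‖ ^ (d + 2) * ‖fderiv ℂ f (X ζ) v / F.form (X ζ) v‖ := by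
    simp only [G, mul_div_assoc, norm_mul, norm_pow]
  have hfu' : ‖fderiv ℂ f (X ζ) u‖ = hermitianNorm (X ζ) ^ (d + 2) *
      ‖fderiv ℂ f (X ζ) v / F.form (X ζ) v‖ := by
    rw [hfu, mul_div_assoc, norm_mul, norm_pow, Complex.norm_real, Real.norm_of_nonneg hpos.le]
  refine h1.trans_lt ?_
  rw [hGζ, hfu']
  refine mul_lt_mul_of_pos_right (pow_lt_pow_left₀ hlt (norm_nonneg _) (by omega)) ?_
  exact norm_pos_iff.2 (div_ne_zero (mt (hf.fderiv_apply_eq_zero_iff h2U).1 h4) h4)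

end

end ProjFoliation

namespace ProjFoliation

section
variable {n d : ℕ} {F : ProjFoliation n d} {M : Set (Fin (n + 1) → ℂ)}
variable {f g : (Fin (n + 1) → ℂ) → ℂ} {U V : Set (Fin (n + 1) → ℂ)} {p q x y z : Fin (n + 1) → ℂ}

theorem hasDerivAt_comp_prodMk {E : Type*} [NormedAddCommGroup E] [NormedSpace ℂ E]
    {T : E × ℂ → ℂ} {P : E} {s : ℂ} (h : DifferentiableAt ℂ T (P, s)) :
    HasDerivAt (fun s => T (P, s)) (fderiv ℂ T (P, s) (0, 1)) s := by
  have h1 : HasDerivAt (fun s : ℂ => (P, s)) ((0 : E), (1 : ℂ)) s :=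
    (hasDerivAt_const s P).prodMk (hasDerivAt_id s)
  exact HasFDerivAt.comp_hasDerivAt (f := fun s => (P, s)) s h.hasFDerivAt h1

theorem norm_le_of_norm_deriv_le {T : ℂ → ℂ} {δ C : ℝ} (hT : ∀ s ∈ Metric.ball (0:ℂ) δ,
    DifferentiableAt ℂ T s ∧ ‖deriv T s‖ ≤ C) {s : ℂ} (hs : s ∈ Metric.ball (0:ℂ) δ) :
    ‖T s - T 0‖ ≤ C * ‖s‖ := by
  have h0 : (0:ℂ) ∈ Metric.ball (0:ℂ) δ :=
    Metric.mem_ball_self (dist_nonneg.trans_lt (Metric.mem_ball.1 hs))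
  have := (convex_ball (0:ℂ) δ).norm_image_sub_le_of_norm_deriv_le (fun s hs => (hT s hs).1)
    (fun s hs => (hT s hs).2) h0 hs
  simpa using this

theorem form_smul_normalVec (hx : x ≠ 0) (hx' : F.form x ≠ 0) :
    F.form x ((hermitianNorm x : ℂ) • F.normalVec (((hermitianNorm x)⁻¹ : ℂ) • x)) =
      hermitianNorm x ^ (d + 2) := by
  have h : (hermitianNorm x : ℂ) ≠ 0 := by exact_mod_cast (hermitianNorm_pos hx).ne'
  have h1 := form_normalVec (form_smul_ne_zero (inv_ne_zero h) hx')
  rw [form_smul_left, inv_pow, inv_mul_eq_div, div_eq_one_iff_eq (pow_ne_zero _ h)] at h1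
  rw [map_smul, h1, smul_eq_mul]
  ring

/-- Near every point of a minimal set there is a transport map contracting the transverse
metric. -/
theorem IsNontrivialMinimalSet.exists_local_contraction (hM : F.IsNontrivialMinimalSet M)
    (hn : 2 ≤ n) (hz : z ∈ M) (hz1 : hermitianNorm z = 1) :
    ∃ N ∈ nhds z, ∃ δ > 0, ∃ ρ < 1, 0 ≤ ρ ∧ ∀ x ∈ N, x ∈ M → ∃ y ∈ M, hermitianNorm y = 1 ∧
      ∃ τ : ℂ → ℂ, (∀ s ∈ Metric.ball (0:ℂ) δ, DifferentiableAt ℂ τ s ∧ deriv τ s ≠ 0 ∧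
        ‖τ s‖ ≤ ρ * ‖s‖) ∧ F.LeafHomotopy (Metric.ball 0 δ) (fun s => x + s • F.normalVec x)
          (fun s => y + τ s • F.normalVec y) := by
  have hz0 := hM.2.1 z hz
  have hz' := hM.form_ne_zero hz
  obtain ⟨W, f, hf, hzW, W', hWW, hW', hzW', hL⟩ := exists_firstIntegral_leafHomotopy hz0 hz'
  have hnz := form_normalVec hz'
  obtain ⟨y₀, hy₀W, hy₀, hy₀', hfy₀, hc⟩ :=
    hf.exists_contraction hn hzW hz1 (hW'.mem_nhds hzW') hnz
  let w : (Fin (n + 1) → ℂ) → Fin (n + 1) → ℂ := fun y =>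
    (hermitianNorm y : ℂ) • F.normalVec (((hermitianNorm y)⁻¹ : ℂ) • y)
  have hw : F.form y₀ (w y₀) = hermitianNorm y₀ ^ (d + 2) := form_smul_normalVec hy₀ hy₀'
  have hN0 : (hermitianNorm y₀ : ℂ) ≠ 0 := by exact_mod_cast (hermitianNorm_pos hy₀).ne'
  have hw0 : F.form y₀ (w y₀) ≠ 0 := by
    rw [hw]
    exact pow_ne_zero _ hN0
  have hlt := hc _ hw
  obtain ⟨T, hT, hT0, hTd, N₀, hN₀, δ₀, hδ₀, hNT⟩ := exists_transport hf hWW hW' hL hzW' hy₀W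
    hfy₀.symm (by rw [hnz]; exact one_ne_zero) hw0
  have hTlt : ‖fderiv ℂ T ((z, F.normalVec z, y₀, w y₀), 0) (0, 1)‖ < 1 := by
    rw [← hTd, norm_mul] at hlt
    by_contra! h
    nlinarith [norm_nonneg (fderiv ℂ f y₀ (w y₀))]
  obtain ⟨ρ, hρ1, hρ2⟩ := exists_between hTlt
  have e1 : ∀ᶠ x in nhds ((z, F.normalVec z, y₀, w y₀), (0:ℂ)), ‖fderiv ℂ T x (0, 1)‖ < ρ := by
    have hcont : ContinuousAt (fun x => ‖fderiv ℂ T x (0, 1)‖)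
        ((z, F.normalVec z, y₀, w y₀), (0:ℂ)) :=
      (hT.fderiv.continuousAt.clm_apply continuousAt_const).norm
    exact hcont.eventually_lt continuousAt_const hρ1
  rw [nhds_prod_eq] at e1
  obtain ⟨a, ha, b, hb, hab⟩ := Filter.eventually_prod_iff.1 e1
  obtain ⟨δ₁, hδ₁, hball⟩ := Metric.eventually_nhds_iff_ball.1 hb
  obtain ⟨σ, hσ, hσ0, -, hσ1, -⟩ := hf.exists_section (hWW hy₀W) hw0
  rw [hfy₀] at hσ hσ0 hσ1
  let Y : (Fin (n + 1) → ℂ) → Fin (n + 1) → ℂ := fun x => y₀ + σ (f x) • w y₀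
  have hY : ContinuousAt Y z := by
    have h1 : ContinuousAt (fun x => σ (f x)) z :=
      ContinuousAt.comp (g := σ) hσ.continuousAt (hf.analyticAt hzW).continuousAt
    exact continuousAt_const.add (h1.smul continuousAt_const)
  have hYz : Y z = y₀ := by simp [Y, hσ0]
  have hwc : ContinuousAt w y₀ := by
    have h1 : ContinuousAt (fun y : Fin (n + 1) → ℂ => (hermitianNorm y : ℂ)) y₀ :=
      (Complex.continuous_ofReal.comp continuous_hermitianNorm).continuousAt
    refine h1.smul (ContinuousAt.comp (g := F.normalVec) (continuousAt_normalVec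
      (form_smul_ne_zero (inv_ne_zero hN0) hy₀')) ((h1.inv₀ hN0).smul continuousAt_id))
  let P : (Fin (n + 1) → ℂ) → (Fin (n + 1) → ℂ) × (Fin (n + 1) → ℂ) × (Fin (n + 1) → ℂ) ×
    (Fin (n + 1) → ℂ) := fun x => (x, F.normalVec x, Y x, w (Y x))
  have hP : Filter.Tendsto P (nhds z) (nhds (z, F.normalVec z, y₀, w y₀)) := by
    have : ContinuousAt P z := continuousAt_id.prodMk ((continuousAt_normalVec hz').prodMk
      (hY.prodMk (ContinuousAt.comp (g := w) (by rwa [hYz]) hY)))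
    have h2 : P z = (z, F.normalVec z, y₀, w y₀) := by simp only [P, hYz]
    rw [← h2]
    exact this
  have e2 : ∀ᶠ x in nhds z, Y x ∈ W' :=
    hY.eventually_mem (by rw [hYz]; exact hW'.mem_nhds hy₀W)
  have e3 : ∀ᶠ x in nhds z, f (Y x) = f x :=
    (hf.analyticAt hzW).continuousAt.eventually hσ1
  refine ⟨_, (hP.eventually hN₀).and ((hP.eventually ha).and (e2.and e3)), min δ₀ δ₁,
    lt_min hδ₀ hδ₁, ρ, hρ2, (norm_nonneg _).trans hρ1.le, ?_⟩
  rintro x ⟨hx1, hx2, hx3, hx4⟩ hxM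
  obtain ⟨hLH, hT00, hTs⟩ := hNT _ hx1
  have hYx0 := hf.ne_zero _ (hWW hx3)
  have hNx := hermitianNorm_pos hYx0
  have hNx' : (hermitianNorm (Y x) : ℂ) ≠ 0 := by exact_mod_cast hNx.ne'
  have hsub : Metric.ball (0:ℂ) (min δ₀ δ₁) ⊆ Metric.ball 0 δ₀ :=
    Metric.ball_subset_ball (min_le_left _ _)
  have hsub' : Metric.ball (0:ℂ) (min δ₀ δ₁) ⊆ Metric.ball 0 δ₁ :=
    Metric.ball_subset_ball (min_le_right _ _)
  have hder : ∀ s ∈ Metric.ball (0:ℂ) (min δ₀ δ₁), HasDerivAt (fun s => T (P x, s))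
      (fderiv ℂ T (P x, s) (0, 1)) s := fun s hs =>
    hasDerivAt_comp_prodMk (hTs s (hsub hs)).1.differentiableAt
  have hT00' : T (P x, 0) = 0 := hT00 hx4.symm
  have hbound : ∀ s ∈ Metric.ball (0:ℂ) (min δ₀ δ₁), ‖T (P x, s)‖ ≤ ρ * ‖s‖ := by
    intro s hs
    have := norm_le_of_norm_deriv_le (T := fun s => T (P x, s)) (C := ρ) (fun s hs =>
      ⟨(hder s hs).differentiableAt, by
        rw [(hder s hs).deriv]
        exact (hab hx2 (hball s (hsub' hs))).le⟩) hs
    simpa [hT00'] using this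
  have hLH' : F.LeafHomotopy (Metric.ball 0 (min δ₀ δ₁)) (fun s => x + s • F.normalVec x)
      (fun s => (((hermitianNorm (Y x))⁻¹ : ℂ) • Y x) + T (P x, s) •
        F.normalVec (((hermitianNorm (Y x))⁻¹ : ℂ) • Y x)) := by
    refine ((hLH.mono hsub).smul_right (inv_pos.2 hNx) fun s hs => ?_).congr (fun s hs => rfl)
      fun s hs => ?_
    · have := hWW (hTs s (hsub hs)).2.2
      exact ⟨hf.ne_zero _ this, hf.form_ne_zero _ this⟩
    · simp only [P, w, smul_add, Complex.ofReal_inv]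
      rw [smul_comm _ (T _), smul_smul _ (hermitianNorm (Y x) : ℂ), inv_mul_cancel₀ hNx', one_smul]
  have h0 : (0:ℂ) ∈ Metric.ball (0:ℂ) (min δ₀ δ₁) := Metric.mem_ball_self (lt_min hδ₀ hδ₁)
  refine ⟨((hermitianNorm (Y x))⁻¹ : ℂ) • Y x, ?_, hermitianNorm_inv_smul hYx0,
    fun s => T (P x, s), fun s hs => ⟨(hder s hs).differentiableAt, ?_, hbound s hs⟩, hLH'⟩
  · have := hLH'.mem_leaf h0
    simp only [hT00', zero_smul, add_zero] at this
    exact (hM.mem_iff_of_mem_leaf this).1 hxM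
  · rw [(hder s hs).deriv]
    exact (hTs s (hsub hs)).2.1

theorem IsNontrivialMinimalSet.isCompact_inter_sphere (hM : F.IsNontrivialMinimalSet M) :
    IsCompact {z | z ∈ M ∧ hermitianNorm z = 1} := by
  have h : {z | z ∈ M ∧ hermitianNorm z = 1} =
      {z | hermitianNorm z = 1} ∩ closure M := by
    ext z
    refine ⟨fun h => ⟨h.2, subset_closure h.1⟩, fun h => ⟨hM.2.2.2.1 z h.2 ?_, h.1⟩⟩
    rintro rfl
    have := h.1
    simp [hermitianNorm] at this
  rw [h]
  exact isCompact_hermitianSphere.inter_right isClosed_closure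

theorem IsNontrivialMinimalSet.exists_contraction (hM : F.IsNontrivialMinimalSet M)
    (hn : 2 ≤ n) :
    ∃ δ > 0, ∃ ρ < 1, 0 ≤ ρ ∧ ∀ x ∈ M, hermitianNorm x = 1 → ∃ y ∈ M, hermitianNorm y = 1 ∧
      ∃ τ : ℂ → ℂ, (∀ s ∈ Metric.ball (0:ℂ) δ, DifferentiableAt ℂ τ s ∧ deriv τ s ≠ 0 ∧
        ‖τ s‖ ≤ ρ * ‖s‖) ∧ F.LeafHomotopy (Metric.ball 0 δ) (fun s => x + s • F.normalVec x)
          (fun s => y + τ s • F.normalVec y) := by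
  have := hM.isCompact_inter_sphere.induction_on (p := fun S => ∃ δ > 0, ∃ ρ < 1, 0 ≤ ρ ∧ ∀ x ∈ S,
    x ∈ M → ∃ y ∈ M, hermitianNorm y = 1 ∧
      ∃ τ : ℂ → ℂ, (∀ s ∈ Metric.ball (0:ℂ) δ, DifferentiableAt ℂ τ s ∧ deriv τ s ≠ 0 ∧
        ‖τ s‖ ≤ ρ * ‖s‖) ∧ F.LeafHomotopy (Metric.ball 0 δ) (fun s => x + s • F.normalVec x)
          (fun s => y + τ s • F.normalVec y)) ?_ ?_ ?_ ?_
  · obtain ⟨δ, hδ, ρ, hρ, hρ0, h⟩ := this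
    exact ⟨δ, hδ, ρ, hρ, hρ0, fun x hx hx' => h x ⟨hx, hx'⟩ hx⟩
  · exact ⟨1, one_pos, 0, one_pos, le_rfl, fun x hx => absurd hx (notMem_empty x)⟩
  · rintro s t hst ⟨δ, hδ, ρ, hρ, hρ0, h⟩
    exact ⟨δ, hδ, ρ, hρ, hρ0, fun x hx => h x (hst hx)⟩
  · rintro s t ⟨δ, hδ, ρ, hρ, hρ0, h⟩ ⟨δ', hδ', ρ', hρ', hρ0', h'⟩
    have hs : Metric.ball (0:ℂ) (min δ δ') ⊆ Metric.ball 0 δ :=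
      Metric.ball_subset_ball (min_le_left _ _)
    have hs' : Metric.ball (0:ℂ) (min δ δ') ⊆ Metric.ball 0 δ' :=
      Metric.ball_subset_ball (min_le_right _ _)
    refine ⟨min δ δ', lt_min hδ hδ', max ρ ρ', max_lt hρ hρ', le_max_of_le_left hρ0, ?_⟩
    rintro x (hx | hx) hxM
    · obtain ⟨y, hy, hy1, τ, hτ, hL⟩ := h x hx hxM
      exact ⟨y, hy, hy1, τ, fun s hs₁ => ⟨(hτ s (hs hs₁)).1, (hτ s (hs hs₁)).2.1,
        (hτ s (hs hs₁)).2.2.trans (by gcongr; exact le_max_left _ _)⟩, hL.mono hs⟩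
    · obtain ⟨y, hy, hy1, τ, hτ, hL⟩ := h' x hx hxM
      exact ⟨y, hy, hy1, τ, fun s hs₁ => ⟨(hτ s (hs' hs₁)).1, (hτ s (hs' hs₁)).2.1,
        (hτ s (hs' hs₁)).2.2.trans (by gcongr; exact le_max_right _ _)⟩, hL.mono hs'⟩
  · intro x hx
    obtain ⟨N, hN, h⟩ := hM.exists_local_contraction hn hx.1 hx.2
    exact ⟨N, mem_nhdsWithin_of_mem_nhds hN, h⟩

end

end ProjFoliation

/-- A holomorphic self-map of a disc of radius `ε` with values of modulus at most `ε / 4`, which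
preserves a nonempty relatively closed set, has a contracting fixed point in this set. -/
theorem exists_fixedPoint_of_norm_le {G : ℂ → ℂ} {ε : ℝ} (hε : 0 < ε)
    (hG : DifferentiableOn ℂ G (Metric.ball 0 ε)) (hGb : ∀ s ∈ Metric.ball (0:ℂ) ε, ‖G s‖ ≤ ε / 4)
    {C : Set ℂ} (hC : IsClosed C) (h0 : 0 ∈ C)
    (hGC : ∀ s ∈ Metric.ball (0:ℂ) ε, s ∈ C → G s ∈ C) :
    ∃ s ∈ C, ‖s‖ ≤ ε / 4 ∧ G s = s ∧ ‖deriv G s‖ < 1 := by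
  have hder : ∀ s ∈ Metric.closedBall (0:ℂ) (ε / 4), ‖deriv G s‖ ≤ 1 / 2 := by
    intro s hs
    have hsub : Metric.closedBall s (ε / 2) ⊆ Metric.ball 0 ε := by
      refine Metric.closedBall_subset_ball' ?_
      rw [Metric.mem_closedBall] at hs
      linarith
    have := Complex.norm_deriv_le_of_forall_mem_sphere_norm_le (half_pos hε)
      (f := G) (c := s) (C := ε / 4)
      ⟨hG.mono (Metric.ball_subset_closedBall.trans hsub), by
        refine (hG.continuousOn).mono ?_
        rw [closure_ball _ (half_pos hε).ne']
        exact hsub⟩ fun w hw => hGb w (hsub (Metric.sphere_subset_closedBall hw))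
    refine this.trans (le_of_eq ?_)
    field_simp
    norm_num
  have hsub : Metric.closedBall (0:ℂ) (ε / 4) ⊆ Metric.ball 0 ε :=
    Metric.closedBall_subset_ball (by linarith)
  have hmaps : MapsTo G (C ∩ Metric.closedBall 0 (ε / 4)) (C ∩ Metric.closedBall 0 (ε / 4)) :=
    fun s hs => ⟨hGC s (hsub hs.2) hs.1, by simpa using hGb s (hsub hs.2)⟩
  have hlip : LipschitzOnWith (1 / 2) G (C ∩ Metric.closedBall 0 (ε / 4)) := by
    refine LipschitzOnWith.mono ?_ inter_subset_right
    refine (convex_closedBall (0:ℂ) (ε / 4)).lipschitzOnWith_of_nnnorm_deriv_le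
      (fun s hs => (hG.differentiableAt (Metric.isOpen_ball.mem_nhds (hsub hs)))) fun s hs => ?_
    rw [← NNReal.coe_le_coe]
    simpa using hder s hs
  have hcontr : ContractingWith (1 / 2) (hmaps.restrict G _ _) := by
    refine ⟨?_, hlip.mapsToRestrict hmaps⟩
    rw [← NNReal.coe_lt_coe]
    norm_num
  obtain ⟨s, hs, hfix, -⟩ := hcontr.exists_fixedPoint'
    (hC.inter Metric.isClosed_closedBall).isComplete hmaps
    (x := 0) ⟨h0, Metric.mem_closedBall_self (by linarith)⟩ (edist_ne_top _ _)
  exact ⟨s, hs.1, by simpa using hs.2, hfix, (hder s hs.2).trans_lt (by norm_num)⟩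

namespace ProjFoliation

section
variable {n d : ℕ} {F : ProjFoliation n d} {M : Set (Fin (n + 1) → ℂ)}
variable {f g : (Fin (n + 1) → ℂ) → ℂ} {U V : Set (Fin (n + 1) → ℂ)} {p q x y z : Fin (n + 1) → ℂ}

/-- A sequence of points of a minimal set joined by transport maps which contract more and more. -/
theorem IsNontrivialMinimalSet.exists_contracting_sequence (hM : F.IsNontrivialMinimalSet M)
    (hn : 2 ≤ n) :
    ∃ δ > 0, ∃ ρ < 1, 0 ≤ ρ ∧ ∃ X : ℕ → Fin (n + 1) → ℂ, ∃ B : ℕ → ℕ → ℂ → ℂ,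
      (∀ k, X k ∈ M ∧ hermitianNorm (X k) = 1) ∧ ∀ j m,
        (∀ s ∈ Metric.ball (0:ℂ) δ, DifferentiableAt ℂ (B j m) s ∧ deriv (B j m) s ≠ 0 ∧
          ‖B j m s‖ ≤ ρ ^ m * ‖s‖) ∧
        F.LeafHomotopy (Metric.ball 0 δ) (fun s => X j + s • F.normalVec (X j))
          (fun s => X (j + m) + B j m s • F.normalVec (X (j + m))) := by
  obtain ⟨δ, hδ, ρ, hρ, hρ0, h⟩ := hM.exists_contraction hn
  obtain ⟨x₀, hx₀⟩ := hM.1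
  have hxn := hM.2.1 x₀ hx₀
  choose! Y hYM hY1 τ hτ hL using h
  let X : ℕ → Fin (n + 1) → ℂ := fun k =>
    Y^[k] (((hermitianNorm x₀ : ℂ)⁻¹) • x₀)
  have hX : ∀ k, X k ∈ M ∧ hermitianNorm (X k) = 1 := by
    intro k
    induction k with
    | zero =>
      refine ⟨hM.2.2.1 _ (inv_ne_zero ?_) _ hx₀, hermitianNorm_inv_smul hxn⟩
      exact_mod_cast (hermitianNorm_pos hxn).ne'
    | succ k ih =>
      simp only [X, Function.iterate_succ_apply']
      exact ⟨hYM _ ih.1 ih.2, hY1 _ ih.1 ih.2⟩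
  have hXs : ∀ k, X (k + 1) = Y (X k) := fun k => Function.iterate_succ_apply' _ _ _
  let B : ℕ → ℕ → ℂ → ℂ := fun j m => Nat.rec id (fun m b => τ (X (j + m)) ∘ b) m
  have hBs : ∀ j m, B j (m + 1) = τ (X (j + m)) ∘ B j m := fun j m => rfl
  refine ⟨δ, hδ, ρ, hρ, hρ0, X, B, hX, fun j m => ?_⟩
  induction m with
  | zero =>
    have hB0 : B j 0 = id := rfl
    simp only [hB0, add_zero, id, pow_zero, one_mul]
    refine ⟨fun s hs => ⟨differentiableAt_id, ?_, le_rfl⟩, ?_⟩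
    · rw [deriv_id]
      exact one_ne_zero
    · exact ⟨fun x => X j + x.2 • F.normalVec (X j), by fun_prop, fun s hs =>
        ⟨rfl, rfl, fun t ht => mem_leaf_self⟩⟩
  | succ m ih =>
    obtain ⟨h1, h2⟩ := ih
    have hmaps : MapsTo (B j m) (Metric.ball 0 δ) (Metric.ball 0 δ) := fun s hs => by
      rw [mem_ball_zero_iff] at hs ⊢
      refine ((h1 s (mem_ball_zero_iff.2 hs)).2.2.trans ?_).trans_lt hs
      exact mul_le_of_le_one_left (norm_nonneg s) (pow_le_one₀ hρ0 hρ.le)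
    have h3 := hτ _ (hX (j + m)).1 (hX (j + m)).2
    have h4 := hL _ (hX (j + m)).1 (hX (j + m)).2
    rw [hBs]
    refine ⟨fun s hs => ⟨?_, ?_, ?_⟩, ?_⟩
    · exact (h3 _ (hmaps hs)).1.comp s (h1 s hs).1
    · rw [deriv_comp s (h3 _ (hmaps hs)).1 (h1 s hs).1]
      exact mul_ne_zero (h3 _ (hmaps hs)).2.1 (h1 s hs).2.1
    · refine (h3 _ (hmaps hs)).2.2.trans ?_
      rw [pow_succ', mul_assoc]
      exact mul_le_mul_of_nonneg_left (h1 s hs).2.2 hρ0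
    · have h5 := h4.comp (τ := B j m) (fun s hs => (h1 s hs).1.continuousAt.continuousWithinAt)
        hmaps
      rw [← add_assoc, hXs]
      exact h2.trans h5

/-- A nontrivial minimal set contains a leaf with hyperbolic holonomy. -/
theorem IsNontrivialMinimalSet.exists_hyperbolic_holonomy (hM : F.IsNontrivialMinimalSet M)
    (hn : 2 ≤ n) : ∃ p ∈ M, ∃ v, F.form p v ≠ 0 ∧ ∃ r > 0, ∃ h : ℂ → ℂ,
      DifferentiableOn ℂ h (Metric.ball 0 r) ∧ h 0 = 0 ∧ deriv h 0 ≠ 0 ∧ ‖deriv h 0‖ < 1 ∧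
        F.IsHolonomyAt p v r h := by
  obtain ⟨δ, hδ, ρ, hρ, hρ0, X, B, hX, hB⟩ := hM.exists_contracting_sequence hn
  obtain ⟨q, ⟨hq, hq1⟩, φ, hφ, hlim⟩ := hM.isCompact_inter_sphere.tendsto_subseq hX
  have hq0 := hM.2.1 q hq
  have hq' := hM.form_ne_zero hq
  set v := F.normalVec q with hv
  have hnz : F.form q v = 1 := form_normalVec hq'
  have hnz' : F.form q v ≠ 0 := by rw [hnz]; exact one_ne_zero
  obtain ⟨W, f, hf, hzW, W', hWW, hW', hzW', hL⟩ := exists_firstIntegral_leafHomotopy hq0 hq'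
  obtain ⟨T, hT, hT0, hTd, N₀, hN₀, δ₀, hδ₀, hNT⟩ := exists_transport hf hWW hW' hL hzW' hzW'
    rfl hnz' hnz'
  have hT1 : fderiv ℂ T ((q, v, q, v), 0) (0, 1) = 1 :=
    mul_right_cancel₀ (mt (hf.fderiv_apply_eq_zero_iff hzW).1 hnz') (by rw [hTd, one_mul])
  have e1 : ∀ᶠ x in nhds ((q, v, q, v), (0:ℂ)), ‖fderiv ℂ T x (0, 1)‖ < 2 := by
    have hcont : ContinuousAt (fun x => ‖fderiv ℂ T x (0, 1)‖) ((q, v, q, v), (0:ℂ)) :=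
      (hT.fderiv.continuousAt.clm_apply continuousAt_const).norm
    exact hcont.eventually_lt continuousAt_const (by simp [hT1])
  rw [nhds_prod_eq] at e1
  obtain ⟨a, ha, b, hb, hab⟩ := Filter.eventually_prod_iff.1 e1
  have e2 : ∀ᶠ s in nhds (0:ℂ), F.form (q + s • v) v ≠ 0 := by
    have h1 : Continuous fun s : ℂ => F.form (q + s • v) v :=
      (F.continuous_form.comp (by fun_prop)).clm_apply continuous_const
    exact h1.continuousAt.eventually_ne (by simpa using hnz')
  obtain ⟨δ₁, hδ₁, hball⟩ := Metric.eventually_nhds_iff_ball.1 (hb.and e2)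
  obtain ⟨ε, hε, hε₀, hε₁, hε₂⟩ : ∃ ε > 0, ε ≤ δ₀ ∧ ε ≤ δ₁ ∧ 3 * ε ≤ δ :=
    ⟨min δ₀ (min δ₁ (δ / 3)), by positivity, min_le_left _ _,
      (min_le_right _ _).trans (min_le_left _ _), by
        have := (min_le_right δ₀ (min δ₁ (δ / 3))).trans (min_le_right _ _)
        linarith⟩
  have e3 : ∀ᶠ P in nhds (q, v, q, v), ‖T (P, 0)‖ < ε / 16 := by
    have h1 : ContinuousAt (fun P => ‖T (P, 0)‖) (q, v, q, v) :=
      (ContinuousAt.comp (g := T) (f := fun P => (P, (0:ℂ))) hT.continuousAt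
        (by fun_prop : Continuous fun P : (Fin (n + 1) → ℂ) × (Fin (n + 1) → ℂ) ×
          (Fin (n + 1) → ℂ) × (Fin (n + 1) → ℂ) => (P, (0:ℂ))).continuousAt).norm
    exact h1.eventually_lt continuousAt_const (by simp [hT0, hε])
  have hXv : Filter.Tendsto (fun i => F.normalVec (X (φ i))) Filter.atTop (nhds v) :=
    (continuousAt_normalVec hq').tendsto.comp hlim
  have hXl : Filter.Tendsto (fun i => X (φ i)) Filter.atTop (nhds q) := hlim
  have t1 : Filter.Tendsto (fun i => (q, v, X (φ i), F.normalVec (X (φ i)))) Filter.atTop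
      (nhds (q, v, q, v)) :=
    tendsto_const_nhds.prodMk_nhds (tendsto_const_nhds.prodMk_nhds (hXl.prodMk_nhds hXv))
  have t2 : Filter.Tendsto (fun i => (X (φ i), F.normalVec (X (φ i)), q, v)) Filter.atTop
      (nhds (q, v, q, v)) :=
    hXl.prodMk_nhds (hXv.prodMk_nhds (tendsto_const_nhds.prodMk_nhds tendsto_const_nhds))
  have eP := (Filter.eventually_mem_set.2 hN₀).and (ha.and e3)
  obtain ⟨I, hI⟩ := Filter.eventually_atTop.1 ((t1.eventually eP).and (t2.eventually eP))
  obtain ⟨m₀, hm₀⟩ := exists_pow_lt_of_lt_one (show (0:ℝ) < 1 / 48 by norm_num) hρ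
  obtain ⟨k, hIk, hk⟩ : ∃ k ≥ I, φ I + m₀ ≤ φ k :=
    ⟨I + m₀, by omega, by
      have := hφ.add_le_nat m₀ I
      rwa [add_comm m₀ (φ I), add_comm m₀ I] at this⟩
  obtain ⟨m, hm⟩ := Nat.exists_eq_add_of_le hk
  obtain ⟨hBs, hBL⟩ := hB (φ I) (m₀ + m)
  have hkm : φ I + (m₀ + m) = φ k := by omega
  rw [hkm] at hBL
  set P₁ := (q, v, X (φ I), F.normalVec (X (φ I))) with hP₁
  set P₂ := (X (φ k), F.normalVec (X (φ k)), q, v) with hP₂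
  have hTb : ∀ P, P ∈ N₀ ∧ a P ∧ ‖T (P, 0)‖ < ε / 16 → ∀ s ∈ Metric.ball (0:ℂ) ε,
      DifferentiableAt ℂ (fun s => T (P, s)) s ∧ deriv (fun s => T (P, s)) s ≠ 0 ∧
        ‖T (P, s)‖ ≤ ε / 16 + 2 * ‖s‖ := by
    intro P hP s hs
    have hd : ∀ s ∈ Metric.ball (0:ℂ) ε, HasDerivAt (fun s => T (P, s))
        (fderiv ℂ T (P, s) (0, 1)) s := fun s hs => hasDerivAt_comp_prodMk
      ((hNT P hP.1).2.2 s (Metric.ball_subset_ball hε₀ hs)).1.differentiableAt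
    refine ⟨(hd s hs).differentiableAt, ?_, ?_⟩
    · rw [(hd s hs).deriv]
      exact ((hNT P hP.1).2.2 s (Metric.ball_subset_ball hε₀ hs)).2.1
    · have := norm_le_of_norm_deriv_le (T := fun s => T (P, s)) (C := 2) (fun s hs =>
        ⟨(hd s hs).differentiableAt, by
          rw [(hd s hs).deriv]
          exact (hab hP.2.1 (hball s (Metric.ball_subset_ball hε₁ hs)).1).le⟩) hs
      have h2 := norm_le_norm_add_norm_sub' (T (P, s)) (T (P, 0))
      linarith [hP.2.2]
  have b1 := hTb P₁ (hI I le_rfl).1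
  have b2 := hTb P₂ (hI k hIk).2
  have m1 : ∀ s ∈ Metric.ball (0:ℂ) ε, ‖T (P₁, s)‖ < 3 * ε := fun s hs => by
    have := (b1 s hs).2.2
    rw [mem_ball_zero_iff] at hs
    linarith
  have m1' : MapsTo (fun s => T (P₁, s)) (Metric.ball 0 ε) (Metric.ball 0 δ) := fun s hs => by
    rw [mem_ball_zero_iff]
    exact (m1 s hs).trans_le hε₂
  let A : ℂ → ℂ := B (φ I) (m₀ + m) ∘ fun s => T (P₁, s)
  have m2 : ∀ s ∈ Metric.ball (0:ℂ) ε, ‖A s‖ < ε / 16 := fun s hs => by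
    have h1 := (hBs _ (m1' hs)).2.2
    have h2 : ρ ^ (m₀ + m) ≤ 1 / 48 := by
      rw [pow_add]
      have := pow_le_one₀ (n := m) hρ0 hρ.le
      have := pow_nonneg hρ0 m₀
      nlinarith
    have h3 := m1 s hs
    have h4 : ρ ^ (m₀ + m) * ‖T (P₁, s)‖ ≤ 1 / 48 * ‖T (P₁, s)‖ :=
      mul_le_mul_of_nonneg_right h2 (norm_nonneg _)
    simp only [A, Function.comp]
    linarith
  have m2' : MapsTo A (Metric.ball 0 ε) (Metric.ball 0 ε) := fun s hs => by
    rw [mem_ball_zero_iff]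
    linarith [m2 s hs]
  have hA : ∀ s ∈ Metric.ball (0:ℂ) ε, DifferentiableAt ℂ A s ∧ deriv A s ≠ 0 := fun s hs => by
    refine ⟨(hBs _ (m1' hs)).1.comp s (b1 s hs).1, ?_⟩
    simp only [A]
    rw [deriv_comp s (hBs _ (m1' hs)).1 (b1 s hs).1]
    exact mul_ne_zero (hBs _ (m1' hs)).2.1 (b1 s hs).2.1
  let G : ℂ → ℂ := (fun s => T (P₂, s)) ∘ A
  have hG : ∀ s ∈ Metric.ball (0:ℂ) ε, DifferentiableAt ℂ G s ∧ deriv G s ≠ 0 := fun s hs => by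
    refine ⟨(b2 _ (m2' hs)).1.comp s (hA s hs).1, ?_⟩
    simp only [G]
    rw [deriv_comp s (b2 _ (m2' hs)).1 (hA s hs).1]
    exact mul_ne_zero (b2 _ (m2' hs)).2.1 (hA s hs).2
  have hGb : ∀ s ∈ Metric.ball (0:ℂ) ε, ‖G s‖ ≤ ε / 4 := fun s hs => by
    have h1 := (b2 _ (m2' hs)).2.2
    have h2 := m2 s hs
    simp only [G, Function.comp]
    linarith
  have hcA : ContinuousOn A (Metric.ball 0 ε) := fun s hs =>
    (hA s hs).1.continuousAt.continuousWithinAt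
  have hGL : F.LeafHomotopy (Metric.ball 0 ε) (fun s => q + s • v) (fun s => q + G s • v) := by
    have l1 : F.LeafHomotopy (Metric.ball 0 ε) (fun s => q + s • v)
        (fun s => X (φ I) + T (P₁, s) • F.normalVec (X (φ I))) :=
      (hNT P₁ (hI I le_rfl).1.1).1.mono (Metric.ball_subset_ball hε₀)
    have l2 : F.LeafHomotopy (Metric.ball 0 ε)
        (fun s => X (φ I) + T (P₁, s) • F.normalVec (X (φ I)))
        (fun s => X (φ k) + A s • F.normalVec (X (φ k))) :=
      hBL.comp (fun s hs => (b1 s hs).1.continuousAt.continuousWithinAt) m1'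
    have l3 : F.LeafHomotopy (Metric.ball 0 ε)
        (fun s => X (φ k) + A s • F.normalVec (X (φ k))) (fun s => q + G s • v) :=
      (hNT P₂ (hI k hIk).2.1).1.comp hcA fun s hs => Metric.ball_subset_ball hε₀ (m2' hs)
    exact (l1.trans l2).trans l3
  have hne : ∀ s : ℂ, q + s • v ≠ 0 := by
    intro s hs
    have h1 : F.form q (q + s • v) = 0 := by rw [hs, map_zero]
    rw [map_add, F.form_self, map_smul, hnz, zero_add, smul_eq_mul, mul_one] at h1
    rw [h1, zero_smul, add_zero] at hs
    exact hq0 hs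
  have hC : {s : ℂ | q + s • v ∈ M} = (fun s : ℂ => q + s • v) ⁻¹' closure M := by
    ext s
    exact ⟨fun h => subset_closure h, fun h => hM.2.2.2.1 _ h (hne s)⟩
  obtain ⟨s₀, hs₀C, hs₀, hfix, hd⟩ := exists_fixedPoint_of_norm_le (C := {s : ℂ | q + s • v ∈ M}) hε
    (fun s hs => (hG s hs).1.differentiableWithinAt) hGb
    (by rw [hC]; exact isClosed_closure.preimage (by fun_prop)) (by simpa using hq)
    fun s hs hsC => (hM.mem_iff_of_mem_leaf (hGL.mem_leaf hs)).1 hsC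
  have hs₀ε : s₀ ∈ Metric.ball (0:ℂ) ε := by
    rw [mem_ball_zero_iff]
    linarith
  have hshift : MapsTo (fun s => s₀ + s) (Metric.ball 0 (ε / 2)) (Metric.ball 0 ε) := fun s hs => by
    rw [mem_ball_zero_iff] at hs ⊢
    linarith [norm_add_le s₀ s]
  have hderiv : HasDerivAt (fun s => G (s₀ + s) - s₀) (deriv G s₀) 0 := by
    have h1 : HasDerivAt G (deriv G s₀) (s₀ + 0) := by
      rw [add_zero]
      exact (hG s₀ hs₀ε).1.hasDerivAt
    simpa using (h1.comp_const_add s₀ 0).sub_const s₀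
  refine ⟨q + s₀ • v, hs₀C, v, (hball s₀ (Metric.ball_subset_ball hε₁ hs₀ε)).2, ε / 2, half_pos hε,
    fun s => G (s₀ + s) - s₀, ?_, by simp [hfix], ?_, ?_, ?_⟩
  · intro s hs
    have h1 : DifferentiableAt ℂ (fun s => G (s₀ + s)) s :=
      ((hG _ (hshift hs)).1.hasDerivAt.comp_const_add s₀ s).differentiableAt
    exact (h1.sub_const s₀).differentiableWithinAt
  · rw [hderiv.deriv]
    exact (hG s₀ hs₀ε).2
  · rwa [hderiv.deriv]
  · obtain ⟨H, hH, hHs⟩ := hGL.comp (by fun_prop) hshift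
    have h0 : (0:ℂ) ∈ Metric.ball (0:ℂ) (ε / 2) := Metric.mem_ball_self (half_pos hε)
    have hs : ∀ s : ℂ, q + (s₀ + s) • v = q + s₀ • v + s • v := fun s => by
      rw [add_smul, add_assoc]
    refine ⟨fun t => H (t, 0), hH.comp (by fun_prop) fun t ht => ⟨ht, h0⟩, ?_, ?_, ?_, H, hH,
      fun t _ => rfl, fun s hs' => ⟨?_, ?_⟩, fun t ht s hs' => ?_⟩
    · simpa using (hHs 0 h0).1
    · simpa [hfix] using (hHs 0 h0).2.1
    · intro t ht
      simpa using (hHs 0 h0).2.2 t ht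
    · exact (hHs s hs').1.trans (hs s)
    · refine (hHs s hs').2.1.trans ?_
      rw [sub_smul, add_add_sub_cancel]
    · rw [← hs]
      exact (hHs s hs').2.2 t ht

end

end ProjFoliation

theorem AnalyticAt.exists_eq_add_mul {f : ℂ → ℂ} (hf : AnalyticAt ℂ f 0) :
    ∃ g : ℂ → ℂ, AnalyticAt ℂ g 0 ∧ g 0 = deriv f 0 ∧ ∀ z, f z = f 0 + z * g z := by
  obtain ⟨p, hp⟩ := hf
  refine ⟨dslope f 0, ⟨_, hp.has_fpower_series_dslope_fslope⟩, dslope_same f 0, fun z => ?_⟩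
  have := sub_smul_dslope f 0 z
  rw [sub_zero, smul_eq_mul] at this
  rw [this]
  ring

/-- Koenigs' linearization of a contracting germ. -/
theorem AnalyticAt.exists_koenigs {h : ℂ → ℂ} (hh : AnalyticAt ℂ h 0) (h0 : h 0 = 0)
    (hl : deriv h 0 ≠ 0) (hl1 : ‖deriv h 0‖ < 1) :
    ∃ φ : ℂ → ℂ, AnalyticAt ℂ φ 0 ∧ φ 0 = 0 ∧ deriv φ 0 ≠ 0 ∧
      ∀ᶠ s in nhds (0:ℂ), φ (h s) = deriv h 0 * φ s := by
  set lam := deriv h 0 with hlam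
  have hlpos : 0 < ‖lam‖ := norm_pos_iff.2 hl
  obtain ⟨g, hg, hg0, hgz⟩ := hh.exists_eq_add_mul
  obtain ⟨k, hk, -, hkz⟩ := hg.exists_eq_add_mul
  have hhk : ∀ z, h z - lam * z = z ^ 2 * k z := fun z => by
    rw [hgz, hkz, h0, hg0]
    ring
  set C := ‖k 0‖ + 1 with hC
  have hCpos : 0 < C := by positivity
  obtain ⟨c, hc1, hc2⟩ : ∃ c, ‖lam‖ < c ∧ c ^ 2 < ‖lam‖ := by
    refine ⟨Real.sqrt (‖lam‖ * ((1 + ‖lam‖) / 2)), Real.lt_sqrt_of_sq_lt ?_, ?_⟩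
    · nlinarith
    · rw [Real.sq_sqrt (by positivity)]
      nlinarith
  have hcpos : 0 < c := hlpos.trans hc1
  have hcone : c < 1 := by nlinarith
  have e1 : ∀ᶠ s in nhds (0:ℂ), ‖k s‖ < C :=
    hk.continuousAt.norm.eventually_lt continuousAt_const (by simp [hC])
  obtain ⟨r₀, hr₀, hball⟩ := Metric.eventually_nhds_iff_ball.1 (e1.and hh.eventually_analyticAt)
  set r := min r₀ (min 1 ((c - ‖lam‖) / C)) with hr
  have hrpos : 0 < r := lt_min hr₀ (lt_min one_pos (div_pos (by linarith) hCpos))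
  have hr0 : r ≤ r₀ := min_le_left _ _
  have hr1 : r ≤ 1 := (min_le_right _ _).trans (min_le_left _ _)
  have hr2 : r * C ≤ c - ‖lam‖ := by
    rw [← le_div_iff₀ hCpos]
    exact (min_le_right _ _).trans (min_le_right _ _)
  have b1 : ∀ s ∈ Metric.ball (0:ℂ) r, ‖h s - lam * s‖ ≤ C * ‖s‖ ^ 2 := fun s hs => by
    rw [hhk, norm_mul, norm_pow, mul_comm]
    exact mul_le_mul_of_nonneg_right (hball s (Metric.ball_subset_ball hr0 hs)).1.le (by positivity)
  have b2 : ∀ s ∈ Metric.ball (0:ℂ) r, ‖h s‖ ≤ c * ‖s‖ := fun s hs => by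
    have h1 := b1 s hs
    have h2 := norm_le_norm_add_norm_sub' (h s) (lam * s)
    rw [norm_mul] at h2
    rw [mem_ball_zero_iff] at hs
    have h3 : C * ‖s‖ ^ 2 ≤ (c - ‖lam‖) * ‖s‖ := by
      rw [pow_two, ← mul_assoc]
      refine mul_le_mul_of_nonneg_right ?_ (norm_nonneg s)
      nlinarith
    linarith
  have hmaps : MapsTo h (Metric.ball 0 r) (Metric.ball 0 r) := fun s hs => by
    have h1 := b2 s hs
    rw [mem_ball_zero_iff] at hs ⊢
    nlinarith [norm_nonneg s]
  have hit : ∀ j, ∀ s ∈ Metric.ball (0:ℂ) r, h^[j] s ∈ Metric.ball (0:ℂ) r ∧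
      ‖h^[j] s‖ ≤ c ^ j * ‖s‖ ∧ DifferentiableAt ℂ h^[j] s := by
    intro j s hs
    induction j with
    | zero => exact ⟨hs, by simp, differentiableAt_id⟩
    | succ j ih =>
      rw [Function.iterate_succ_apply', Function.iterate_succ']
      refine ⟨hmaps ih.1, (b2 _ ih.1).trans ?_, ?_⟩
      · rw [pow_succ', mul_assoc]
        exact mul_le_mul_of_nonneg_left ih.2.1 hcpos.le
      · exact (hball _ (Metric.ball_subset_ball hr0 ih.1)).2.differentiableAt.comp s ih.2.2
  let D : ℕ → ℂ → ℂ := fun j s => lam⁻¹ ^ (j + 1) * h^[j + 1] s - lam⁻¹ ^ j * h^[j] s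
  have hD : ∀ j, ∀ s ∈ Metric.ball (0:ℂ) r, ‖D j s‖ ≤ (C / ‖lam‖) * (c ^ 2 / ‖lam‖) ^ j *
      ‖s‖ ^ 2 := by
    intro j s hs
    have e : D j s = lam⁻¹ ^ (j + 1) * (h (h^[j] s) - lam * h^[j] s) := by
      have e1 : lam⁻¹ ^ j = lam⁻¹ ^ (j + 1) * lam := by
        rw [pow_succ, mul_assoc, inv_mul_cancel₀ hl, mul_one]
      simp only [D, Function.iterate_succ_apply']
      rw [e1]
      ring
    obtain ⟨i1, i2, -⟩ := hit j s hs
    rw [e, norm_mul, norm_pow, norm_inv]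
    calc ‖lam‖⁻¹ ^ (j + 1) * ‖h (h^[j] s) - lam * h^[j] s‖
        ≤ ‖lam‖⁻¹ ^ (j + 1) * (C * (c ^ j * ‖s‖) ^ 2) := by
          refine mul_le_mul_of_nonneg_left ((b1 _ i1).trans ?_) (by positivity)
          gcongr
      _ = _ := by
          rw [div_pow, ← pow_mul, mul_pow, ← pow_mul, mul_comm j 2, inv_pow, pow_succ]
          field_simp
  have hq : c ^ 2 / ‖lam‖ < 1 := (div_lt_one hlpos).2 hc2
  have hsum : Summable fun j : ℕ => (C / ‖lam‖) * (c ^ 2 / ‖lam‖) ^ j :=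
    (summable_geometric_of_lt_one (by positivity) hq).mul_left _
  have hDd : DifferentiableOn ℂ (fun s => ∑' j, D j s) (Metric.ball 0 r) := by
    refine differentiableOn_tsum_of_summable_norm hsum (fun j s hs => ?_) Metric.isOpen_ball
      fun j s hs => ?_
    · exact (((hit (j + 1) s hs).2.2.const_mul _).sub
        ((hit j s hs).2.2.const_mul _)).differentiableWithinAt
    · refine (hD j s hs).trans (mul_le_of_le_one_right (by positivity) ?_)
      rw [mem_ball_zero_iff] at hs
      exact pow_le_one₀ (norm_nonneg s) (hs.le.trans hr1)
  have hDs : ∀ s ∈ Metric.ball (0:ℂ) r, Summable fun j => D j s := fun s hs =>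
    Summable.of_norm_bounded (hsum.mul_right (‖s‖ ^ 2)) fun j => hD j s hs
  let φ : ℂ → ℂ := fun s => s + ∑' j, D j s
  have hlim : ∀ s ∈ Metric.ball (0:ℂ) r,
      Filter.Tendsto (fun j => lam⁻¹ ^ j * h^[j] s) Filter.atTop (nhds (φ s)) := by
    intro s hs
    have h1 := (hDs s hs).hasSum.tendsto_sum_nat
    have h2 : ∀ N, ∑ j ∈ Finset.range N, D j s = lam⁻¹ ^ N * h^[N] s - s := fun N => by
      have := Finset.sum_range_sub (fun j => lam⁻¹ ^ j * h^[j] s) N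
      exact this.trans (by simp)
    simp only [h2] at h1
    simpa [φ] using h1.const_add s
  have hD0 : ∀ j, D j 0 = 0 := fun j => by
    have := hD j 0 (Metric.mem_ball_self hrpos)
    simpa using this
  have hφd : DifferentiableOn ℂ φ (Metric.ball 0 r) := differentiableOn_id.add hDd
  have hφ0 : φ 0 = 0 := by simp [φ, hD0]
  have hφ : AnalyticAt ℂ φ 0 := hφd.analyticAt (Metric.ball_mem_nhds 0 hrpos)
  refine ⟨φ, hφ, hφ0, ?_, ?_⟩
  · have hder : HasDerivAt (fun s => ∑' j, D j s) 0 0 := by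
      rw [hasDerivAt_iff_isLittleO]
      simp only [hD0, tsum_zero, sub_zero, smul_zero]
      have hO : (fun s => ∑' j, D j s) =O[nhds 0] fun s : ℂ => ‖s‖ ^ 2 := by
        refine Asymptotics.IsBigO.of_bound (∑' j : ℕ, (C / ‖lam‖) * (c ^ 2 / ‖lam‖) ^ j) ?_
        filter_upwards [Metric.ball_mem_nhds (0:ℂ) hrpos] with s hs
        rw [norm_pow, norm_norm, ← tsum_mul_right]
        exact tsum_of_norm_bounded (hsum.mul_right (‖s‖ ^ 2)).hasSum fun j => hD j s hs
      refine hO.trans_isLittleO ?_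
      exact (Asymptotics.isLittleO_norm_pow_id (E' := ℂ) one_lt_two)
    have : HasDerivAt φ (1 + 0) 0 := (hasDerivAt_id 0).add hder
    rw [this.deriv]
    simp
  · filter_upwards [Metric.ball_mem_nhds (0:ℂ) hrpos] with s hs
    have h1 := hlim _ (hmaps hs)
    have h2 := ((hlim s hs).comp (Filter.tendsto_add_atTop_nat 1)).const_mul lam
    refine tendsto_nhds_unique h1 (h2.congr fun j => ?_)
    simp only [Function.comp, Function.iterate_succ_apply, pow_succ]
    field_simp

/-- A relatively closed subset of a disk which is invariant under a contracting homothety extends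
to a closed subset of the plane invariant under that homothety. -/
theorem exists_isClosed_homothety_invariant {lam : ℂ} (hl1 : ‖lam‖ < 1)
    {Q : ℂ → Prop} {r : ℝ} (hr : 0 < r)
    (hQ : ∀ z ∈ Metric.ball (0:ℂ) r, Q (lam * z) ↔ Q z)
    (hQc : ∀ z ∈ Metric.ball (0:ℂ) r, ¬ Q z → ∀ᶠ w in nhds z, ¬ Q w) :
    ∃ K : Set ℂ, IsClosed K ∧ (∀ z, lam * z ∈ K ↔ z ∈ K) ∧
      ∀ z ∈ Metric.ball (0:ℂ) r, z ∈ K ↔ Q z := by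
  have hball : ∀ z ∈ Metric.ball (0:ℂ) r, lam * z ∈ Metric.ball (0:ℂ) r := fun z hz => by
    rw [mem_ball_zero_iff] at hz ⊢
    rw [norm_mul]
    nlinarith [norm_nonneg z, norm_nonneg lam]
  have hstep : ∀ j k : ℕ, ∀ z, lam ^ k * z ∈ Metric.ball (0:ℂ) r →
      lam ^ (k + j) * z ∈ Metric.ball (0:ℂ) r ∧ (Q (lam ^ (k + j) * z) ↔ Q (lam ^ k * z)) := by
    intro j k z hz
    induction j with
    | zero => exact ⟨hz, Iff.rfl⟩
    | succ j ih =>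
      have e : lam ^ (k + (j + 1)) * z = lam * (lam ^ (k + j) * z) := by ring
      rw [e]
      exact ⟨hball _ ih.1, (hQ _ ih.1).trans ih.2⟩
  have hcons : ∀ j k : ℕ, ∀ z, lam ^ k * z ∈ Metric.ball (0:ℂ) r →
      lam ^ j * z ∈ Metric.ball (0:ℂ) r → (Q (lam ^ j * z) ↔ Q (lam ^ k * z)) := by
    intro j k z hk hj
    rcases le_total j k with h | h
    · obtain ⟨i, rfl⟩ := Nat.exists_eq_add_of_le h
      exact (hstep i j z hj).2.symm
    · obtain ⟨i, rfl⟩ := Nat.exists_eq_add_of_le h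
      exact (hstep i k z hk).2
  have hex : ∀ z, ∃ k : ℕ, lam ^ k * z ∈ Metric.ball (0:ℂ) r := fun z => by
    have h1 : Filter.Tendsto (fun k : ℕ => lam ^ k * z) Filter.atTop (nhds 0) := by
      simpa using (tendsto_pow_atTop_nhds_zero_of_norm_lt_one hl1).mul_const z
    exact (h1.eventually_mem (Metric.ball_mem_nhds _ hr)).exists
  refine ⟨{z | ∃ k : ℕ, lam ^ k * z ∈ Metric.ball (0:ℂ) r ∧ Q (lam ^ k * z)}, ?_, ?_, ?_⟩
  · rw [← isOpen_compl_iff, isOpen_iff_mem_nhds]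
    intro z hz
    obtain ⟨k, hk⟩ := hex z
    have h1 : ¬ Q (lam ^ k * z) := fun h => hz ⟨k, hk, h⟩
    have hc : Continuous fun w : ℂ => lam ^ k * w := continuous_const.mul continuous_id
    filter_upwards [hc.continuousAt.eventually (hQc _ hk h1),
      hc.continuousAt.eventually_mem (Metric.isOpen_ball.mem_nhds hk)] with w hw hw'
    rintro ⟨j, hj, hj'⟩
    exact hw ((hcons k j w hj hw').2 hj')
  · intro z
    constructor
    · rintro ⟨k, hk, hk'⟩
      rw [← mul_assoc, ← pow_succ] at hk hk'
      exact ⟨_, hk, hk'⟩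
    · rintro ⟨k, hk, hk'⟩
      have := hstep 1 k z hk
      rw [pow_succ, mul_assoc] at this
      exact ⟨k, this.1, this.2.2 hk'⟩
  · intro z hz
    have hz0 : lam ^ 0 * z ∈ Metric.ball (0:ℂ) r := by simpa using hz
    constructor
    · rintro ⟨k, hk, hk'⟩
      simpa using (hcons k 0 z hz0 hk).1 hk'
    · intro h
      exact ⟨0, hz0, by simpa using h⟩

theorem pow_mul_mem_iff {K : Set ℂ} {lam : ℂ} (hlK : ∀ z, lam * z ∈ K ↔ z ∈ K) (k : ℕ) (z : ℂ) :
    lam ^ k * z ∈ K ↔ z ∈ K := by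
  induction k with
  | zero => simp
  | succ k ih => rw [pow_succ', mul_assoc, hlK, ih]

theorem tendsto_pow_mul_principal {lam : ℂ} (hl1 : ‖lam‖ < 1) {X : Type*} {f : X → ℂ} {s : Set X}
    {C : ℝ} (hf : ∀ x ∈ s, ‖f x‖ ≤ C) :
    Filter.Tendsto (fun x : ℕ × X => lam ^ x.1 * f x.2) (Filter.atTop ×ˢ Filter.principal s)
      (nhds 0) := by
  have h1 : Filter.Tendsto (fun k : ℕ => ‖lam‖ ^ k * C) Filter.atTop (nhds 0) := by
    simpa using (tendsto_pow_atTop_nhds_zero_of_lt_one (norm_nonneg _) hl1).mul_const C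
  refine squeeze_zero_norm' ?_ (h1.comp Filter.tendsto_fst)
  filter_upwards [Filter.tendsto_snd.eventually_mem (Filter.mem_principal_self s)] with x hx
  rw [norm_mul, norm_pow]
  exact mul_le_mul_of_nonneg_left (hf _ hx) (by positivity)

/-- The leading monomial of a germ preserving a homothety invariant closed set preserves that
set. -/
theorem mem_iff_mul_pow_mem {K : Set ℂ} (hK : IsClosed K) {lam : ℂ}
    (hl1 : ‖lam‖ < 1) (hlK : ∀ z, lam * z ∈ K ↔ z ∈ K) {k : ℂ → ℂ} (hk : AnalyticAt ℂ k 0)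
    (hk0 : k 0 ≠ 0) {m : ℕ} (hm : m ≠ 0) (hgK : ∀ᶠ s in nhds (0:ℂ), s ∈ K ↔ s ^ m * k s ∈ K)
    (z : ℂ) : z ∈ K ↔ k 0 * z ^ m ∈ K := by
  let G : ℕ → ℂ → ℂ := fun j w => w ^ m * k (lam ^ j * w)
  have hG : ∀ j w, lam ^ (m * j) * G j w = (lam ^ j * w) ^ m * k (lam ^ j * w) := fun j w => by
    simp only [G]
    ring
  have hb : ∀ w ∈ Metric.closedBall z 1, ‖w‖ ≤ ‖z‖ + 1 := fun w hw => by
    rw [mem_closedBall_iff_norm] at hw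
    linarith [norm_le_norm_add_norm_sub' w z]
  have ht := tendsto_pow_mul_principal hl1 hb
  have hKG : ∀ᶠ j in Filter.atTop, ∀ w ∈ Metric.closedBall z 1, w ∈ K ↔ G j w ∈ K := by
    have := ht.eventually hgK
    rw [Filter.eventually_prod_principal_iff] at this
    filter_upwards [this] with j hj w hw
    have h1 := hj w hw
    rw [← hG] at h1
    rw [← pow_mul_mem_iff hlK j w, h1, pow_mul_mem_iff hlK]
  have hGu : ∀ δ > 0, ∀ᶠ j in Filter.atTop, ∀ w ∈ Metric.closedBall z 1,
      ‖G j w - k 0 * w ^ m‖ < δ := by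
    intro δ hδ
    have h1 : Filter.Tendsto (fun x : ℕ × ℂ => k (lam ^ x.1 * x.2) - k 0)
        (Filter.atTop ×ˢ Filter.principal (Metric.closedBall z 1)) (nhds 0) := by
      simpa using (hk.continuousAt.tendsto.comp ht).sub_const (k 0)
    have hC : (0:ℝ) < (‖z‖ + 1) ^ m := by positivity
    have h2 := h1.eventually_mem (Metric.ball_mem_nhds 0 (div_pos hδ hC))
    rw [Filter.eventually_prod_principal_iff] at h2
    filter_upwards [h2] with j hj w hw
    have h3 := hj w hw
    rw [mem_ball_zero_iff, lt_div_iff₀ hC] at h3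
    have e : G j w - k 0 * w ^ m = w ^ m * (k (lam ^ j * w) - k 0) := by
      simp only [G]
      ring
    rw [e, norm_mul, norm_pow, mul_comm]
    exact (mul_le_mul_of_nonneg_left (pow_le_pow_left₀ (norm_nonneg _) (hb w hw) m)
      (norm_nonneg _)).trans_lt h3
  constructor
  · intro hz
    have h1 : Filter.Tendsto (fun j => G j z) Filter.atTop (nhds (k 0 * z ^ m)) := by
      rw [Metric.tendsto_nhds]
      intro δ hδ
      filter_upwards [hGu δ hδ] with j hj
      rw [dist_eq_norm]
      exact hj z (Metric.mem_closedBall_self one_pos.le)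
    refine hK.mem_of_tendsto h1 ?_
    filter_upwards [hKG] with j hj
    exact (hj z (Metric.mem_closedBall_self one_pos.le)).1 hz
  · intro hz
    by_contra hzK
    -- find a small circle on which the monomial avoids its value at the centre
    have hfin : ∀ᶠ w in nhdsWithin z {z}ᶜ, k 0 * w ^ m ≠ k 0 * z ^ m := by
      have han : AnalyticAt ℂ (fun w => k 0 * w ^ m - k 0 * z ^ m) z := by fun_prop
      rcases han.eventually_eq_zero_or_eventually_ne_zero with h | h
      · exfalso
        have h2 : AnalyticOnNhd ℂ (fun w => k 0 * w ^ m - k 0 * z ^ m) univ :=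
          fun w _ => by fun_prop
        have h3 := h2.eq_of_eventuallyEq (g := fun _ => 0) (fun w _ => analyticAt_const) h
        have h4 := congrFun h3 0
        have h5 := congrFun h3 1
        simp only [zero_pow hm, one_pow, mul_zero, zero_sub, neg_eq_zero, mul_one] at h4 h5
        rw [h4, sub_zero] at h5
        exact hk0 h5
      · filter_upwards [h] with w hw h'
        exact hw (by rw [h', sub_self])
    have hkK : ∀ᶠ w in nhds z, w ∉ K := hK.isOpen_compl.eventually_mem hzK
    have hka : ∀ᶠ w in nhds (0:ℂ), AnalyticAt ℂ k w := hk.eventually_analyticAt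
    rw [eventually_nhdsWithin_iff] at hfin
    obtain ⟨ρ₀, hρ₀, hball⟩ := Metric.eventually_nhds_iff_ball.1 (hfin.and hkK)
    let ρ := min (ρ₀ / 2) 1
    have hρ : 0 < ρ := lt_min (by positivity) one_pos
    have hsub : Metric.closedBall z ρ ⊆ Metric.ball z ρ₀ :=
      Metric.closedBall_subset_ball ((min_le_left _ _).trans_lt (by linarith))
    have hsub1 : Metric.closedBall z ρ ⊆ Metric.closedBall z 1 :=
      Metric.closedBall_subset_closedBall (min_le_right _ _)
    obtain ⟨x, hx, hxmin⟩ := (isCompact_sphere z ρ).exists_isMinOn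
      (NormedSpace.sphere_nonempty.2 hρ.le)
      (f := fun w => ‖k 0 * w ^ m - k 0 * z ^ m‖) (by fun_prop)
    let ε := ‖k 0 * x ^ m - k 0 * z ^ m‖
    have hε : 0 < ε := by
      have hx1 := (hball x (hsub (Metric.sphere_subset_closedBall hx))).1
      have : x ≠ z := by
        rintro rfl
        simp at hx
        exact hρ.ne hx
      exact norm_pos_iff.2 (sub_ne_zero.2 (hx1 this))
    have hdiff := ht.eventually hka
    rw [Filter.eventually_prod_principal_iff] at hdiff
    obtain ⟨j, hj1, hj2, hj3⟩ := (hKG.and ((hGu (ε / 8) (by positivity)).and hdiff)).exists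
    have hd : DiffContOnCl ℂ (G j) (Metric.ball z ρ) := by
      refine DifferentiableOn.diffContOnCl ?_
      rw [closure_ball z hρ.ne']
      intro w hw
      have h1 : DifferentiableAt ℂ (fun w => k (lam ^ j * w)) w :=
        (hj3 w (hsub1 hw)).differentiableAt.comp w (by fun_prop)
      exact ((differentiableAt_id.pow m).mul h1).differentiableWithinAt
    have hzc : z ∈ Metric.closedBall z ρ := Metric.mem_closedBall_self hρ.le
    have hlow : ∀ w ∈ Metric.sphere z ρ, ε / 2 ≤ ‖G j w - G j z‖ := by
      intro w hw
      have h1 := hj2 w (hsub1 (Metric.sphere_subset_closedBall hw))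
      have h2 := hj2 z (hsub1 hzc)
      have h3 : ε ≤ ‖k 0 * w ^ m - k 0 * z ^ m‖ := hxmin hw
      have e : k 0 * w ^ m - k 0 * z ^ m =
          (G j w - G j z) - (G j w - k 0 * w ^ m) + (G j z - k 0 * z ^ m) := by ring
      have h4 := norm_add_le ((G j w - G j z) - (G j w - k 0 * w ^ m)) (G j z - k 0 * z ^ m)
      have h5 := norm_sub_le (G j w - G j z) (G j w - k 0 * w ^ m)
      rw [← e] at h4
      linarith
    have hne : ∃ᶠ w in nhds z, G j w ≠ G j z := by
      by_contra hcon
      rw [Filter.not_frequently] at hcon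
      simp only [not_not] at hcon
      have h2 : AnalyticOnNhd ℂ (G j) (Metric.ball z ρ) := fun w hw =>
        (hd.differentiableOn.analyticAt (Metric.isOpen_ball.mem_nhds hw))
      have h3 := h2.eqOn_of_preconnected_of_eventuallyEq (g := fun _ => G j z)
        (fun w _ => analyticAt_const) (convex_ball z ρ).isPreconnected
        (Metric.mem_ball_self hρ) hcon
      have hcl : EqOn (G j) (fun _ => G j z) (closure (Metric.ball z ρ)) :=
        h3.of_subset_closure hd.continuousOn continuousOn_const subset_closure subset_rfl
      rw [closure_ball z hρ.ne'] at hcl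
      have h4 := hlow x hx
      rw [hcl (Metric.sphere_subset_closedBall hx)] at h4
      simp at h4
      linarith
    have himg := hd.ball_subset_image_closedBall hρ hlow hne
    have hmem : k 0 * z ^ m ∈ Metric.ball (G j z) (ε / 2 / 2) := by
      rw [mem_ball_iff_norm']
      linarith [hj2 z (hsub1 hzc)]
    obtain ⟨w, hw, hw'⟩ := himg hmem
    refine (hball w (hsub hw)).2 ((hj1 w (hsub1 hw)).2 ?_)
    rw [hw']
    exact hz

/-- A closed additive subgroup of `ℂ` stable under division by some `m ≥ 2` is a real subspace. -/
theorem AddSubgroup.real_smul_mem_of_div_mem {A : AddSubgroup ℂ} (hA : IsClosed (A : Set ℂ))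
    {m : ℕ} (hm : 2 ≤ m) (hdiv : ∀ w ∈ A, w / m ∈ A) (x : ℝ) {w : ℂ} (hw : w ∈ A) :
    (x:ℂ) * w ∈ A := by
  have hmR : (2:ℝ) ≤ m := by exact_mod_cast hm
  have hpow : ∀ j : ℕ, w / (m:ℂ) ^ j ∈ A := by
    intro j
    induction j with
    | zero => simpa using hw
    | succ j ih =>
      have := hdiv _ ih
      rwa [div_div, ← pow_succ] at this
  have h1 : Filter.Tendsto (fun j : ℕ => (m:ℝ) ^ j) Filter.atTop Filter.atTop :=
    tendsto_pow_atTop_atTop_of_one_lt (by linarith)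
  have h2 : Filter.Tendsto (fun j : ℕ => ((⌊x * (m:ℝ) ^ j⌋ : ℤ) : ℝ) / (m:ℝ) ^ j) Filter.atTop
      (nhds x) := by
    have h3 : Filter.Tendsto (fun j : ℕ => ((m:ℝ) ^ j)⁻¹) Filter.atTop (nhds 0) :=
      tendsto_inv_atTop_zero.comp h1
    have h4 : Filter.Tendsto (fun j : ℕ => x - ((m:ℝ) ^ j)⁻¹) Filter.atTop (nhds x) := by
      simpa using h3.const_sub x
    refine tendsto_of_tendsto_of_tendsto_of_le_of_le h4 tendsto_const_nhds (fun j => ?_)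
      fun j => ?_
    · have hp : (0:ℝ) < (m:ℝ) ^ j := by positivity
      simp only
      rw [le_div_iff₀ hp, sub_mul, inv_mul_cancel₀ hp.ne']
      linarith [Int.sub_one_lt_floor (x * (m:ℝ) ^ j)]
    · have hp : (0:ℝ) < (m:ℝ) ^ j := by positivity
      simp only
      rw [div_le_iff₀ hp]
      exact Int.floor_le _
  have h5 : Filter.Tendsto
      (fun j : ℕ => (((((⌊x * (m:ℝ) ^ j⌋ : ℤ) : ℝ) / (m:ℝ) ^ j : ℝ)) : ℂ) * w)
      Filter.atTop (nhds (x * w)) :=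
    ((Complex.continuous_ofReal.tendsto x).comp h2).mul_const w
  refine hA.mem_of_tendsto h5 (Filter.Eventually.of_forall fun j => ?_)
  have e : (((((⌊x * (m:ℝ) ^ j⌋ : ℤ) : ℝ) / (m:ℝ) ^ j : ℝ)) : ℂ) * w =
      ⌊x * (m:ℝ) ^ j⌋ • (w / (m:ℂ) ^ j) := by
    rw [zsmul_eq_mul]
    push_cast
    ring
  rw [e]
  exact A.zsmul_mem (hpow j) _

theorem eq_univ_of_mem_iff_mul_pow_mem {K : Set ℂ} (hK : IsClosed K) {lam : ℂ} (hl0 : lam ≠ 0)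
    (hl1 : ‖lam‖ < 1) (hlK : ∀ z, lam * z ∈ K ↔ z ∈ K) {c : ℂ} {m : ℕ} (hm : 2 ≤ m)
    (hc : ∀ z, z ∈ K ↔ c * z ^ m ∈ K) {q : ℂ} (hq : q ∈ K) (hq0 : q ≠ 0) {z : ℂ} (hz : z ≠ 0) :
    z ∈ K := by
  let A : AddSubgroup ℂ :=
    { carrier := {w | ∀ z, exp w * z ∈ K ↔ z ∈ K}
      zero_mem' := fun z => by simp
      add_mem' := fun {a b} ha hb z => by rw [exp_add, mul_assoc, ha, hb]
      neg_mem' := fun {a} ha z => by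
        rw [← ha, ← mul_assoc, ← exp_add, add_neg_cancel, exp_zero, one_mul] }
  have hA : ∀ w, w ∈ A ↔ ∀ z, exp w * z ∈ K ↔ z ∈ K := fun w => Iff.rfl
  have hAc : IsClosed (A : Set ℂ) := by
    refine isClosed_of_closure_subset fun w hw => ?_
    obtain ⟨x, hx, hxw⟩ := mem_closure_iff_seq_limit.1 hw
    have key : ∀ (y : ℕ → ℂ) (u : ℂ), (∀ j, y j ∈ A) →
        Filter.Tendsto y Filter.atTop (nhds u) → ∀ z ∈ K, exp u * z ∈ K := by
      intro y u hy hyu z hz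
      have h1 : Filter.Tendsto (fun j => exp (y j) * z) Filter.atTop (nhds (exp u * z)) :=
        ((Complex.continuous_exp.tendsto u).comp hyu).mul_const z
      exact hK.mem_of_tendsto h1 (Filter.Eventually.of_forall fun j => (hy j z).2 hz)
    intro z
    constructor
    · intro h
      have := key (fun j => -x j) (-w) (fun j => A.neg_mem (hx j)) hxw.neg _ h
      rwa [← mul_assoc, ← exp_add, neg_add_cancel, exp_zero, one_mul] at this
    · exact key x w hx hxw z
  have hdiv : ∀ w ∈ A, w / m ∈ A := by
    intro w hw
    rw [hA] at hw ⊢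
    intro z
    have hm0 : (m:ℂ) ≠ 0 := by
      norm_cast
      omega
    rw [hc, mul_pow, ← exp_nat_mul, mul_div_cancel₀ _ hm0, mul_left_comm, hw, ← hc]
  have hl : log lam ∈ A := (hA _).2 fun z => by rw [exp_log hl0, hlK]
  have h2 : 2 * (Real.pi : ℂ) * I ∈ A := (hA _).2 fun z => by rw [exp_two_pi_mul_I, one_mul]
  have hre : (log lam).re ≠ 0 := by
    rw [log_re]
    exact (Real.log_neg (norm_pos_iff.2 hl0) hl1).ne
  have hall : ∀ w, w ∈ A := by
    intro w
    have h3 := A.add_mem (AddSubgroup.real_smul_mem_of_div_mem hAc hm hdiv (w.re / (log lam).re) hl)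
      (AddSubgroup.real_smul_mem_of_div_mem hAc hm hdiv
        ((w.im - w.re / (log lam).re * (log lam).im) / (2 * Real.pi)) h2)
    convert h3 using 1
    have hpi := Real.pi_ne_zero
    have e1 : (2 * (Real.pi : ℂ) * I).re = 0 := by simp
    have e2 : (2 * (Real.pi : ℂ) * I).im = 2 * Real.pi := by simp
    apply Complex.ext
    · rw [add_re, re_ofReal_mul, re_ofReal_mul, e1]
      field_simp
      ring
    · rw [add_im, im_ofReal_mul, im_ofReal_mul, e2]
      field_simp
      ring
  have := (hA _).1 (hall (log (z / q))) q
  rw [exp_log (div_ne_zero hz hq0), div_mul_cancel₀ _ hq0] at this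
  exact this.2 hq

/-- A germ preserving a closed set with empty interior which is invariant under a contracting
homothety is invertible, and its linear part preserves the set. -/
theorem deriv_ne_zero_and_deriv_mul_mem_iff {K : Set ℂ} (hK : IsClosed K) (hKint : interior K = ∅)
    {lam : ℂ} (hl0 : lam ≠ 0) (hl1 : ‖lam‖ < 1) (hlK : ∀ z, lam * z ∈ K ↔ z ∈ K)
    (h0 : (0:ℂ) ∈ K) {q : ℂ} (hq : q ∈ K) (hq0 : q ≠ 0)
    {g : ℂ → ℂ} (hg : AnalyticAt ℂ g 0) (hg0 : g 0 = 0)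
    (hgK : ∀ᶠ s in nhds (0:ℂ), s ∈ K ↔ g s ∈ K) :
    deriv g 0 ≠ 0 ∧ ∀ z, z ∈ K ↔ deriv g 0 * z ∈ K := by
  have hnz : ¬ ∀ᶠ s in nhds (0:ℂ), g s = 0 := by
    intro h
    have h1 : ∀ᶠ s in nhds (0:ℂ), s ∈ K := by
      filter_upwards [h, hgK] with s hs hs'
      rw [hs', hs]
      exact h0
    have h2 : (0:ℂ) ∈ interior K := mem_interior_iff_mem_nhds.2 h1
    rw [hKint] at h2
    exact h2
  obtain ⟨m, k, hk, hk0, hgk⟩ := hg.exists_eventuallyEq_pow_smul_nonzero_iff.2 hnz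
  simp only [sub_zero, smul_eq_mul] at hgk
  have hm : m ≠ 0 := by
    rintro rfl
    have := hgk.self_of_nhds
    rw [hg0, pow_zero, one_mul] at this
    exact hk0 this.symm
  have hiff := mem_iff_mul_pow_mem hK hl1 hlK hk hk0 hm (by
    filter_upwards [hgk, hgK] with s hs hs'
    rw [hs', hs])
  rcases Nat.lt_or_ge m 2 with h | h
  · obtain rfl : m = 1 := by omega
    have hd : deriv g 0 = k 0 := by
      have h1 : HasDerivAt (fun s => s ^ 1 * k s) (1 * k 0 + 0 ^ 1 * deriv k 0) 0 := by
        simpa using (hasDerivAt_id' (0:ℂ)).fun_mul hk.differentiableAt.hasDerivAt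
      have h2 : g =ᶠ[nhds 0] fun s => s ^ 1 * k s := hgk
      rw [h2.deriv_eq, h1.deriv]
      simp
    rw [hd]
    refine ⟨hk0, fun z => ?_⟩
    simpa using hiff z
  · exfalso
    have h1 : Metric.ball q ‖q‖ ⊆ K := fun z hz => by
      refine eq_univ_of_mem_iff_mul_pow_mem hK hl0 hl1 hlK h hiff hq hq0 ?_
      rintro rfl
      simp [dist_eq_norm] at hz
    have h2 : q ∈ interior K := mem_interior.2
      ⟨_, h1, Metric.isOpen_ball, Metric.mem_ball_self (norm_pos_iff.2 hq0)⟩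
    rw [hKint] at h2
    exact h2

/-- Euler's method: a closed set preserved by approximate small translations is locally invariant
under the translation flow. -/
theorem add_ofReal_mem_of_euler_steps {K : Set ℂ} {c : ℂ} {ρ : ℝ}
    (hK : ∀ w ∈ Metric.ball c ρ, w ∈ closure K → w ∈ K) {T : ℕ → ℂ → ℂ} {ε : ℕ → ℝ}
    (hε0 : ∀ k, 0 < ε k) (hε : Filter.Tendsto ε Filter.atTop (nhds 0))
    (hT : ∀ δ > 0, ∀ᶠ k in Filter.atTop, ∀ w ∈ Metric.ball c ρ, w ∈ K →
      T k w ∈ K ∧ ‖T k w - w - ε k‖ ≤ δ * ε k)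
    {w : ℂ} (hw : w ∈ K) {t : ℝ} (ht : 0 ≤ t) (h : ‖w - c‖ + t < ρ) : w + t ∈ K := by
  have hnt : ‖(t:ℂ)‖ = t := by rw [norm_real, Real.norm_of_nonneg ht]
  refine hK _ ?_ (Metric.mem_closure_iff.2 fun η hη => ?_)
  · rw [mem_ball_iff_norm]
    have e : w + t - c = (w - c) + t := by ring
    rw [e]
    exact (norm_add_le _ _).trans_lt (by rwa [hnt])
  let δ := min η (ρ - ‖w - c‖ - t) / (2 * (t + 1))
  have hm : 0 < min η (ρ - ‖w - c‖ - t) := lt_min hη (by linarith)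
  have hδ : 0 < δ := div_pos hm (by linarith)
  have hδt : δ * t < min η (ρ - ‖w - c‖ - t) / 2 := by
    have e : δ * (2 * (t + 1)) = min η (ρ - ‖w - c‖ - t) :=
      div_mul_cancel₀ _ (by linarith : 2 * (t + 1) ≠ 0)
    linarith
  have hδ1 : δ * t < η / 2 := hδt.trans_le (by linarith [min_le_left η (ρ - ‖w - c‖ - t)])
  have hδ2 : δ * t < ρ - ‖w - c‖ - t :=
    hδt.trans (by linarith [min_le_right η (ρ - ‖w - c‖ - t)])
  obtain ⟨k, hk, hk'⟩ := ((hT δ hδ).and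
    (hε.eventually_lt_const (half_pos hη))).exists
  have key : ∀ j : ℕ, j * ε k ≤ t → ∃ y ∈ K, ‖y - (w + (j * ε k : ℝ))‖ ≤ j * ε k * δ := by
    intro j
    induction j with
    | zero => exact fun _ => ⟨w, hw, by simp⟩
    | succ j ih =>
      intro hj
      push_cast at hj
      have hεk := hε0 k
      have hj' : j * ε k ≤ t := by linarith
      obtain ⟨y, hy, hyn⟩ := ih hj'
      have hj0 : (0:ℝ) ≤ j * ε k := by positivity
      have hyb : y ∈ Metric.ball c ρ := by
        rw [mem_ball_iff_norm]
        have e : y - c = (y - (w + (j * ε k : ℝ))) + ((w - c) + (j * ε k : ℝ)) := by ring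
        have h1 := norm_add_le (y - (w + (j * ε k : ℝ))) ((w - c) + (j * ε k : ℝ))
        have h2 := norm_add_le (w - c) ((j * ε k : ℝ) : ℂ)
        rw [norm_real, Real.norm_of_nonneg hj0] at h2
        rw [e]
        nlinarith
      obtain ⟨h1, h2⟩ := hk y hyb hy
      refine ⟨_, h1, ?_⟩
      have e : T k y - (w + ((j + 1 : ℕ) * ε k : ℝ)) =
          (T k y - y - ε k) + (y - (w + (j * ε k : ℝ))) := by
        push_cast
        ring
      rw [e]
      refine (norm_add_le _ _).trans ((add_le_add h2 hyn).trans (le_of_eq ?_))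
      push_cast
      ring
  obtain ⟨y, hy, hyn⟩ := key ⌊t / ε k⌋₊
    (by rw [← le_div_iff₀ (hε0 k)]; exact Nat.floor_le (div_nonneg ht (hε0 k).le))
  refine ⟨y, hy, ?_⟩
  have h1 : ⌊t / ε k⌋₊ * ε k ≤ t := by
    rw [← le_div_iff₀ (hε0 k)]
    exact Nat.floor_le (div_nonneg ht (hε0 k).le)
  have h2 : t < ⌊t / ε k⌋₊ * ε k + ε k := by
    have := Nat.lt_floor_add_one (t / ε k)
    rw [div_lt_iff₀ (hε0 k)] at this
    linarith
  set a : ℝ := ⌊t / ε k⌋₊ * ε k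
  rw [dist_eq_norm]
  have e : w + t - y = ((t - a : ℝ) : ℂ) - (y - (w + (a : ℝ))) := by
    push_cast
    ring
  rw [e]
  refine (norm_sub_le _ _).trans_lt ?_
  rw [norm_real, Real.norm_of_nonneg (by linarith)]
  nlinarith

/-- A germ tangent to the identity which preserves a homothety invariant closed set `K` makes `K`
locally invariant under the flow of a limit of its rescalings. -/
theorem eventually_mem_of_tangent_germ {K : Set ℂ} (hK : IsClosed K)
    {lam : ℂ} (hl0 : lam ≠ 0) (hl1 : ‖lam‖ < 1) (hlK : ∀ z, lam * z ∈ K ↔ z ∈ K)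
    {u a : ℂ → ℂ} {m : ℕ} (hm : m ≠ 0) (ha : ContinuousAt a 0)
    (hu : ∀ᶠ s in nhds (0:ℂ), u s = s + s ^ (m + 1) * a s)
    (huK : ∀ᶠ s in nhds (0:ℂ), s ∈ K → u s ∈ K) {ξ : ℂ} {φ : ℕ → ℕ}
    (hφ : Filter.Tendsto φ Filter.atTop Filter.atTop)
    (hξ : Filter.Tendsto (fun k => (lam / ‖lam‖) ^ (m * φ k)) Filter.atTop (nhds ξ))
    {κ : ℂ} (hκ : κ * ξ * a 0 * m = -1) {q : ℂ} (hq : q ≠ 0) :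
    ∀ᶠ x in nhds (q, q), ∀ t : ℝ, 0 ≤ t → κ * (x.2 ^ m)⁻¹ = κ * (x.1 ^ m)⁻¹ + t →
      x.1 ∈ K → x.2 ∈ K := by
  have hκ0 : κ ≠ 0 := by
    rintro rfl
    simp at hκ
  let W : ℂ → ℂ := fun z => κ * (z ^ m)⁻¹
  have hWan : AnalyticAt ℂ W q :=
    analyticAt_const.mul ((analyticAt_id.pow m).inv (pow_ne_zero m hq))
  have hWd : deriv W q ≠ 0 := by
    have h1 : HasDerivAt W (κ * (-(m * q ^ (m - 1)) / (q ^ m) ^ 2)) q :=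
      ((hasDerivAt_pow m q).fun_inv (pow_ne_zero m hq)).const_mul κ
    rw [h1.deriv]
    have hm' : (m:ℂ) ≠ 0 := Nat.cast_ne_zero.2 hm
    exact mul_ne_zero hκ0 (div_ne_zero (neg_ne_zero.2 (mul_ne_zero hm' (pow_ne_zero _ hq)))
      (pow_ne_zero _ (pow_ne_zero _ hq)))
  obtain ⟨Z, hZan, hZq, -, hZW, hWZ⟩ := hWan.exists_local_inverse hWd
  obtain ⟨r, hr, hrb⟩ := Metric.eventually_nhds_iff_ball.1
    (hZW.and (continuousAt_id.eventually_ne hq))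
  have e1 : ∀ᶠ w in nhds (W q), Z w ∈ Metric.ball q (r / 2) := by
    have := hZan.continuousAt.eventually_mem (s := Metric.ball q (r / 2))
      (Metric.isOpen_ball.mem_nhds (by rw [hZq]; exact Metric.mem_ball_self (half_pos hr)))
    exact this
  obtain ⟨ρ, hρ, hρb⟩ := Metric.eventually_nhds_iff_ball.1
    (e1.and (hWZ.and hZan.eventually_analyticAt))
  have hZne : ∀ w ∈ Metric.ball (W q) ρ, Z w ≠ 0 := fun w hw =>
    (hrb _ (Metric.ball_subset_ball (half_le_self hr.le) (hρb w hw).1)).2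
  have hZb : ∀ w ∈ Metric.ball (W q) ρ, ‖Z w‖ ≤ ‖q‖ + r := fun w hw => by
    have := (hρb w hw).1
    rw [mem_ball_iff_norm] at this
    linarith [norm_le_norm_add_norm_sub' (Z w) q]
  -- the remainder in the expansion of `(1 + x)⁻ᵐ`
  have hfan : AnalyticAt ℂ (fun x : ℂ => ((1 + x) ^ m)⁻¹) 0 :=
    ((analyticAt_const.add analyticAt_id).pow m).inv (by simp)
  obtain ⟨P, hP, hP0, hPe⟩ := hfan.exists_eq_add_mul
  have hP0' : P 0 = -m := by
    rw [hP0]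
    have h1 : HasDerivAt (fun x : ℂ => (1 + x) ^ m) (m * (1 + 0) ^ (m - 1) * 1) 0 := by
      simpa using ((hasDerivAt_id' (0:ℂ)).const_add 1).fun_pow m
    rw [(h1.fun_inv (by simp)).deriv]
    simp
  let fil : Filter (ℕ × ℂ) := Filter.atTop ×ˢ Filter.principal (Metric.ball (W q) ρ)
  let y : ℕ × ℂ → ℂ := fun x => lam ^ φ x.1 * Z x.2
  have hy : Filter.Tendsto y fil (nhds 0) :=
    (tendsto_pow_mul_principal hl1 hZb).comp (hφ.prodMap Filter.tendsto_id)
  let X : ℕ × ℂ → ℂ := fun x => y x ^ m * a (y x)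
  have hay : Filter.Tendsto (fun x => a (y x)) fil (nhds (a 0)) := ha.tendsto.comp hy
  have hX : Filter.Tendsto X fil (nhds 0) := by
    simpa [zero_pow hm] using (hy.pow m).mul hay
  let S : ℕ × ℂ → ℂ := fun x => Z x.2 * (1 + X x)
  have hS : ∀ᶠ x in fil, ‖S x - Z x.2‖ < r / 2 := by
    have h1 : Filter.Tendsto (fun x => (‖q‖ + r) * ‖X x‖) fil (nhds 0) := by
      simpa using hX.norm.const_mul (‖q‖ + r)
    filter_upwards [h1.eventually_lt_const (half_pos hr),
      Filter.tendsto_snd.eventually_mem (Filter.mem_principal_self _)] with x hx hx'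
    have e : S x - Z x.2 = Z x.2 * X x := by
      simp only [S]
      ring
    rw [e, norm_mul]
    exact (mul_le_mul_of_nonneg_right (hZb _ hx') (norm_nonneg _)).trans_lt hx
  let B : ℕ × ℂ → ℂ := fun x => κ * (lam / ‖lam‖) ^ (m * φ x.1) * a (y x) * P (X x)
  have hB : Filter.Tendsto B fil (nhds 1) := by
    have h1 := (((hξ.comp Filter.tendsto_fst).const_mul κ).mul hay).mul
      (hP.continuousAt.tendsto.comp hX)
    have e : κ * ξ * a 0 * P 0 = 1 := by
      rw [hP0']
      linear_combination -hκ
    rw [e] at h1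
    exact h1
  have hlpos : 0 < ‖lam‖ := norm_pos_iff.2 hl0
  let ε : ℕ → ℝ := fun k => ‖lam‖ ^ (m * φ k)
  have hεt : Filter.Tendsto ε Filter.atTop (nhds 0) := by
    refine (tendsto_pow_atTop_nhds_zero_of_lt_one hlpos.le hl1).comp ?_
    refine Filter.tendsto_atTop_mono (fun k => ?_) hφ
    exact Nat.le_mul_of_pos_left _ (Nat.pos_of_ne_zero hm)
  have hWS : ∀ x : ℕ × ℂ, x.2 ∈ Metric.ball (W q) ρ → W (S x) - x.2 = ε x.1 * B x := by
    intro x hx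
    have h1 := hZne _ hx
    have h2 : W (Z x.2) = x.2 := (hρb _ hx).2.1
    have h3 : W (S x) = κ * (Z x.2 ^ m)⁻¹ * ((1 + X x) ^ m)⁻¹ := by
      simp only [W, S, mul_pow, mul_inv]
      ring
    have h4 : W (S x) - x.2 = κ * (Z x.2 ^ m)⁻¹ * (X x * P (X x)) := by
      have := hPe (X x)
      simp only [add_zero, one_pow, inv_one] at this
      rw [h3, this]
      nth_rewrite 2 [← h2]
      simp only [W]
      ring
    have h5 : (lam ^ φ x.1) ^ m = ε x.1 * (lam / ‖lam‖) ^ (m * φ x.1) := by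
      have : (‖lam‖ : ℂ) ≠ 0 := ofReal_ne_zero.2 hlpos.ne'
      simp only [ε]
      push_cast
      rw [← mul_pow, mul_div_cancel₀ _ this, ← pow_mul, mul_comm]
    rw [h4]
    simp only [X, B, y]
    rw [mul_pow, h5]
    have h6 : Z x.2 ^ m ≠ 0 := pow_ne_zero m h1
    field_simp
  have hSK : ∀ᶠ x in fil, Z x.2 ∈ K → S x ∈ K := by
    filter_upwards [hy.eventually hu, hy.eventually huK] with x hx hx' hxK
    have e : lam ^ φ x.1 * S x = u (y x) := by
      rw [hx]
      simp only [S, X, y]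
      ring
    rw [← pow_mul_mem_iff hlK (φ x.1), e]
    exact hx' ((pow_mul_mem_iff hlK _ _).2 hxK)
  have hmain := fun (w : ℂ) (hw : w ∈ Z ⁻¹' K) (t : ℝ) (ht : 0 ≤ t) (h : ‖w - W q‖ + t < ρ) =>
    add_ofReal_mem_of_euler_steps (K := Z ⁻¹' K) (c := W q) (ρ := ρ)
      (T := fun k w => W (S (k, w))) (ε := ε) (fun w hw hwc => by
        have h1 := (hρb w hw).2.2.continuousAt.continuousWithinAt.mem_closure_image
          (s := Z ⁻¹' K) hwc
        exact hK.closure_subset_iff.2 (image_preimage_subset _ _) h1)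
      (fun k => pow_pos hlpos _) hεt (fun δ hδ => by
        have h1 : ∀ᶠ x in fil, ‖B x - 1‖ < δ := by
          have := hB.eventually_mem (Metric.ball_mem_nhds 1 hδ)
          simpa only [mem_ball_iff_norm] using this
        have h2 := h1.and (hS.and hSK)
        rw [Filter.eventually_prod_principal_iff] at h2
        filter_upwards [h2] with k hk w hw hwK
        obtain ⟨k1, k2, k3⟩ := hk w hw
        constructor
        · change Z (W (S (k, w))) ∈ K
          have h3 : S (k, w) ∈ Metric.ball q r := by
            have := (hρb w hw).1
            rw [mem_ball_iff_norm] at this ⊢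
            have e : S (k, w) - q = (S (k, w) - Z w) + (Z w - q) := by ring
            rw [e]
            exact (norm_add_le _ _).trans_lt (by linarith)
          rw [(hrb _ h3).1]
          exact k3 hwK
        · rw [hWS (k, w) hw]
          have e : (ε k : ℂ) * B (k, w) - ε k = (B (k, w) - 1) * ε k := by ring
          rw [e, norm_mul, norm_real, Real.norm_of_nonneg (pow_pos hlpos _).le]
          exact mul_le_mul_of_nonneg_right k1.le (pow_pos hlpos _).le) hw ht h
  have hWc : ∀ᶠ x in nhds q, Z (W x) = x ∧ W x ∈ Metric.ball (W q) (ρ / 4) :=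
    hZW.and (hWan.continuousAt.eventually_mem (Metric.ball_mem_nhds _ (by positivity)))
  filter_upwards [continuousAt_fst.eventually hWc, continuousAt_snd.eventually hWc] with
    x ⟨h1, h1'⟩ ⟨h2, h2'⟩ t ht htx hxK
  have htx' : W x.2 = W x.1 + t := htx
  rw [mem_ball_iff_norm] at h1' h2'
  have htn : t < ρ / 2 := by
    have e : (t:ℂ) = (W x.2 - W q) - (W x.1 - W q) := by
      rw [htx']
      ring
    have := norm_sub_le (W x.2 - W q) (W x.1 - W q)
    rw [← e, norm_real, Real.norm_of_nonneg ht] at this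
    linarith
  have := hmain (W x.1) (by rw [mem_preimage, h1]; exact hxK) t ht (by linarith)
  rw [← htx', mem_preimage, h2] at this
  exact this

/-- A nontrivial germ tangent to the identity which preserves a homothety invariant closed set
makes that set locally saturated by the level curves of the imaginary part of `κ / z ^ m`. -/
theorem exists_saturated_im_level {K : Set ℂ} (hK : IsClosed K)
    {lam : ℂ} (hl0 : lam ≠ 0) (hl1 : ‖lam‖ < 1) (hlK : ∀ z, lam * z ∈ K ↔ z ∈ K)
    {u : ℂ → ℂ} (hu : AnalyticAt ℂ u 0) (hu0 : u 0 = 0) (hu1 : deriv u 0 = 1)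
    (hne : ¬ ∀ᶠ s in nhds (0:ℂ), u s = s) (huK : ∀ᶠ s in nhds (0:ℂ), s ∈ K ↔ u s ∈ K) :
    ∃ m : ℕ, m ≠ 0 ∧ ∃ κ : ℂ, κ ≠ 0 ∧ ∀ q ≠ 0, ∀ᶠ x in nhds (q, q),
      (κ * (x.1 ^ m)⁻¹).im = (κ * (x.2 ^ m)⁻¹).im → x.1 ∈ K → x.2 ∈ K := by
  obtain ⟨g, hg, hg0, hug⟩ := hu.exists_eq_add_mul
  obtain ⟨k, hk, -, hgk⟩ := hg.exists_eq_add_mul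
  have huk : ∀ z, u z = z + z ^ 2 * k z := fun z => by
    rw [hug, hgk, hg0, hu0, hu1]
    ring
  have hknz : ¬ ∀ᶠ s in nhds (0:ℂ), k s = 0 := fun h => hne (by
    filter_upwards [h] with s hs
    rw [huk, hs]
    ring)
  obtain ⟨j, a, ha, ha0, hka⟩ := hk.exists_eventuallyEq_pow_smul_nonzero_iff.2 hknz
  simp only [sub_zero, smul_eq_mul] at hka
  have hua : ∀ᶠ s in nhds (0:ℂ), u s = s + s ^ ((j + 1) + 1) * a s := by
    filter_upwards [hka] with s hs
    rw [huk, hs]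
    ring
  -- the inverse germ
  obtain ⟨τ, hτ, hτ0, hτ', -, huτ⟩ := hu.exists_local_inverse (by rw [hu1]; exact one_ne_zero)
  rw [hu0] at hτ hτ0 hτ' huτ
  obtain ⟨t, ht, ht0, hτt⟩ := hτ.exists_eq_add_mul
  have ht1 : t 0 = 1 := by
    have h1 : HasDerivAt (fun y => u (τ y)) (deriv u (τ 0) * deriv τ 0) 0 := by
      have hd : HasDerivAt u (deriv u (τ 0)) (τ 0) := by
        rw [hτ0]
        exact hu.differentiableAt.hasDerivAt
      exact hd.comp (0:ℂ) hτ.differentiableAt.hasDerivAt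
    have h2 : HasDerivAt (fun y => u (τ y)) 1 0 :=
      (hasDerivAt_id (0:ℂ)).congr_of_eventuallyEq huτ
    have h3 := h1.unique h2
    rw [hτ0, hu1, one_mul] at h3
    rw [ht0, h3]
  have hτc : Filter.Tendsto τ (nhds 0) (nhds 0) := by
    have := hτ.continuousAt.tendsto
    rwa [hτ0] at this
  let b : ℂ → ℂ := fun y => -(t y ^ (j + 2) * a (τ y))
  have hb : ContinuousAt b 0 := by
    have h1 : ContinuousAt (fun y => a (τ y)) 0 :=
      ContinuousAt.comp (g := a) (f := τ) (by rw [hτ0]; exact ha.continuousAt) hτ.continuousAt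
    exact ((ht.continuousAt.pow _).mul h1).neg
  have hb0 : b 0 = -a 0 := by
    simp only [b]
    rw [hτ0, ht1]
    ring
  have hτb : ∀ᶠ y in nhds (0:ℂ), τ y = y + y ^ ((j + 1) + 1) * b y := by
    filter_upwards [huτ, hτc.eventually hua] with y hy hy'
    have e : τ y = y * t y := by rw [hτt, hτ0, zero_add]
    rw [hy] at hy'
    have : y ^ (j + 1 + 1) * b y = -(τ y ^ (j + 1 + 1) * a (τ y)) := by
      simp only [b]
      nth_rewrite 2 [e]
      rw [mul_pow]
      ring
    rw [this]
    linear_combination -hy'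
  have hτK : ∀ᶠ y in nhds (0:ℂ), y ∈ K → τ y ∈ K := by
    filter_upwards [huτ, hτc.eventually huK] with y hy hy' hyK
    rw [hy', hy]
    exact hyK
  -- a subsequence along which the rotations converge
  have hlpos : 0 < ‖lam‖ := norm_pos_iff.2 hl0
  have hsph : ∀ k : ℕ, (lam / ‖lam‖) ^ ((j + 1) * k) ∈ Metric.sphere (0:ℂ) 1 := fun k => by
    rw [mem_sphere_zero_iff_norm, norm_pow, norm_div, norm_real, norm_norm, div_self hlpos.ne',
      one_pow]
  obtain ⟨ξ, hξs, φ, hφ, hξ⟩ := (isCompact_sphere (0:ℂ) 1).tendsto_subseq hsph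
  have hξ0 : ξ ≠ 0 := by
    rintro rfl
    simp at hξs
  have hj : ((j + 1 : ℕ) : ℂ) ≠ 0 := Nat.cast_ne_zero.2 (Nat.succ_ne_zero j)
  refine ⟨j + 1, Nat.succ_ne_zero j, -(ξ * a 0 * ((j + 1 : ℕ) : ℂ))⁻¹,
    neg_ne_zero.2 (inv_ne_zero (mul_ne_zero (mul_ne_zero hξ0 ha0) hj)), fun q hq => ?_⟩
  have h1 := eventually_mem_of_tangent_germ hK hl0 hl1 hlK (m := j + 1) (Nat.succ_ne_zero j)
    ha.continuousAt hua
    (huK.mono fun s hs => hs.1) hφ.tendsto_atTop hξ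
    (κ := -(ξ * a 0 * ((j + 1 : ℕ) : ℂ))⁻¹) (by field_simp) hq
  have h2 := eventually_mem_of_tangent_germ hK hl0 hl1 hlK (m := j + 1) (Nat.succ_ne_zero j) hb hτb
    hτK hφ.tendsto_atTop hξ
    (κ := (ξ * a 0 * ((j + 1 : ℕ) : ℂ))⁻¹) (by rw [hb0]; field_simp) hq
  filter_upwards [h1, h2] with x hx1 hx2 him hxK
  set A := (ξ * a 0 * ((j + 1 : ℕ) : ℂ))⁻¹
  let T : ℝ := (-A * (x.2 ^ (j + 1))⁻¹ - -A * (x.1 ^ (j + 1))⁻¹).re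
  have hT : -A * (x.2 ^ (j + 1))⁻¹ = -A * (x.1 ^ (j + 1))⁻¹ + T := by
    have : (T:ℂ) = -A * (x.2 ^ (j + 1))⁻¹ - -A * (x.1 ^ (j + 1))⁻¹ := by
      apply Complex.ext
      · rfl
      · rw [ofReal_im, sub_im, him, sub_self]
    rw [this]
    ring
  rcases le_total 0 T with h | h
  · exact hx1 T h hT hxK
  · refine hx2 (-T) (by linarith) ?_ hxK
    push_cast
    linear_combination -hT

/-- Points of a homothety invariant set saturated by the level curves of `Im (κ / z ^ m)` are
joined to the origin inside the set. -/
theorem exists_isPreconnected_of_saturated {K : Set ℂ} (h0 : (0:ℂ) ∈ K)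
    {m : ℕ} (hm : m ≠ 0)
    {κ : ℂ} (hκ : κ ≠ 0) (hsat : ∀ q ≠ 0, ∀ᶠ x in nhds (q, q),
      (κ * (x.1 ^ m)⁻¹).im = (κ * (x.2 ^ m)⁻¹).im → x.1 ∈ K → x.2 ∈ K)
    {z₀ : ℂ} (hz : z₀ ∈ K) (hz0 : z₀ ≠ 0) :
    ∃ C : Set ℂ, IsPreconnected C ∧ 0 ∈ C ∧ z₀ ∈ C ∧ C ⊆ K ∧ ∀ x ∈ C, ‖x‖ ≤ ‖z₀‖ := by
  let w : ℂ := κ * (z₀ ^ m)⁻¹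
  have hw : w ≠ 0 := mul_ne_zero hκ (inv_ne_zero (pow_ne_zero m hz0))
  obtain ⟨σ, hσ, hσre⟩ : ∃ σ : ℝ, (σ = 1 ∨ σ = -1) ∧ 0 ≤ σ * (w⁻¹).re := by
    rcases le_total 0 (w⁻¹).re with h | h
    · exact ⟨1, Or.inl rfl, by linarith⟩
    · exact ⟨-1, Or.inr rfl, by linarith⟩
  let y : ℝ → ℂ := fun t => 1 + (σ * t : ℝ) * w⁻¹
  have hyre : ∀ t : ℝ, 0 ≤ t → 1 ≤ (y t).re := fun t ht => by
    simp only [y, add_re, one_re, re_ofReal_mul]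
    nlinarith
  have hyn : ∀ t : ℝ, 0 ≤ t → 1 ≤ ‖y t‖ := fun t ht =>
    (hyre t ht).trans (Complex.re_le_norm _)
  have hyslit : ∀ t : ℝ, 0 ≤ t → y t ∈ slitPlane := fun t ht =>
    Or.inl (by linarith [hyre t ht])
  have hyc : Continuous y := by
    simp only [y]
    fun_prop
  let z : ℝ → ℂ := fun t => z₀ * (y t ^ ((m:ℂ)⁻¹))⁻¹
  have hy0 : ∀ t : ℝ, 0 ≤ t → y t ≠ 0 := fun t ht => slitPlane_ne_zero (hyslit t ht)
  have hcp0 : ∀ t : ℝ, 0 ≤ t → y t ^ ((m:ℂ)⁻¹) ≠ 0 := fun t ht => by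
    rw [Ne, cpow_eq_zero_iff]
    exact fun h => hy0 t ht h.1
  have hcpn : ∀ t : ℝ, 0 ≤ t → ‖y t ^ ((m:ℂ)⁻¹)‖ ^ m = ‖y t‖ := fun t ht => by
    rw [← norm_pow, cpow_nat_inv_pow _ hm]
  have hcp1 : ∀ t : ℝ, 0 ≤ t → 1 ≤ ‖y t ^ ((m:ℂ)⁻¹)‖ := fun t ht => by
    by_contra hcon
    push Not at hcon
    have h1 := pow_lt_one₀ (norm_nonneg _) hcon hm
    rw [hcpn t ht] at h1
    linarith [hyn t ht]
  have hzc : ContinuousOn z (Ici 0) := by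
    intro t ht
    have h1 : ContinuousAt (fun t => y t ^ ((m:ℂ)⁻¹)) t :=
      hyc.continuousAt.cpow continuousAt_const (hyslit t ht)
    exact (continuousAt_const.mul (h1.inv₀ (hcp0 t ht))).continuousWithinAt
  have hzn : ∀ t : ℝ, 0 ≤ t → z t ≠ 0 := fun t ht => mul_ne_zero hz0 (inv_ne_zero (hcp0 t ht))
  have hWz : ∀ t : ℝ, 0 ≤ t → κ * (z t ^ m)⁻¹ = w + (σ * t : ℝ) := fun t ht => by
    simp only [z]
    rw [mul_pow, inv_pow, cpow_nat_inv_pow _ hm, mul_inv, inv_inv, ← mul_assoc]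
    change w * y t = _
    simp only [y]
    field_simp
  have hz00 : z 0 = z₀ := by simp [z, y]
  have hzK : ∀ t : ℝ, 0 ≤ t → z t ∈ K := by
    intro t ht
    have hpre : IsPreconnected (Ici (0:ℝ)) := isPreconnected_Ici
    refine hpre.induction₂' (fun s t => z s ∈ K → z t ∈ K) (fun t ht => ?_)
      (fun s t u _ _ _ h1 h2 h => h2 (h1 h)) (x := 0) self_mem_Ici ht (by rwa [hz00])
    · have h1 := hsat (z t) (hzn t ht)
      have h3 : Filter.Tendsto (fun s => (z t, z s)) (nhdsWithin t (Ici 0)) (nhds (z t, z t)) :=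
        tendsto_const_nhds.prodMk_nhds (hzc t ht)
      have h4 : Filter.Tendsto (fun s => (z s, z t)) (nhdsWithin t (Ici 0)) (nhds (z t, z t)) :=
        (hzc t ht).tendsto.prodMk_nhds tendsto_const_nhds
      filter_upwards [h3.eventually h1, h4.eventually h1, self_mem_nhdsWithin] with s hs hs' hs0
      have him : ∀ r : ℝ, 0 ≤ r → (κ * (z r ^ m)⁻¹).im = w.im := fun r hr => by
        rw [hWz r hr, add_im, ofReal_im, add_zero]
      exact ⟨hs (by rw [him t ht, him s hs0]), hs' (by rw [him t ht, him s hs0])⟩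
  have hzle : ∀ t : ℝ, 0 ≤ t → ‖z t‖ ≤ ‖z₀‖ := fun t ht => by
    simp only [z]
    rw [norm_mul, norm_inv]
    exact mul_le_of_le_one_right (norm_nonneg _) (inv_le_one_of_one_le₀ (hcp1 t ht))
  have hlim : Filter.Tendsto z Filter.atTop (nhds 0) := by
    have h1 : Filter.Tendsto (fun t : ℝ => ‖w + (σ * t : ℝ)‖) Filter.atTop Filter.atTop := by
      refine Filter.tendsto_atTop_mono' _ ?_ (Filter.tendsto_atTop_add_const_right _ (-‖w‖)
        Filter.tendsto_id)
      filter_upwards [Filter.eventually_ge_atTop 0] with t ht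
      have h2 : ‖((σ * t : ℝ) : ℂ)‖ = t := by
        rw [norm_real, norm_mul, Real.norm_of_nonneg ht]
        rcases hσ with rfl | rfl <;> simp
      have h3 := norm_le_norm_add_norm_sub' ((σ * t : ℝ) : ℂ) (-w)
      rw [h2, norm_neg, sub_neg_eq_add, add_comm _ w] at h3
      simp only [id]
      linarith
    rw [Metric.tendsto_nhds]
    intro ε hε
    have hκn : 0 < ‖κ‖ := norm_pos_iff.2 hκ
    filter_upwards [Filter.eventually_ge_atTop 0, h1.eventually_gt_atTop (‖κ‖ / ε ^ m)] with t ht h2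
    rw [← hWz t ht, norm_mul, norm_inv, norm_pow, ← div_eq_mul_inv,
      div_lt_div_iff_of_pos_left hκn (by positivity)
        (pow_pos (norm_pos_iff.2 (hzn t ht)) _)] at h2
    rw [dist_zero_right]
    exact lt_of_pow_lt_pow_left₀ m hε.le h2
  refine ⟨insert 0 (z '' Ici 0), ?_, mem_insert _ _, mem_insert_of_mem _ ⟨0, self_mem_Ici, hz00⟩,
    ?_, ?_⟩
  · refine (isPreconnected_Ici.image z hzc).subset_closure (subset_insert _ _) ?_
    refine insert_subset ?_ subset_closure
    refine mem_closure_of_tendsto hlim ?_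
    filter_upwards [Filter.eventually_ge_atTop 0] with t ht
    exact ⟨t, ht, rfl⟩
  · rintro x (rfl | ⟨t, ht, rfl⟩)
    · exact h0
    · exact hzK t ht
  · rintro x (rfl | ⟨t, ht, rfl⟩)
    · simp
    · exact hzle t ht

/-- A closed set with empty interior, invariant under a contracting homothety and a germ which is
not linear, is a real analytic curve near any of its nonzero points at which it is locally
equivalent to itself near the origin. -/
theorem exists_im_eq_zero_iff_mem {K : Set ℂ} (hK : IsClosed K) (hKint : interior K = ∅)
    {lam : ℂ} (hl0 : lam ≠ 0) (hl1 : ‖lam‖ < 1) (hlK : ∀ z, lam * z ∈ K ↔ z ∈ K)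
    (h0 : (0:ℂ) ∈ K) {g : ℂ → ℂ} (hg : AnalyticAt ℂ g 0) (hg0 : g 0 = 0)
    (hgK : ∀ᶠ s in nhds (0:ℂ), s ∈ K ↔ g s ∈ K)
    (hgl : ¬ ∃ c : ℂ, ∀ᶠ s in nhds (0:ℂ), g s = c * s)
    {ψ : ℂ → ℂ} (hψ : AnalyticAt ℂ ψ 0) (hψ0 : ψ 0 ≠ 0) (hψ' : deriv ψ 0 ≠ 0)
    (hψK : ∀ᶠ s in nhds (0:ℂ), s ∈ K ↔ ψ s ∈ K) :
    ∃ χ : ℂ → ℂ, AnalyticAt ℂ χ 0 ∧ χ 0 = 0 ∧ deriv χ 0 ≠ 0 ∧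
      ∀ᶠ s in nhds (0:ℂ), s ∈ K ↔ (χ s).im = 0 := by
  have hqK : ψ 0 ∈ K := hψK.self_of_nhds.1 h0
  obtain ⟨hμ, hμK⟩ := deriv_ne_zero_and_deriv_mul_mem_iff hK hKint hl0 hl1 hlK h0 hqK hψ0 hg hg0 hgK
  have hu : AnalyticAt ℂ (fun s => (deriv g 0)⁻¹ * g s) 0 := analyticAt_const.mul hg
  obtain ⟨m, hm, κ, hκ, hsat⟩ := exists_saturated_im_level hK hl0 hl1 hlK hu
    (by simp [hg0]) (by
      rw [(hg.differentiableAt.hasDerivAt.const_mul _).deriv]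
      exact inv_mul_cancel₀ hμ)
    (fun h => hgl ⟨deriv g 0, by
      filter_upwards [h] with s hs
      nth_rewrite 2 [← hs]
      rw [← mul_assoc, mul_inv_cancel₀ hμ, one_mul]⟩)
    (by
      filter_upwards [hgK] with s hs
      rw [hs, hμK ((deriv g 0)⁻¹ * g s), ← mul_assoc, mul_inv_cancel₀ hμ, one_mul])
  let W : ℂ → ℂ := fun z => κ * (z ^ m)⁻¹
  have hWan : ∀ q ≠ 0, AnalyticAt ℂ W q := fun q hq =>
    analyticAt_const.mul ((analyticAt_id.pow m).inv (pow_ne_zero m hq))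
  have hWd : ∀ q ≠ 0, deriv W q ≠ 0 := fun q hq => by
    have h1 : HasDerivAt W (κ * (-(m * q ^ (m - 1)) / (q ^ m) ^ 2)) q :=
      ((hasDerivAt_pow m q).fun_inv (pow_ne_zero m hq)).const_mul κ
    rw [h1.deriv]
    have hm' : (m:ℂ) ≠ 0 := Nat.cast_ne_zero.2 hm
    exact mul_ne_zero hκ (div_ne_zero (neg_ne_zero.2 (mul_ne_zero hm' (pow_ne_zero _ hq)))
      (pow_ne_zero _ (pow_ne_zero _ hq)))
  -- a neighbourhood of `ψ 0` saturated by the level curves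
  have hs1 := hsat (ψ 0) hψ0
  rw [nhds_prod_eq] at hs1
  obtain ⟨O, hO, hOK⟩ := Filter.mem_prod_same_iff.1 hs1
  have hO' : ∀ᶠ z in nhds (ψ 0), z ∈ O ∧ z ≠ 0 :=
    Filter.Eventually.and hO (continuousAt_id.eventually_ne hψ0)
  rw [eventually_nhds_iff] at hO'
  obtain ⟨O', hO'O, hO'o, hqO'⟩ := hO'
  have hlev : ∀ z ∈ O', ∀ z' ∈ O', (W z).im = (W z').im → z ∈ K → z' ∈ K := fun z hz z' hz' h =>
    hOK (mk_mem_prod (hO'O z hz).1 (hO'O z' hz').1) h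
  have hψO : ∀ᶠ s in nhds (0:ℂ), ψ s ∈ O' ∧ (s ∈ K ↔ ψ s ∈ K) ∧ AnalyticAt ℂ ψ s :=
    (hψ.continuousAt.eventually_mem (hO'o.mem_nhds hqO')).and (hψK.and hψ.eventually_analyticAt)
  obtain ⟨r, hr, hrb⟩ := Metric.eventually_nhds_iff_ball.1 hψO
  have hconst : ∀ s ∈ Metric.ball (0:ℂ) r, s ∈ K → (W (ψ s)).im = (W (ψ 0)).im := by
    intro s hs hsK
    by_contra hcon
    have hs0 : s ≠ 0 := by
      rintro rfl
      exact hcon rfl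
    obtain ⟨C, hC, hC0, hCs, hCK, hCn⟩ :=
      exists_isPreconnected_of_saturated h0 hm hκ hsat hsK hs0
    have hCr : C ⊆ Metric.ball 0 r := fun x hx => by
      rw [mem_ball_zero_iff] at hs ⊢
      exact (hCn x hx).trans_lt hs
    let f : ℂ → ℝ := fun x => (W (ψ x)).im
    have hf : ContinuousOn f C := fun x hx => by
      obtain ⟨h1, -, h2⟩ := hrb x (hCr hx)
      have h3 : ContinuousAt (fun x => W (ψ x)) x :=
        ContinuousAt.comp (g := W) (f := ψ) (hWan _ (hO'O _ h1).2).continuousAt h2.continuousAt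
      exact (Complex.continuous_im.continuousAt.comp h3).continuousWithinAt
    have hmem : ∀ a b : ℝ, Ioo a b ⊆ f '' C → a < b → False := by
      intro a b hab hlt
      obtain ⟨x, hxC, hx⟩ := hab (a := (a + b) / 2) ⟨by linarith, by linarith⟩
      obtain ⟨h1, -, -⟩ := hrb x (hCr hxC)
      have h2 : ∀ᶠ z in nhds (ψ x), z ∈ K := by
        have h3 : ContinuousAt (fun z => (W z).im) (ψ x) :=
          Complex.continuous_im.continuousAt.comp (hWan _ (hO'O _ h1).2).continuousAt
        filter_upwards [hO'o.mem_nhds h1, h3.eventually_mem (s := Ioo a b)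
          (isOpen_Ioo.mem_nhds (by change f x ∈ _; rw [hx]; constructor <;> linarith))]
      with z hz hz'
        obtain ⟨y, hyC, hy⟩ := hab hz'
        obtain ⟨h4, h5, -⟩ := hrb y (hCr hyC)
        exact hlev _ h4 _ hz hy (h5.1 (hCK hyC))
      have h3 : ψ x ∈ interior K := mem_interior_iff_mem_nhds.2 h2
      rw [hKint] at h3
      exact h3
    rcases lt_or_gt_of_ne hcon with h | h
    · exact hmem _ _ (Ioo_subset_Icc_self.trans (hC.intermediate_value hCs hC0 hf)) h
    · exact hmem _ _ (Ioo_subset_Icc_self.trans (hC.intermediate_value hC0 hCs hf)) h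
  refine ⟨fun s => W (ψ s) - W (ψ 0), ?_, sub_self _, ?_, ?_⟩
  · exact ((hWan _ hψ0).fun_comp hψ).sub analyticAt_const
  · have h1 : HasDerivAt (fun s => W (ψ s)) (deriv W (ψ 0) * deriv ψ 0) 0 :=
      (hWan _ hψ0).differentiableAt.hasDerivAt.comp (0:ℂ) hψ.differentiableAt.hasDerivAt
    rw [(h1.sub_const _).deriv]
    exact mul_ne_zero (hWd _ hψ0) hψ'
  · filter_upwards [Metric.ball_mem_nhds (0:ℂ) hr] with s hs
    obtain ⟨h1, h2, -⟩ := hrb s hs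
    rw [sub_im, sub_eq_zero]
    exact ⟨hconst s hs, fun h => h2.2 (hlev _ hqO' _ h1 h.symm hqK)⟩

/-- The function `q` has at most a pole at `s`, with residue `a`. -/
def HasResidue (q : ℂ → ℂ) (s a : ℂ) : Prop :=
  ∃ (P : Polynomial ℂ) (h : ℂ → ℂ), AnalyticAt ℂ h s ∧ P.coeff 1 = a ∧
    ∀ᶠ z in nhdsWithin s {s}ᶜ, q z = P.eval (z - s)⁻¹ + h z

section Residue

variable {q q' h : ℂ → ℂ} {a b c s : ℂ} {R : ℝ}

theorem MeromorphicAt.exists_hasResidue (hq : MeromorphicAt q s) : ∃ a, HasResidue q s a := by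
  obtain ⟨N, hN⟩ := hq
  have key : ∀ (N : ℕ) (g : ℂ → ℂ), AnalyticAt ℂ g s → ∃ (P : Polynomial ℂ) (h : ℂ → ℂ),
      AnalyticAt ℂ h s ∧ ∀ᶠ z in nhds s, z ≠ s → (z - s)⁻¹ ^ N * g z = P.eval (z - s)⁻¹ + h z := by
    intro N
    induction N with
    | zero => exact fun g hg => ⟨0, g, hg, .of_forall fun z _ => by simp⟩
    | succ N ih =>
      intro g hg
      have hg' : AnalyticAt ℂ (fun z => g (z + s)) 0 :=
        AnalyticAt.fun_comp (f := fun z => z + s) (g := g) (by simpa using hg) (by fun_prop)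
      obtain ⟨k, hk, -, hgk⟩ := hg'.exists_eq_add_mul
      obtain ⟨P, h, hh, hPh⟩ := ih (fun z => k (z - s))
        (AnalyticAt.fun_comp (f := fun z => z - s) (g := k) (by simpa using hk) (by fun_prop))
      refine ⟨P + Polynomial.C (g s) * Polynomial.X ^ (N + 1), h, hh, ?_⟩
      filter_upwards [hPh] with z hz hzs
      have h1 := hgk (z - s)
      simp only [sub_add_cancel, zero_add] at h1
      have h2 := hz hzs
      have h3 : z - s ≠ 0 := sub_ne_zero.2 hzs
      simp only [Polynomial.eval_add, Polynomial.eval_mul, Polynomial.eval_C, Polynomial.eval_pow,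
        Polynomial.eval_X]
      have h4 : (z - s)⁻¹ ^ (N + 1) * (z - s) = (z - s)⁻¹ ^ N := by
        rw [pow_succ, mul_assoc, inv_mul_cancel₀ h3, mul_one]
      rw [h1, mul_add, ← mul_assoc, h4]
      linear_combination h2
  obtain ⟨P, h, hh, hPh⟩ := key N _ hN
  refine ⟨P.coeff 1, P, h, hh, rfl, ?_⟩
  rw [eventually_nhdsWithin_iff]
  filter_upwards [hPh] with z hz hzs
  have h3 : z - s ≠ 0 := sub_ne_zero.2 hzs
  rw [← hz hzs, smul_eq_mul, ← mul_assoc, ← mul_pow, inv_mul_cancel₀ h3, one_pow, one_mul]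

theorem HasResidue.add_analyticAt (hq : HasResidue q s a) (hh : AnalyticAt ℂ h s)
    (hqq : ∀ᶠ z in nhdsWithin s {s}ᶜ, q' z = q z + h z) : HasResidue q' s a := by
  obtain ⟨P, k, hk, hP, hqP⟩ := hq
  refine ⟨P, fun z => k z + h z, hk.add hh, hP, ?_⟩
  filter_upwards [hqP, hqq] with z h1 h2
  rw [h2, h1, add_assoc]

theorem HasResidue.congr (hq : HasResidue q s a)
    (hqq : ∀ᶠ z in nhdsWithin s {s}ᶜ, q' z = q z) : HasResidue q' s a :=
  hq.add_analyticAt analyticAt_const (h := fun _ => 0) (by simpa using hqq)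

theorem HasResidue.const_mul (hq : HasResidue q s a) (c : ℂ) :
    HasResidue (fun z => c * q z) s (c * a) := by
  obtain ⟨P, k, hk, hP, hqP⟩ := hq
  refine ⟨Polynomial.C c * P, fun z => c * k z, analyticAt_const.mul hk, by simp [hP], ?_⟩
  filter_upwards [hqP] with z h1
  rw [h1]
  simp
  ring

theorem HasResidue.comp_sub (hq : HasResidue q b a) (s : ℂ) :
    HasResidue (fun z => q (z - s + b)) s a := by
  obtain ⟨P, k, hk, hP, hqP⟩ := hq
  refine ⟨P, fun z => k (z - s + b),
    AnalyticAt.fun_comp (f := fun z => z - s + b) (g := k) (by simpa using hk)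
      (by fun_prop), hP, ?_⟩
  rw [eventually_nhdsWithin_iff] at hqP ⊢
  have ht : Filter.Tendsto (fun z : ℂ => z - s + b) (nhds s) (nhds b) := by
    have : Continuous fun z : ℂ => z - s + b := by fun_prop
    simpa using this.tendsto s
  filter_upwards [ht.eventually hqP] with z hz hzs
  rw [hz fun h0 => hzs (by simpa [sub_eq_zero] using h0), add_sub_cancel_right]

theorem HasResidue.comp_mul (hq : HasResidue q 0 a) (hc : c ≠ 0) :
    HasResidue (fun z => q (c * z)) 0 (c⁻¹ * a) := by
  obtain ⟨P, k, hk, hP, hqP⟩ := hq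
  refine ⟨P.comp (Polynomial.C c⁻¹ * Polynomial.X), fun z => k (c * z),
    AnalyticAt.fun_comp (f := fun z => c * z) (g := k) (by simpa using hk) (by fun_prop), ?_, ?_⟩
  · rw [Polynomial.comp_C_mul_X_coeff, hP, pow_one, mul_comm]
  rw [eventually_nhdsWithin_iff] at hqP ⊢
  have ht : Filter.Tendsto (fun z : ℂ => c * z) (nhds 0) (nhds 0) := by
    have : Continuous fun z : ℂ => c * z := by fun_prop
    simpa using this.tendsto 0
  filter_upwards [ht.eventually hqP] with z hz hzs
  rw [hz (by simpa [hc] using hzs)]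
  simp [mul_comm z⁻¹]

theorem circleIntegrable_eval_inv (hs : s ∈ Metric.ball c R) (P : Polynomial ℂ) :
    CircleIntegrable (fun z => P.eval (z - s)⁻¹) c R := by
  have hR : 0 < R := Metric.pos_of_mem_ball hs
  refine ContinuousOn.circleIntegrable hR.le fun z hz => ContinuousAt.continuousWithinAt ?_
  have : z - s ≠ 0 := sub_ne_zero.2 fun h => by
    rw [h, mem_sphere_iff_norm] at hz
    rw [mem_ball_iff_norm] at hs
    linarith
  exact ContinuousAt.comp (g := fun w => P.eval w) (f := fun z => (z - s)⁻¹)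
    P.continuous.continuousAt ((continuousAt_id.sub continuousAt_const).inv₀ this)

theorem circleIntegral_eval_inv (hs : s ∈ Metric.ball c R) (P : Polynomial ℂ) :
    (∮ z in C(c, R), P.eval (z - s)⁻¹) = 2 * Real.pi * I * P.coeff 1 := by
  have hR : 0 < R := Metric.pos_of_mem_ball hs
  induction P using Polynomial.induction_on' with
  | add P Q hP hQ =>
    simp only [Polynomial.eval_add, Polynomial.coeff_add]
    rw [circleIntegral.integral_add (circleIntegrable_eval_inv hs P)
      (circleIntegrable_eval_inv hs Q), hP, hQ, mul_add]
  | monomial k b =>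
    simp only [Polynomial.eval_monomial, Polynomial.coeff_monomial]
    rw [circleIntegral.integral_const_mul]
    rcases eq_or_ne k 1 with rfl | hk
    · simp only [pow_one, if_true]
      rw [circleIntegral.integral_sub_inv_of_mem_ball hs, mul_comm]
    · rw [if_neg hk]
      have := circleIntegral.integral_sub_zpow_of_ne (n := -(k:ℤ)) (by omega) c s R
      simp only [zpow_neg, zpow_natCast, ← inv_pow] at this
      rw [this, mul_zero, mul_zero]

/-- The residue theorem for a disk. -/
theorem circleIntegral_eq_sum_hasResidue {a : ℂ → ℂ} (hR : 0 ≤ R) (S : Finset ℂ) :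
    ∀ q : ℂ → ℂ, (∀ s ∈ S, s ∈ Metric.ball c R) → (∀ s ∈ S, HasResidue q s (a s)) →
    (∀ z ∈ Metric.closedBall c R, z ∉ S → DifferentiableAt ℂ q z) →
    (∮ z in C(c, R), q z) = 2 * Real.pi * I * ∑ s ∈ S, a s := by
  classical
  induction S using Finset.induction_on with
  | empty =>
    intro q _ _ hd
    rw [Finset.sum_empty, mul_zero]
    refine Complex.circleIntegral_eq_zero_of_differentiable_on_off_countable hR countable_empty
      (fun z hz => (hd z hz (Finset.notMem_empty z)).continuousAt.continuousWithinAt)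
      fun z hz => hd z (Metric.ball_subset_closedBall hz.1) (Finset.notMem_empty z)
  | insert s S hsS ih =>
    intro q hS hres hd
    obtain ⟨P, h, hh, hP, hqP⟩ := hres s (Finset.mem_insert_self s S)
    have hsb := hS s (Finset.mem_insert_self s S)
    set q₁ : ℂ → ℂ := Function.update (fun z => q z - P.eval (z - s)⁻¹) s (h s) with hq₁
    have hq₁s : q₁ =ᶠ[nhds s] h := by
      rw [eventually_nhdsWithin_iff] at hqP
      filter_upwards [hqP] with z hz
      by_cases hzs : z = s
      · rw [hzs, hq₁, Function.update_self]
      · rw [hq₁, Function.update_of_ne hzs, hz hzs, add_sub_cancel_left]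
    have hq₁z : ∀ z, z ≠ s → q₁ =ᶠ[nhds z] fun z => q z - P.eval (z - s)⁻¹ := fun z hz => by
      filter_upwards [isOpen_ne.mem_nhds hz] with w hw
      rw [hq₁, Function.update_of_ne hw]
    have hPa : ∀ z, z ≠ s → AnalyticAt ℂ (fun z => P.eval (z - s)⁻¹) z := fun z hz => by
      have h1 : AnalyticAt ℂ (fun z => (z - s)⁻¹) z :=
        (analyticAt_id.sub analyticAt_const).inv (sub_ne_zero.2 hz)
      have h2 : AnalyticAt ℂ (fun w : ℂ => P.eval w) (z - s)⁻¹ :=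
        P.differentiable.analyticAt _
      exact AnalyticAt.fun_comp (f := fun z => (z - s)⁻¹) (g := fun w => P.eval w) h2 h1
    have h1 := ih q₁ (fun w hw => hS w (Finset.mem_insert_of_mem hw)) (fun w hw => by
        have hws : w ≠ s := fun h => hsS (h ▸ hw)
        refine (hres w (Finset.mem_insert_of_mem hw)).add_analyticAt (hPa w hws).neg ?_
        exact ((hq₁z w hws).filter_mono nhdsWithin_le_nhds).mono fun z hz => by
          rw [hz]; exact sub_eq_add_neg _ _)
      (fun z hz hzS => by
        by_cases hzs : z = s
        · rw [hzs]; exact hq₁s.symm.differentiableAt_iff.1 hh.differentiableAt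
        · exact (hq₁z z hzs).symm.differentiableAt_iff.1
            ((hd z hz (by simp [hzs, hzS])).sub (hPa z hzs).differentiableAt))
    have hsph : ∀ z ∈ Metric.sphere c R, z ∉ insert s S := fun z hz hzS => by
      have := hS z hzS
      rw [mem_ball_iff_norm] at this
      rw [mem_sphere_iff_norm] at hz
      linarith
    have hqi : CircleIntegrable q c R := ContinuousOn.circleIntegrable hR fun z hz =>
      (hd z (Metric.sphere_subset_closedBall hz) (hsph z hz)).continuousAt.continuousWithinAt
    have h2 : (∮ z in C(c, R), q₁ z) = ∮ z in C(c, R), (q z - P.eval (z - s)⁻¹) :=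
      circleIntegral.integral_congr hR fun z hz => by
        have : z ≠ s := fun h => hsph z hz (by simp [h])
        rw [hq₁, Function.update_of_ne this]
    rw [h2, circleIntegral.integral_sub hqi (circleIntegrable_eval_inv hsb P),
      circleIntegral_eval_inv hsb, hP] at h1
    rw [Finset.sum_insert hsS]
    linear_combination h1

theorem HasResidue.unique (ha : HasResidue q s a) (hb : HasResidue q s b) : a = b := by
  have hd : ∀ᶠ z in nhdsWithin s {s}ᶜ, DifferentiableAt ℂ q z := by
    obtain ⟨P, h, hh, hP, hqP⟩ := ha
    have h1 : ∀ᶠ z in nhdsWithin s {s}ᶜ, ∀ᶠ w in nhds z, q w = P.eval (w - s)⁻¹ + h w := by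
      rw [eventually_nhdsWithin_iff] at hqP ⊢
      filter_upwards [hqP.eventually_nhds] with z hz hzs
      filter_upwards [hz, isOpen_ne.mem_nhds hzs] with w hw hws
      exact hw hws
    filter_upwards [h1, hh.eventually_analyticAt.filter_mono nhdsWithin_le_nhds,
      self_mem_nhdsWithin] with z hz hhz hzs
    have h2 : DifferentiableAt ℂ (fun z => P.eval (z - s)⁻¹) z :=
      DifferentiableAt.fun_comp' (g := fun w : ℂ => P.eval w) (f := fun z => (z - s)⁻¹) z
        (P.differentiable _) ((differentiableAt_id.sub_const s).inv (sub_ne_zero.2 hzs))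
    exact (Filter.EventuallyEq.differentiableAt_iff hz).2 (h2.add hhz.differentiableAt)
  rw [eventually_nhdsWithin_iff] at hd
  obtain ⟨r, hr, hrd⟩ := Metric.eventually_nhds_iff_ball.1 hd
  have key : ∀ a : ℂ, HasResidue q s a → (∮ z in C(s, r / 2), q z) = 2 * Real.pi * I * a :=
    fun a ha => by
    have := circleIntegral_eq_sum_hasResidue (a := fun _ => a) (c := s) (R := r / 2)
      (by positivity) {s} q (by simp [hr]) (by simpa using ha) fun z hz hzs =>
        hrd z (Metric.closedBall_subset_ball (half_lt_self hr) hz) (by simpa using hzs)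
    simpa using this
  have h1 := (key a ha).symm.trans (key b hb)
  have h2 : (2 * Real.pi * I : ℂ) ≠ 0 := Complex.two_pi_I_ne_zero
  exact mul_left_cancel₀ h2 h1

/-- The logarithmic residue weighted by an analytic function. -/
theorem hasResidue_mul_deriv_div {A f : ℂ → ℂ} (hA : AnalyticAt ℂ A s) (hf : AnalyticAt ℂ f s)
    (hfs : ¬∀ᶠ z in nhds s, f z = 0) :
    HasResidue (fun z => A z * deriv f z / f z) s (analyticOrderNatAt f s * A s) := by
  obtain ⟨u, hu, hu0, hfu⟩ :=
    hf.analyticOrderAt_ne_top.1 fun h => hfs (analyticOrderAt_eq_top.1 h)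
  set m := analyticOrderNatAt f s
  have hA' : AnalyticAt ℂ (fun z => A (z + s)) 0 :=
    AnalyticAt.fun_comp (f := fun z => z + s) (g := A) (by simpa using hA) (by fun_prop)
  obtain ⟨k, hk, -, hAk⟩ := hA'.exists_eq_add_mul
  refine ⟨Polynomial.C (m * A s) * Polynomial.X,
    fun z => m * k (z - s) + A z * deriv u z / u z,
    (analyticAt_const.mul (AnalyticAt.fun_comp (f := fun z => z - s) (g := k) (by simpa using hk)
      (by fun_prop))).add ((hA.mul hu.deriv).div hu hu0), by simp, ?_⟩
  rw [eventually_nhdsWithin_iff]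
  filter_upwards [hfu.eventually_nhds, hu.continuousAt.eventually_ne hu0,
    hu.eventually_analyticAt] with z hz huz huz' hzs
  have h3 : z - s ≠ 0 := sub_ne_zero.2 hzs
  have h4 : HasDerivAt (fun z => (z - s) ^ m • u z)
      (m * (z - s) ^ (m - 1) * 1 * u z + (z - s) ^ m * deriv u z) z :=
    (((hasDerivAt_id' z).sub_const s).fun_pow m).fun_mul huz'.differentiableAt.hasDerivAt
  rw [hz.self_of_nhds, Filter.EventuallyEq.deriv_eq hz, h4.deriv]
  have h5 := hAk (z - s)
  simp only [sub_add_cancel, zero_add] at h5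
  have h6 : (m:ℂ) * (z - s) ^ (m - 1) = m * ((z - s) ^ m * (z - s)⁻¹) := by
    rcases m.eq_zero_or_pos with h0 | h0
    · simp [h0]
    · obtain ⟨j, hj⟩ := Nat.exists_eq_succ_of_ne_zero h0.ne'
      rw [hj, Nat.succ_sub_one, pow_succ, mul_assoc, mul_inv_cancel₀ h3, mul_one]
  rw [h6]
  simp only [Polynomial.eval_mul, Polynomial.eval_C, Polynomial.eval_X, smul_eq_mul]
  rw [show (m:ℂ) * k (z - s) = m * (A z - A s) * (z - s)⁻¹ by rw [h5]; field_simp; ring]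
  have h7 := pow_ne_zero m h3
  field_simp
  ring

end Residue

theorem differentiableAt_circleIntegral {q : ℂ × ℂ → ℂ} {t₀ c : ℂ} {ρ : ℝ} (hρ : 0 ≤ ρ)
    (hq : ∀ s ∈ Metric.sphere c ρ, AnalyticAt ℂ q (t₀, s)) :
    DifferentiableAt ℂ (fun t => ∮ s in C(c, ρ), q (t, s)) t₀ := by
  have h1 : ∀ᶠ t in nhds t₀, ∀ s ∈ Metric.sphere c ρ, AnalyticAt ℂ q (t, s) :=
    (isCompact_sphere c ρ).eventually_forall_of_forall_eventually fun s hs =>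
      (hq s hs).eventually_analyticAt
  obtain ⟨ε, hε, hε'⟩ := Metric.nhds_basis_closedBall.eventually_iff.1 h1
  set q₁ : ℂ × ℂ → ℂ := fun x => fderiv ℂ q x (1, 0)
  have hq₁ : ∀ x ∈ Metric.closedBall t₀ ε ×ˢ Metric.sphere c ρ, ContinuousAt q₁ x :=
    fun x hx => (((hε' hx.1 x.2 hx.2).fderiv).continuousAt).clm_apply continuousAt_const
  obtain ⟨C, hC⟩ := ((isCompact_closedBall t₀ ε).prod
    (isCompact_sphere c ρ)).exists_bound_of_continuousOn
      fun x hx => (hq₁ x hx).continuousWithinAt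
  have hcirc : ∀ θ, circleMap c ρ θ ∈ Metric.sphere c ρ := circleMap_mem_sphere c hρ
  have hder : Continuous (deriv (circleMap c ρ)) := by
    rw [funext (deriv_circleMap c ρ)]
    fun_prop
  have hFc : ∀ (k : ℂ × ℂ → ℂ) (t : ℂ), (∀ s ∈ Metric.sphere c ρ, ContinuousAt k (t, s)) →
      Continuous fun θ : ℝ => deriv (circleMap c ρ) θ • k (t, circleMap c ρ θ) := fun k t hk => by
    refine hder.smul (continuous_iff_continuousAt.2 fun θ => ?_)
    exact ContinuousAt.comp (g := k) (f := fun θ => (t, circleMap c ρ θ)) (hk _ (hcirc θ))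
      (continuous_const.prodMk (continuous_circleMap c ρ)).continuousAt
  have hm := Metric.closedBall_mem_nhds t₀ hε
  have := intervalIntegral.hasDerivAt_integral_of_dominated_loc_of_deriv_le
    (μ := MeasureTheory.volume) (a := 0) (b := 2 * Real.pi)
    (F := fun t θ => deriv (circleMap c ρ) θ • q (t, circleMap c ρ θ))
    (F' := fun t θ => deriv (circleMap c ρ) θ • q₁ (t, circleMap c ρ θ)) (x₀ := t₀)
    (s := Metric.closedBall t₀ ε) (bound := fun _ => ρ * C) hm
    (Filter.mem_of_superset hm fun t ht =>
      (hFc q t fun s hs => (hε' ht s hs).continuousAt).aestronglyMeasurable)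
    ((hFc q t₀ fun s hs => (hq s hs).continuousAt).intervalIntegrable _ _)
    (hFc q₁ t₀ fun s hs => hq₁ (t₀, s) ⟨Metric.mem_closedBall_self hε.le, hs⟩).aestronglyMeasurable
    (.of_forall fun θ _ t ht => by
      rw [norm_smul]
      have h2 := hC (t, circleMap c ρ θ) ⟨ht, hcirc θ⟩
      have h3 : ‖deriv (circleMap c ρ) θ‖ = ρ := by
        rw [deriv_circleMap]; simp [abs_of_nonneg hρ]
      rw [h3]
      exact mul_le_mul_of_nonneg_left h2 hρ)
    (by simp)
    (.of_forall fun θ _ t ht => by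
      have h2 := (hε' ht _ (hcirc θ)).differentiableAt.hasFDerivAt
      have h3 : HasDerivAt (fun t => q (t, circleMap c ρ θ)) (q₁ (t, circleMap c ρ θ)) t :=
        h2.comp_hasDerivAt t ((hasDerivAt_id' t).prodMk (hasDerivAt_const t (circleMap c ρ θ)))
      exact h3.const_mul _)
  exact this.2.differentiableAt

/-- A curve in `ℂ × ℂ`, finite over the first factor, together with a function on it given by
residues of meromorphic functions along the fibres. -/
structure IsResidueCurve (Γ : Set (ℂ × ℂ)) (R : ℂ × ℂ → ℂ) : Prop where
  isClosed : IsClosed Γ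
  bounded : ∀ t₀, ∃ B, ∀ᶠ t in nhds t₀, ∀ s, (t, s) ∈ Γ → ‖s‖ ≤ B
  residue : ∀ x ∈ Γ, ∃ A f : ℂ × ℂ → ℂ, AnalyticAt ℂ A x ∧ AnalyticAt ℂ f x ∧
    (¬∀ᶠ s in nhds x.2, f (x.1, s) = 0) ∧ ∀ᶠ y in nhds x, (y ∈ Γ ↔ f y = 0) ∧
      (y ∈ Γ → HasResidue (fun s => A (y.1, s) / f (y.1, s)) y.2 (R y))

namespace IsResidueCurve

variable {Γ : Set (ℂ × ℂ)} {R : ℂ × ℂ → ℂ} {t₀ s₀ : ℂ}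

theorem isClosed_fibre (h : IsResidueCurve Γ R) (t : ℂ) : IsClosed {s | (t, s) ∈ Γ} :=
  h.isClosed.preimage (Continuous.prodMk_right t)

theorem finite_fibre (h : IsResidueCurve Γ R) (t : ℂ) : {s | (t, s) ∈ Γ}.Finite := by
  obtain ⟨B, hB⟩ := h.bounded t
  have hc : IsCompact {s | (t, s) ∈ Γ} :=
    (isCompact_closedBall (0:ℂ) B).of_isClosed_subset (h.isClosed_fibre t) fun s hs => by
      simpa using hB.self_of_nhds s hs
  refine hc.finite (isDiscrete_iff_nhdsNE.2 fun s hs => ?_)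
  obtain ⟨A, f, -, hf, hf0, hΓ⟩ := h.residue (t, s) hs
  have hfs : AnalyticAt ℂ (fun s => f (t, s)) s :=
    AnalyticAt.fun_comp (f := fun s => (t, s)) (g := f) hf (by fun_prop)
  have h1 := hfs.eventually_eq_zero_or_eventually_ne_zero.resolve_left hf0
  have h2 := (Continuous.prodMk_right t).continuousAt.eventually hΓ
  rw [Filter.inf_principal_eq_bot]
  filter_upwards [h1, h2.filter_mono nhdsWithin_le_nhds] with w hw hw' hwΓ
  exact hw (hw'.1.1 hwΓ)

theorem eventually_differentiableAt (h : IsResidueCurve Γ R) (hx : (t₀, s₀) ∈ Γ) :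
    ∀ᶠ ρ in nhdsWithin (0:ℝ) (Ioi 0), DifferentiableAt ℂ
      (fun t => ∑ᶠ s ∈ {s | s ∈ Metric.ball s₀ ρ ∧ (t, s) ∈ Γ}, R (t, s)) t₀ := by
  obtain ⟨A, f, hA, hf, hf0, hΓ⟩ := h.residue (t₀, s₀) hx
  have hfs : AnalyticAt ℂ (fun s => f (t₀, s)) s₀ :=
    AnalyticAt.fun_comp (f := fun s => (t₀, s)) (g := f) hf (by fun_prop)
  have h1 := hfs.eventually_eq_zero_or_eventually_ne_zero.resolve_left hf0
  rw [eventually_nhdsWithin_iff] at h1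
  obtain ⟨ε₁, hε₁, h1⟩ := Metric.eventually_nhds_iff_ball.1 h1
  obtain ⟨ε₂, hε₂, h2⟩ := Metric.eventually_nhds_iff_ball.1
    (hA.eventually_analyticAt.and (hf.eventually_analyticAt.and hΓ))
  have hε : 0 < min ε₁ ε₂ := lt_min hε₁ hε₂
  filter_upwards [Ioo_mem_nhdsGT hε] with ρ hρ
  have hρ1 : Metric.closedBall s₀ ρ ⊆ Metric.ball s₀ ε₁ :=
    Metric.closedBall_subset_ball (hρ.2.trans_le (min_le_left _ _))
  have hρ2 : ∀ t ∈ Metric.ball t₀ ε₂, ∀ s ∈ Metric.closedBall s₀ ρ,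
      (t, s) ∈ Metric.ball (t₀, s₀) ε₂ := fun t ht s hs => by
    rw [← ball_prod_same]
    exact ⟨ht, Metric.closedBall_subset_ball (hρ.2.trans_le (min_le_right _ _)) hs⟩
  have ht₀ := Metric.mem_ball_self hε₂ (x := t₀)
  have hsph : ∀ s ∈ Metric.sphere s₀ ρ, f (t₀, s) ≠ 0 := fun s hs =>
    h1 s (hρ1 (Metric.sphere_subset_closedBall hs)) fun hss => by
      rw [mem_singleton_iff.1 hss, mem_sphere_iff_norm, sub_self, norm_zero] at hs
      exact hρ.1.ne hs
  have hq : ∀ s ∈ Metric.sphere s₀ ρ, AnalyticAt ℂ (fun y => A y / f y) (t₀, s) := fun s hs => by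
    obtain ⟨h3, h4, -⟩ := h2 _ (hρ2 t₀ ht₀ s (Metric.sphere_subset_closedBall hs))
    exact h3.div h4 (hsph s hs)
  have hI := (differentiableAt_circleIntegral hρ.1.le hq).const_mul (2 * Real.pi * I)⁻¹
  refine hI.congr_of_eventuallyEq ?_
  have h3 : ∀ᶠ t in nhds t₀, ∀ s ∈ Metric.sphere s₀ ρ, f (t, s) ≠ 0 :=
    (isCompact_sphere s₀ ρ).eventually_forall_of_forall_eventually fun s hs =>
      (h2 _ (hρ2 t₀ ht₀ s (Metric.sphere_subset_closedBall hs))).2.1.continuousAt.eventually_ne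
        (hsph s hs)
  filter_upwards [h3, Metric.ball_mem_nhds t₀ hε₂] with t ht htb
  have hfin : {s | s ∈ Metric.ball s₀ ρ ∧ (t, s) ∈ Γ}.Finite :=
    (h.finite_fibre t).subset fun s hs => hs.2
  refine (finsum_mem_eq_finite_toFinset_sum _ hfin).trans ?_
  have h4 := circleIntegral_eq_sum_hasResidue (a := fun s => R (t, s)) hρ.1.le hfin.toFinset
    (fun s => A (t, s) / f (t, s)) (c := s₀) (fun s hs => (hfin.mem_toFinset.1 hs).1)
    (fun s hs => ((h2 _ (hρ2 t htb s (Metric.ball_subset_closedBall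
      (hfin.mem_toFinset.1 hs).1))).2.2.2 (hfin.mem_toFinset.1 hs).2)) fun s hs hsΓ => by
    obtain ⟨h5, h6, h7, -⟩ := h2 _ (hρ2 t htb s hs)
    have h8 : f (t, s) ≠ 0 := fun h0 => by
      rcases (Metric.mem_closedBall.1 hs).lt_or_eq with hlt | heq
      · exact hsΓ (hfin.mem_toFinset.2 ⟨hlt, h7.2 h0⟩)
      · exact ht s heq h0
    have h9 : DifferentiableAt ℂ (fun s : ℂ => (t, s)) s := by fun_prop
    exact (h5.differentiableAt.fun_comp' (f := fun s : ℂ => (t, s)) s h9).div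
      (h6.differentiableAt.fun_comp' (f := fun s : ℂ => (t, s)) s h9) h8
  rw [h4, ← mul_assoc, inv_mul_cancel₀ Complex.two_pi_I_ne_zero, one_mul]

/-- The trace of the residues is holomorphic. -/
theorem differentiable_trace (h : IsResidueCurve Γ R) :
    Differentiable ℂ fun t => ∑ᶠ s ∈ {s | (t, s) ∈ Γ}, R (t, s) := by
  intro t₀
  have hfin := h.finite_fibre t₀
  obtain ⟨B, hB⟩ := h.bounded t₀
  have h1 : ∀ᶠ ρ in nhdsWithin (0:ℝ) (Ioi 0), ∀ s₀ ∈ {s | (t₀, s) ∈ Γ}, DifferentiableAt ℂ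
      (fun t => ∑ᶠ s ∈ {s | s ∈ Metric.ball s₀ ρ ∧ (t, s) ∈ Γ}, R (t, s)) t₀ :=
    (Filter.eventually_all_finite hfin).2 fun s hs => h.eventually_differentiableAt hs
  have h2 : ∀ᶠ ρ in nhdsWithin (0:ℝ) (Ioi 0), ∀ s ∈ {s | (t₀, s) ∈ Γ}, ∀ s' ∈ {s | (t₀, s) ∈ Γ},
      s ≠ s' → ρ + ρ ≤ dist s s' :=
    (Filter.eventually_all_finite hfin).2 fun s hs => (Filter.eventually_all_finite hfin).2
      fun s' hs' => by
        by_cases hss : s = s'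
        · exact .of_forall fun ρ h => absurd hss h
        · filter_upwards [Ioo_mem_nhdsGT (half_pos (dist_pos.2 hss))] with ρ hρ _
          linarith [hρ.2]
  obtain ⟨ρ, ⟨h1, h2⟩, hρ⟩ := ((h1.and h2).and self_mem_nhdsWithin).exists
  have hK : IsCompact (Metric.closedBall (0:ℂ) B \ ⋃ s ∈ {s | (t₀, s) ∈ Γ}, Metric.ball s ρ) :=
    (isCompact_closedBall _ _).diff (isOpen_biUnion fun _ _ => Metric.isOpen_ball)
  have h3 : ∀ᶠ t in nhds t₀, ∀ s ∈ Metric.closedBall (0:ℂ) B \ ⋃ s ∈ {s | (t₀, s) ∈ Γ},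
      Metric.ball s ρ, (t, s) ∉ Γ :=
    hK.eventually_forall_of_forall_eventually fun s hs =>
      h.isClosed.isOpen_compl.mem_nhds fun hsΓ =>
        hs.2 (mem_biUnion (x := s) hsΓ (Metric.mem_ball_self hρ))
  have hsum : DifferentiableAt ℂ (fun t => ∑ s₀ ∈ hfin.toFinset,
      ∑ᶠ s ∈ {s | s ∈ Metric.ball s₀ ρ ∧ (t, s) ∈ Γ}, R (t, s)) t₀ :=
    DifferentiableAt.fun_sum fun s hs => h1 s (hfin.mem_toFinset.1 hs)
  refine hsum.congr_of_eventuallyEq ?_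
  filter_upwards [h3, hB] with t ht htB
  have hU : {s | (t, s) ∈ Γ} =
      ⋃ s₀ ∈ {s | (t₀, s) ∈ Γ}, {s | s ∈ Metric.ball s₀ ρ ∧ (t, s) ∈ Γ} := by
    ext s
    simp only [mem_iUnion, mem_ofPred_eq, exists_prop]
    refine ⟨fun hs => ?_, fun ⟨_, _, _, hs⟩ => hs⟩
    by_contra hne
    refine ht s ⟨by simpa using htB s hs, fun hmem => ?_⟩ hs
    simp only [mem_iUnion, exists_prop] at hmem
    obtain ⟨i, hi, hi'⟩ := hmem
    exact hne ⟨i, hi, hi', hs⟩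
  have hdisj : {s | (t₀, s) ∈ Γ}.PairwiseDisjoint
      fun s₀ => {s | s ∈ Metric.ball s₀ ρ ∧ (t, s) ∈ Γ} := fun s hs s' hs' hss =>
    disjoint_left.2 fun w hw hw' =>
      disjoint_left.1 (Metric.ball_disjoint_ball (h2 s hs s' hs' hss)) hw.1 hw'.1
  refine (finsum_mem_congr hU fun _ _ => rfl).trans ?_
  refine (finsum_mem_biUnion hdisj hfin fun s _ =>
    (h.finite_fibre t).subset fun s hs => hs.2).trans ?_
  exact finsum_mem_eq_finite_toFinset_sum _ hfin

end IsResidueCurve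

/-- A closed cone, finite over a hyperplane under projection from `c`, together with a homogeneous
function on it given by residues of meromorphic functions along the lines parallel to `c`. -/
structure IsResidueCone {m : ℕ} (S : Set (Fin m → ℂ)) (c : Fin m → ℂ) (k : ℕ)
    (R : (Fin m → ℂ) → ℂ) : Prop where
  isCone : IsCone S
  isClosed : IsClosedInPunctured S
  ne_zero : c ≠ 0
  notMem : c ∉ S
  smul : ∀ a : ℂ, a ≠ 0 → ∀ y ∈ S, R (a • y) = a⁻¹ ^ k * R y
  residue : ∀ y ∈ S, ∃ A f : (Fin m → ℂ) → ℂ, AnalyticAt ℂ A y ∧ AnalyticAt ℂ f y ∧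
    (¬∀ᶠ s in nhds (0:ℂ), f (y + s • c) = 0) ∧ ∀ᶠ x in nhds y, (x ∈ S ↔ f x = 0) ∧
      (x ∈ S → HasResidue (fun s => A (x + s • c) / f (x + s • c)) 0 (R x))

namespace IsResidueCone

variable {m k : ℕ} {S : Set (Fin m → ℂ)} {c b₀ b₁ : Fin m → ℂ} {R : (Fin m → ℂ) → ℂ}

theorem isResidueCurve (h : IsResidueCone S c k R)
    (hb : ∀ t s : ℂ, b₀ + t • b₁ + s • c ≠ 0) :
    IsResidueCurve {x | b₀ + x.1 • b₁ + x.2 • c ∈ S} fun x => R (b₀ + x.1 • b₁ + x.2 • c) where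
  isClosed := by
    have hL : Continuous fun x : ℂ × ℂ => b₀ + x.1 • b₁ + x.2 • c := by fun_prop
    refine isClosed_of_closure_subset fun x hx => h.isClosed _ ?_ (hb _ _)
    exact map_mem_closure (f := fun x : ℂ × ℂ => b₀ + x.1 • b₁ + x.2 • c) hL hx fun y hy => hy
  bounded t₀ := by
    have hcS : c ∉ closure S := fun hc => h.notMem (h.isClosed c hc h.ne_zero)
    obtain ⟨δ, hδ, hδS⟩ := Metric.isOpen_iff.1 isClosed_closure.isOpen_compl c hcS
    have hb : Continuous fun t : ℂ => ‖b₀ + t • b₁‖ := by fun_prop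
    set C := ‖b₀ + t₀ • b₁‖ + 1
    have hC : 0 < C := by positivity
    refine ⟨C / δ, ?_⟩
    filter_upwards [hb.continuousAt.eventually_lt_const (lt_add_one ‖b₀ + t₀ • b₁‖)] with t ht s hs
    by_contra! hlt
    have hs0 : 0 < ‖s‖ := (by positivity : 0 ≤ C / δ).trans_lt hlt
    have hs0' : s ≠ 0 := norm_pos_iff.1 hs0
    refine hδS (?_ : s⁻¹ • (b₀ + t • b₁ + s • c) ∈ Metric.ball c δ)
      (subset_closure (h.isCone _ (inv_ne_zero hs0') _ hs))
    rw [mem_ball_iff_norm, smul_add, inv_smul_smul₀ hs0', add_sub_cancel_right, norm_smul, norm_inv]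
    rw [div_lt_iff₀ hδ] at hlt
    rw [inv_mul_lt_iff₀ hs0]
    exact ht.trans hlt
  residue x hx := by
    obtain ⟨A, f, hA, hf, hf0, hS⟩ := h.residue _ hx
    set L : ℂ × ℂ → (Fin m → ℂ) := fun x => b₀ + x.1 • b₁ + x.2 • c with hL
    have hLa : AnalyticAt ℂ L x := by
      refine (analyticAt_const.add (analyticAt_fst.smul analyticAt_const)).add
        (analyticAt_snd.smul analyticAt_const)
    have hLs : ∀ (t s s' : ℂ), L (t, s') = L (t, s) + (s' - s) • c := fun t s s' => by
      simp only [hL]; module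
    refine ⟨fun x => A (L x), fun x => f (L x), AnalyticAt.fun_comp (f := L) hA hLa,
      AnalyticAt.fun_comp (f := L) hf hLa, fun h0 => hf0 ?_, ?_⟩
    · have ht : Filter.Tendsto (fun s : ℂ => x.2 + s) (nhds 0) (nhds x.2) := by
        have : Continuous fun s : ℂ => x.2 + s := by fun_prop
        simpa using this.tendsto 0
      filter_upwards [ht.eventually h0] with s hs
      rwa [hLs x.1 x.2, add_sub_cancel_left] at hs
    · filter_upwards [hLa.continuousAt.eventually hS] with y hy
      refine ⟨hy.1, fun hyS => ((hy.2 hyS).comp_sub y.2).congr (.of_forall fun s => ?_)⟩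
      rw [hLs y.1 y.2 s, add_zero]

/-- The sum of the residues along any line parallel to `c` vanishes. -/
theorem trace_eq_zero (h : IsResidueCone S c k R) (hk : k ≠ 0)
    (hb : ∀ x₀ x₁ s : ℂ, x₀ • b₀ + x₁ • b₁ + s • c = 0 → x₀ = 0 ∧ x₁ = 0) :
    {s : ℂ | b₀ + s • c ∈ S}.Finite ∧ ∑ᶠ s ∈ {s : ℂ | b₀ + s • c ∈ S}, R (b₀ + s • c) = 0 := by
  have h1 := h.isResidueCurve (b₀ := b₀) (b₁ := b₁) fun t s h0 =>
    one_ne_zero (hb 1 t s (by rwa [one_smul])).1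
  have h2 := h.isResidueCurve (b₀ := b₁) (b₁ := b₀) fun t s h0 =>
    one_ne_zero (hb t 1 s (by rwa [one_smul, add_comm (t • b₀)])).2
  have hd1 := h1.differentiable_trace
  have hd2 := h2.differentiable_trace
  have hf1 := h1.finite_fibre 0
  simp only [mem_ofPred_eq] at hd1 hd2 hf1
  set T₁ : ℂ → ℂ := fun t => ∑ᶠ (s : ℂ) (_ : b₀ + t • b₁ + s • c ∈ S), R (b₀ + t • b₁ + s • c)
    with hT₁
  set T₂ : ℂ → ℂ := fun t => ∑ᶠ (s : ℂ) (_ : b₁ + t • b₀ + s • c ∈ S), R (b₁ + t • b₀ + s • c)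
    with hT₂
  have h12 : ∀ t : ℂ, t ≠ 0 → T₂ t = t⁻¹ ^ k * T₁ t⁻¹ := fun t ht => by
    have hL : ∀ s : ℂ, b₁ + t • b₀ + s • c = t • (b₀ + t⁻¹ • b₁ + (t⁻¹ * s) • c) := fun s => by
      simp only [smul_add, smul_smul, mul_inv_cancel₀ ht, mul_inv_cancel_left₀ ht, one_smul]
      abel
    have hfin : {s | b₀ + t⁻¹ • b₁ + s • c ∈ S}.Finite := h1.finite_fibre t⁻¹
    have h3 : T₁ t⁻¹ = ∑ᶠ s ∈ {s | b₀ + t⁻¹ • b₁ + s • c ∈ S}, R (b₀ + t⁻¹ • b₁ + s • c) := rfl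
    rw [h3, ← smul_eq_mul, smul_finsum_mem hfin]
    refine finsum_mem_eq_of_bijOn (s := {s | b₁ + t • b₀ + s • c ∈ S}) (fun s => t⁻¹ * s)
      ⟨fun s hs => ?_, fun s _ s' _ hss => mul_left_cancel₀ (inv_ne_zero ht) hss,
        fun s hs => ⟨t * s, ?_, inv_mul_cancel_left₀ ht s⟩⟩ fun s hs => ?_
    · have := h.isCone _ (inv_ne_zero ht) _ hs
      rw [hL, inv_smul_smul₀ ht] at this
      exact this
    · rw [mem_ofPred_eq, hL, inv_mul_cancel_left₀ ht]
      exact h.isCone _ ht _ hs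
    · have := h.isCone _ (inv_ne_zero ht) _ hs
      rw [hL, inv_smul_smul₀ ht] at this
      rw [hL, h.smul t ht _ this, smul_eq_mul]
  have hT₂0 : ∀ t, T₂ t = 0 := by
    have hlim : Filter.Tendsto T₂ (Bornology.cobounded ℂ) (nhds 0) := by
      have h4 : Filter.Tendsto (fun t : ℂ => t⁻¹ ^ k * T₁ t⁻¹) (Bornology.cobounded ℂ)
          (nhds 0) := by
        have h5 : Filter.Tendsto (fun u : ℂ => u ^ k * T₁ u) (nhds 0) (nhds 0) := by
          have : Continuous fun u : ℂ => u ^ k * T₁ u :=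
            (continuous_pow k).mul hd1.continuous
          simpa [hk] using this.tendsto 0
        exact h5.comp Filter.tendsto_inv₀_cobounded
      refine h4.congr' ?_
      filter_upwards [Bornology.isBounded_def.1 (Bornology.isBounded_singleton (x := (0:ℂ)))]
        with t ht
      exact (h12 t ht).symm
    exact fun t => hd2.apply_eq_of_tendsto_cocompact t (by rwa [← Metric.cobounded_eq_cocompact])
  have hT₁0 : ∀ u, u ≠ 0 → T₁ u = 0 := fun u hu => by
    have h6 := h12 u⁻¹ (inv_ne_zero hu)
    rw [hT₂0, inv_inv] at h6
    exact (mul_eq_zero.1 h6.symm).resolve_left (pow_ne_zero _ hu)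
  have hT₁00 : T₁ 0 = 0 := by
    have h7 : Filter.Tendsto T₁ (nhdsWithin 0 {0}ᶜ) (nhds (T₁ 0)) :=
      hd1.continuous.continuousAt.tendsto.mono_left nhdsWithin_le_nhds
    have h8 : Filter.Tendsto T₁ (nhdsWithin 0 {0}ᶜ) (nhds 0) :=
      tendsto_const_nhds.congr' (by
        filter_upwards [self_mem_nhdsWithin] with u hu using (hT₁0 u hu).symm)
    exact tendsto_nhds_unique h7 h8
  simp only [zero_smul, add_zero] at hf1
  refine ⟨hf1, ?_⟩
  simp only [hT₁, zero_smul, add_zero] at hT₁00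
  exact hT₁00

end IsResidueCone

/-- If all positive power sums with positive integral weights vanish, so do all terms. -/
theorem eq_zero_of_forall_sum_mul_pow_eq_zero {ι : Type*} {s : Finset ι} {m : ι → ℕ} {t : ι → ℂ}
    (hm : ∀ i ∈ s, m i ≠ 0) (h : ∀ k : ℕ, k ≠ 0 → ∑ i ∈ s, (m i : ℂ) * t i ^ k = 0) :
    ∀ i ∈ s, t i = 0 := by
  classical
  intro i₀ hi₀
  by_contra h0
  have hpoly : ∀ p : Polynomial ℂ, ∑ i ∈ s, (m i : ℂ) * (t i * p.eval (t i)) = 0 := fun p => by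
    induction p using Polynomial.induction_on' with
    | add p q hp hq =>
      simp only [Polynomial.eval_add, mul_add, Finset.sum_add_distrib, hp, hq, add_zero]
    | monomial k b =>
      have : ∀ i ∈ s, (m i : ℂ) * (t i * (Polynomial.monomial k b).eval (t i)) =
          b * (m i * t i ^ (k + 1)) := fun i _ => by
        rw [Polynomial.eval_monomial]; ring
      rw [Finset.sum_congr rfl this, ← Finset.mul_sum, h _ k.succ_ne_zero, mul_zero]
  set p : Polynomial ℂ := ∏ x ∈ (s.image t).erase (t i₀), (Polynomial.X - Polynomial.C x)
  have hp0 : p.eval (t i₀) ≠ 0 := by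
    rw [Polynomial.eval_prod, Finset.prod_ne_zero_iff]
    intro x hx
    rw [Polynomial.eval_sub, Polynomial.eval_X, Polynomial.eval_C]
    exact sub_ne_zero.2 (Finset.ne_of_mem_erase hx).symm
  have hp : ∀ i ∈ s, t i ≠ t i₀ → p.eval (t i) = 0 := fun i hi hne => by
    rw [Polynomial.eval_prod]
    refine Finset.prod_eq_zero (Finset.mem_erase.2 ⟨hne, Finset.mem_image_of_mem t hi⟩) ?_
    simp
  have h1 := hpoly p
  have h2 : ∀ i ∈ s, (m i : ℂ) * (t i * p.eval (t i)) =
      (if t i = t i₀ then (m i : ℂ) else 0) * (t i₀ * p.eval (t i₀)) := fun i hi => by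
    split_ifs with hc
    · rw [hc]
    · rw [hp i hi hc]; ring
  rw [Finset.sum_congr rfl h2, ← Finset.sum_mul] at h1
  have h3 := (mul_eq_zero.1 h1).resolve_right (mul_ne_zero h0 hp0)
  have h4 : ((∑ i ∈ s, if t i = t i₀ then m i else 0 : ℕ) : ℂ) = 0 := by
    rw [← h3, Nat.cast_sum]
    exact Finset.sum_congr rfl fun i _ => by split_ifs <;> simp
  have h5 := Finset.sum_eq_zero_iff.1 (Nat.cast_eq_zero.1 h4) i₀ hi₀
  rw [if_pos rfl] at h5
  exact hm i₀ hi₀ h5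

theorem AnalyticAt.clm_apply_const {E G H : Type*} [NormedAddCommGroup E] [NormedSpace ℂ E]
    [NormedAddCommGroup G] [NormedSpace ℂ G] [NormedAddCommGroup H] [NormedSpace ℂ H]
    {f : E → G →L[ℂ] H} {x : E} (hf : AnalyticAt ℂ f x) (v : G) :
    AnalyticAt ℂ (fun y => f y v) x :=
  AnalyticAt.fun_comp (f := f) (g := fun L : G →L[ℂ] H => L v)
    ((ContinuousLinearMap.apply ℂ H v).analyticAt _) hf

namespace ProjFoliation

section

variable {n d : ℕ} {F : ProjFoliation n d} {c v w y z : Fin (n + 1) → ℂ}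

theorem analyticAt_dform (u v z : Fin (n + 1) → ℂ) : AnalyticAt ℂ (fun z => F.dform z u v) z := by
  have h : AnalyticAt ℂ (fderiv ℂ F.form) z := (F.analyticAt_form z).fderiv
  have h2 : ∀ u v : Fin (n + 1) → ℂ, AnalyticAt ℂ (fun z => fderiv ℂ F.form z u v) z := fun u v =>
    (h.clm_apply_const u).clm_apply_const v
  exact (h2 u v).sub (h2 v u)

theorem dform_smul_left (a : ℂ) (z u v : Fin (n + 1) → ℂ) :
    F.dform (a • z) u v = a ^ d * F.dform z u v := by
  simp only [dform, fderiv_form_apply, mul_sub, Finset.mul_sum, Finset.sum_mul]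
  have h : ∀ i j, eval (a • z) (pderiv j (F.a i)) = a ^ d * eval z (pderiv j (F.a i)) :=
    fun i j => by
      have := (F.homog i).pderiv (i := j)
      rw [Nat.add_sub_cancel] at this
      exact this.eval_smul a z
  simp only [h, mul_assoc]

theorem analyticAt_form_apply (v z : Fin (n + 1) → ℂ) : AnalyticAt ℂ (fun z => F.form z v) z :=
  (F.analyticAt_form z).clm_apply_const v

theorem isClosed_form_apply_eq_zero (v : Fin (n + 1) → ℂ) : IsClosed {z | F.form z v = 0} :=
  isClosed_eq (continuous_iff_continuousAt.2 fun z => (analyticAt_form_apply v z).continuousAt)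
    continuous_const

theorem not_eventually_form_line_eq_zero (hc : F.form c v ≠ 0) (y : Fin (n + 1) → ℂ) :
    ¬∀ᶠ s in nhds (0:ℂ), F.form (y + s • c) v = 0 := by
  intro h
  have ha : AnalyticOnNhd ℂ (fun s : ℂ => F.form (y + s • c) v) univ := fun s _ =>
    AnalyticAt.fun_comp (f := fun s : ℂ => y + s • c) (g := fun z => F.form z v)
      (analyticAt_form_apply v _) (by fun_prop)
  have h0 := ha.eq_of_eventuallyEq (g := fun _ => 0) (fun s _ => analyticAt_const) (z₀ := 0) h
  have h1 : ∀ s : ℂ, F.form (y + s • c) v = 0 := fun s => congrFun h0 s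
  have h2 : Filter.Tendsto (fun u : ℂ => F.form (u • y + c) v) (nhdsWithin 0 {0}ᶜ)
      (nhds (F.form c v)) := by
    have : ContinuousAt (fun u : ℂ => F.form (u • y + c) v) 0 :=
      ContinuousAt.comp (f := fun u : ℂ => u • y + c) (g := fun z => F.form z v)
        (analyticAt_form_apply v _).continuousAt (by fun_prop)
    have := this.tendsto.mono_left (nhdsWithin_le_nhds (s := {0}ᶜ))
    simpa using this
  refine hc (tendsto_nhds_unique h2 (tendsto_const_nhds.congr' ?_))
  filter_upwards [self_mem_nhdsWithin] with u hu
  have h3 : u • y + c = u • (y + u⁻¹ • c) := by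
    rw [smul_add, smul_inv_smul₀ hu]
  rw [h3, form_smul_left, h1, mul_zero]

/-- At a point where the form vanishes on `v`, the contraction of its exterior derivative with `v`
is proportional to the form; this is the factor. -/
def tangencyFactor (F : ProjFoliation n d) (v z : Fin (n + 1) → ℂ) : ℂ :=
  F.dform z v (Classical.epsilon fun w => F.form z w ≠ 0) /
    F.form z (Classical.epsilon fun w => F.form z w ≠ 0)

theorem tangencyFactor_eq (hv : F.form z v = 0) (hw : F.form z w ≠ 0) :
    F.tangencyFactor v z = F.dform z v w / F.form z w := by
  have h1 := Classical.epsilon_spec (p := fun w => F.form z w ≠ 0) ⟨w, hw⟩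
  rw [tangencyFactor, div_eq_div_iff h1 hw]
  have h2 := F.dform_integrable z v w (Classical.epsilon fun w => F.form z w ≠ 0)
  rw [hv, F.dform_swap z _ v] at h2
  linear_combination -h2

theorem isResidueCone_tangencyFactor (hF : ∀ z, z ≠ 0 → F.form z ≠ 0) (hc : F.form c v ≠ 0)
    (k : ℕ) :
    IsResidueCone {z | z ≠ 0 ∧ F.form z v = 0} c k fun y =>
      analyticOrderNatAt (fun s : ℂ => F.form (y + s • c) v) 0 * F.tangencyFactor v y ^ k where
  isCone a ha z hz := ⟨smul_ne_zero ha hz.1, by rw [form_smul_left, hz.2, mul_zero]⟩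
  isClosed z hz hz0 := ⟨hz0, (isClosed_form_apply_eq_zero v).closure_subset_iff.2
    (fun _ h => h.2) hz⟩
  ne_zero h := hc (by rw [h, ← zero_smul ℂ (0 : Fin (n + 1) → ℂ), form_smul_left,
    zero_pow d.succ_ne_zero, zero_mul])
  notMem h := hc h.2
  smul a ha y hy := by
    obtain ⟨w, hw⟩ := DFunLike.ne_iff.1 (hF y hy.1)
    have hw' : F.form (a • y) w ≠ 0 := by
      rw [form_smul_left]
      exact mul_ne_zero (pow_ne_zero _ ha) hw
    have hv' : F.form (a • y) v = 0 := by rw [form_smul_left, hy.2, mul_zero]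
    rw [tangencyFactor_eq hy.2 hw, tangencyFactor_eq hv' hw', form_smul_left, dform_smul_left]
    have h1 : (fun s : ℂ => F.form (a • y + s • c) v) =
        (fun _ => a ^ (d + 1)) * ((fun s : ℂ => F.form (y + s • c) v) ∘ fun s => a⁻¹ * s) := by
      ext s
      rw [Pi.mul_apply, Function.comp_apply, ← form_smul_left, smul_add, smul_smul,
        mul_inv_cancel_left₀ ha]
    have h2 : analyticOrderAt (fun s : ℂ => F.form (a • y + s • c) v) 0 =
        analyticOrderAt (fun s : ℂ => F.form (y + s • c) v) 0 := by
      have h3 : AnalyticAt ℂ (fun s : ℂ => a⁻¹ * s) 0 := by fun_prop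
      have h4 : deriv (fun s : ℂ => a⁻¹ * s) 0 ≠ 0 := by
        rw [((hasDerivAt_id' (0:ℂ)).const_mul a⁻¹).deriv, mul_one]
        exact inv_ne_zero ha
      have h5 : AnalyticAt ℂ (fun s : ℂ => F.form (y + s • c) v) (a⁻¹ * 0) :=
        AnalyticAt.fun_comp (f := fun s : ℂ => y + s • c) (g := fun z => F.form z v)
          (analyticAt_form_apply v _) (by fun_prop)
      rw [h1, analyticOrderAt_mul analyticAt_const (h5.comp h3),
        analyticOrderAt_comp_of_deriv_ne_zero h3 h4, mul_zero,
        analyticAt_const.analyticOrderAt_eq_zero.2 (pow_ne_zero _ ha), zero_add]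
    rw [analyticOrderNatAt, h2, ← analyticOrderNatAt]
    have h6 : a ^ d * F.dform y v w / (a ^ (d + 1) * F.form y w) =
        a⁻¹ * (F.dform y v w / F.form y w) := by
      rw [pow_succ, inv_mul_eq_div, div_div, mul_assoc, mul_div_mul_left _ _ (pow_ne_zero d ha),
        mul_comm a]
    rw [h6, mul_pow]
    ring
  residue y hy := by
    obtain ⟨w, hw⟩ := DFunLike.ne_iff.1 (hF y hy.1)
    have hA : ∀ x, F.form x w ≠ 0 → AnalyticAt ℂ (fun z => (F.dform z v w / F.form z w) ^ k) x :=
      fun x hx => ((analyticAt_dform v w x).div (analyticAt_form_apply w x) hx).pow k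
    have hline : ∀ (x : Fin (n + 1) → ℂ) (s : ℂ), HasDerivAt (fun s : ℂ => F.form (x + s • c) v)
        (fderiv ℂ (fun z => F.form z v) (x + s • c) c) s := fun x s => by
      have h1 : HasDerivAt (fun s : ℂ => x + s • c) c s := by
        simpa using ((hasDerivAt_id' s).smul_const c).const_add x
      exact (analyticAt_form_apply v _).differentiableAt.hasFDerivAt.comp_hasDerivAt s h1
    refine ⟨fun z => (F.dform z v w / F.form z w) ^ k * fderiv ℂ (fun z => F.form z v) z c,
      fun z => F.form z v, (hA y hw).mul
        ((analyticAt_form_apply v y).fderiv.clm_apply_const c),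
      analyticAt_form_apply v y, not_eventually_form_line_eq_zero hc y, ?_⟩
    filter_upwards [(analyticAt_form_apply w y).continuousAt.eventually_ne hw,
      isOpen_ne.mem_nhds hy.1] with x hx hx0
    refine ⟨⟨fun h => h.2, fun h => ⟨hx0, h⟩⟩, fun hxS => ?_⟩
    have h1 := hasResidue_mul_deriv_div (s := 0)
      (A := fun s : ℂ => (F.dform (x + s • c) v w / F.form (x + s • c) w) ^ k)
      (f := fun s : ℂ => F.form (x + s • c) v)
      (AnalyticAt.fun_comp (f := fun s : ℂ => x + s • c)
        (g := fun z => (F.dform z v w / F.form z w) ^ k) (hA _ (by simpa using hx)) (by fun_prop))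
      (AnalyticAt.fun_comp (f := fun s : ℂ => x + s • c) (g := fun z => F.form z v)
        (analyticAt_form_apply v _) (by fun_prop)) (not_eventually_form_line_eq_zero hc x)
    simp only [zero_smul, add_zero] at h1
    rw [tangencyFactor_eq hxS.2 hx]
    exact h1.congr (.of_forall fun s => by rw [(hline x s).deriv])

/-- Every foliation of codimension one on a projective space has a singularity. -/
theorem exists_form_eq_zero (F : ProjFoliation n d) (hn : 2 ≤ n) : ∃ z, z ≠ 0 ∧ F.form z = 0 := by
  by_contra! hF
  obtain ⟨c, hc0⟩ := exists_ne (0 : Fin (n + 1) → ℂ)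
  obtain ⟨v, hv⟩ := DFunLike.ne_iff.1 (hF c hc0)
  have hv : F.form c v ≠ 0 := hv
  obtain ⟨e, he⟩ := exists_not_mem_span_pair hn v c
  have hb : ∀ x₀ x₁ s : ℂ, x₀ • v + x₁ • e + s • c = 0 → x₀ = 0 ∧ x₁ = 0 := fun x₀ x₁ s h => by
    have h1 : x₁ = 0 := by
      by_contra h1
      refine he (Submodule.mem_span_pair.2 ⟨-(x₁⁻¹ * x₀), -(x₁⁻¹ * s), ?_⟩)
      have h2 : e = x₁⁻¹ • (x₁ • e) := (inv_smul_smul₀ h1 e).symm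
      have h3 : x₁ • e = -(x₀ • v) - s • c := by linear_combination (exp := 1) h
      rw [h2, h3]
      module
    refine ⟨?_, h1⟩
    have h2 := congrArg (F.form c) h
    rw [h1] at h2
    simpa [form_self, hv] using h2
  have hv0 : v ≠ 0 := fun h => hv (by rw [h, map_zero])
  have hfin := ((isResidueCone_tangencyFactor hF hv 1).trace_eq_zero one_ne_zero hb).1
  have htr : ∀ k : ℕ, k ≠ 0 → ∑ s ∈ hfin.toFinset,
      (analyticOrderNatAt (fun u : ℂ => F.form (v + s • c + u • c) v) 0 : ℂ) *
        F.tangencyFactor v (v + s • c) ^ k = 0 := fun k hk => by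
    have := ((isResidueCone_tangencyFactor hF hv k).trace_eq_zero hk hb).2
    exact (finsum_mem_eq_finite_toFinset_sum _ hfin).symm.trans this
  have h0 : (0:ℂ) ∈ hfin.toFinset := by
    rw [hfin.mem_toFinset]
    simp [hv0, form_self]
  have h1 := eq_zero_of_forall_sum_mul_pow_eq_zero (fun s hs => ?hm) htr 0 h0
  case hm =>
    rw [hfin.mem_toFinset] at hs
    have ha : AnalyticAt ℂ (fun u : ℂ => F.form (v + s • c + u • c) v) 0 :=
      AnalyticAt.fun_comp (f := fun u : ℂ => v + s • c + u • c) (g := fun z => F.form z v)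
        (analyticAt_form_apply v _) (by fun_prop)
    intro h0
    have h1 : analyticOrderAt (fun u : ℂ => F.form (v + s • c + u • c) v) 0 ≠ ⊤ := fun h =>
      not_eventually_form_line_eq_zero hv _ (analyticOrderAt_eq_top.1 h)
    have h2 := Nat.cast_analyticOrderNatAt h1
    rw [h0, Nat.cast_zero] at h2
    refine ha.analyticOrderAt_eq_zero.1 h2.symm ?_
    simpa using hs.2
  obtain ⟨w, hw⟩ := DFunLike.ne_iff.1 (hF v hv0)
  have hw : F.form v w ≠ 0 := hw
  rw [zero_smul, add_zero, tangencyFactor_eq (form_self _ _) hw, dform_self_left,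
    mul_div_assoc, div_self hw, mul_one] at h1
  exact (by positivity : ((d:ℝ) + 2) ≠ 0) (by exact_mod_cast h1)

end

end ProjFoliation

namespace ProjFoliation

section

variable {n d : ℕ} {F : ProjFoliation n d} {M : Set (Fin (n + 1) → ℂ)}
  {b c p v w y z : Fin (n + 1) → ℂ} {f g : (Fin (n + 1) → ℂ) → ℂ} {U V : Set (Fin (n + 1) → ℂ)}

theorem IsNontrivialMinimalSet.isClosed_line (hM : F.IsNontrivialMinimalSet M)
    (h : ∀ s : ℂ, y + s • c ≠ 0) : IsClosed {s : ℂ | y + s • c ∈ M} := by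
  have hcl : {s : ℂ | y + s • c ∈ M} = (fun s : ℂ => y + s • c) ⁻¹' closure M := by
    ext s
    exact ⟨fun hs => subset_closure hs, fun hs => hM.2.2.2.1 _ hs (h s)⟩
  rw [hcl]
  exact isClosed_closure.preimage (by fun_prop)

/-- A nontrivial minimal set has empty interior. -/
theorem IsNontrivialMinimalSet.interior_eq_empty (hM : F.IsNontrivialMinimalSet M) (hn : 2 ≤ n) :
    interior M = ∅ := by
  by_contra hne
  have hne := nonempty_iff_ne_empty.2 hne
  have ho := hM.isOpen_of_interior_nonempty hne
  have hrank : 1 < Module.rank ℝ (Fin (n + 1) → ℂ) := by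
    rw [← Module.finrank_eq_rank]
    have h1 : Module.finrank ℝ (Fin (n + 1) → ℂ) = 2 * (n + 1) := by
      rw [← Module.finrank_mul_finrank ℝ ℂ (Fin (n + 1) → ℂ), Complex.finrank_real_complex,
        Module.finrank_fin_fun]
    rw [h1]
    exact_mod_cast (by lia : 1 < 2 * (n + 1))
  have hc := (isConnected_compl_singleton_of_one_lt_rank hrank
    (0 : Fin (n + 1) → ℂ)).isPreconnected
  obtain ⟨x, hx⟩ := hM.1
  obtain ⟨z, hz, hz'⟩ := F.exists_form_eq_zero hn
  have hsub := hc.subset_of_closure_inter_subset ho ⟨x, hM.2.1 x hx, hx⟩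
    fun y hy => hM.2.2.2.1 y hy.1 hy.2
  exact hM.form_ne_zero (hsub hz) hz'

theorem IsFirstIntegral.exists_nhds_mem_iff (hf : F.IsFirstIntegral f U)
    (hM : F.IsNontrivialMinimalSet M) (hz : z ∈ U) :
    ∃ N ∈ nhds z, ∀ x ∈ N, ∀ y ∈ N, f x = f y → (x ∈ M ↔ y ∈ M) := by
  obtain ⟨N, hN, h⟩ := hf.exists_nhds_plaqueRel hz
  exact ⟨N, hN, fun x hx y hy hxy =>
    hM.mem_iff_of_mem_leaf (Relation.ReflTransGen.single (h x hx y hy hxy))⟩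

theorem tendsto_section {σ : ℂ → ℂ} {a : ℂ} (hσ : ContinuousAt σ a) (h0 : σ a = 0)
    (v : Fin (n + 1) → ℂ) :
    Filter.Tendsto (fun t => z + σ t • v) (nhds a) (nhds z) := by
  have h1 : ContinuousAt (fun t => z + σ t • v) a :=
    continuousAt_const.add (hσ.smul continuousAt_const)
  simpa [ContinuousAt, h0] using h1

/-- A description of a minimal set at one point by a first integral can be transported along
leaves. -/
theorem IsNontrivialMinimalSet.exists_mem_iff_comp (hM : F.IsNontrivialMinimalSet M)
    (hp : p ∈ F.leaf z) (hf : F.IsFirstIntegral f U) (hpU : p ∈ U) (hg : F.IsFirstIntegral g V)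
    (hzV : z ∈ V) {P : ℂ → Prop} (hP : ∀ᶠ x in nhds p, x ∈ M ↔ P (f x)) :
    ∃ ψ, AnalyticAt ℂ ψ (g z) ∧ ψ (g z) = f p ∧ deriv ψ (g z) ≠ 0 ∧
      ∀ᶠ y in nhds z, y ∈ M ↔ P (ψ (g y)) := by
  obtain ⟨v, hv⟩ := hf.exists_form_ne_zero hpU
  obtain ⟨ψ, hψ, hψ0, hψ', he⟩ := GermRel.of_mem_leaf hp g V f U hg hzV hf hpU
  obtain ⟨σ, hσ, hσ0, -, hσ1, -⟩ := hf.exists_section hpU hv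
  refine ⟨ψ, hψ, hψ0, hψ', ?_⟩
  have h1 : Filter.Tendsto (fun y => ψ (g y)) (nhds z) (nhds (f p)) := by
    rw [← hψ0]
    exact hψ.continuousAt.tendsto.comp (hg.differentiableAt z hzV).continuousAt
  have h2 : Filter.Tendsto (fun y => p + σ (ψ (g y)) • v) (nhds z) (nhds p) :=
    (tendsto_section hσ.continuousAt hσ0 v).comp h1
  have h3 : Filter.Tendsto (fun y => (y, p + σ (ψ (g y)) • v)) (nhds z) (nhds (z, p)) := by
    rw [nhds_prod_eq]
    exact Filter.tendsto_id.prodMk h2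
  filter_upwards [h3.eventually he, h1.eventually hσ1, h2.eventually hP] with y hy1 hy2 hy3
  rw [hM.mem_iff_of_mem_leaf (hy1 hy2), hy3, hy2]

theorem IsFirstIntegral.comp_smul (hf : F.IsFirstIntegral f U) {a : ℂ} (ha : a ≠ 0) :
    F.IsFirstIntegral (fun x => f (a • x)) {x | a • x ∈ U} ∧
      ∀ x, a • x ∈ U → ∀ v, fderiv ℂ (fun x => f (a • x)) x v = a * fderiv ℂ f (a • x) v := by
  have hd : ∀ x, a • x ∈ U → HasFDerivAt (fun x => f (a • x))
      ((fderiv ℂ f (a • x)).comp (a • ContinuousLinearMap.id ℂ (Fin (n + 1) → ℂ))) x :=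
    fun x hx => (hf.differentiableAt _ hx).hasFDerivAt.comp x
      ((hasFDerivAt_id x).fun_const_smul a)
  have hd' : ∀ x, a • x ∈ U → ∀ v,
      fderiv ℂ (fun x => f (a • x)) x v = a * fderiv ℂ f (a • x) v := fun x hx v => by
    rw [(hd x hx).fderiv]
    simp
  refine ⟨⟨hf.isOpen.preimage (continuous_const_smul a), ?_, ?_, fun x hx =>
    (hd x hx).differentiableAt, ?_, ?_⟩, hd'⟩
  · rintro x hx rfl
    exact hf.ne_zero _ hx (smul_zero a)
  · intro x hx h
    refine hf.form_ne_zero _ hx ?_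
    ext v
    rw [form_smul_left, h]
    simp
  · intro x hx h
    obtain ⟨v, hv⟩ := DFunLike.ne_iff.1 (hf.fderiv_ne_zero _ hx)
    have h1 := hd' x hx v
    rw [h] at h1
    exact mul_ne_zero ha hv h1.symm
  · intro x hx v hv
    rw [hd' x hx, hf.fderiv_eq_zero _ hx v (by rw [form_smul_left, hv, mul_zero]), mul_zero]

/-- The quotient whose residue at `0` contributes to the index of the minimal set. -/
def indexQuotient (F : ProjFoliation n d) (b c w : Fin (n + 1) → ℂ) (f : (Fin (n + 1) → ℂ) → ℂ)
    (y : Fin (n + 1) → ℂ) (s : ℂ) : ℂ :=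
  F.dform (y + s • c) b c * fderiv ℂ f (y + s • c) w / F.form (y + s • c) w /
    (f (y + s • c) - f y)

theorem IsFirstIntegral.analyticAt_indexFactor (hf : F.IsFirstIntegral f U) (hy : y ∈ U)
    (hw : F.form y w ≠ 0) :
    AnalyticAt ℂ (fun x => F.dform x b c * fderiv ℂ f x w / F.form x w) y :=
  ((analyticAt_dform b c y).mul ((hf.analyticAt hy).fderiv.clm_apply_const w)).div
    (analyticAt_form_apply w y) hw

theorem eventually_line {P : (Fin (n + 1) → ℂ) → Prop} (h : ∀ᶠ x in nhds y, P x)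
    (c : Fin (n + 1) → ℂ) : ∀ᶠ s in nhds (0:ℂ), P (y + s • c) := by
  have h1 : ContinuousAt (fun s : ℂ => y + s • c) 0 := by fun_prop
  rw [ContinuousAt, zero_smul, add_zero] at h1
  exact h1.eventually h

theorem analyticAt_line {h : (Fin (n + 1) → ℂ) → ℂ} (hh : AnalyticAt ℂ h y)
    (c : Fin (n + 1) → ℂ) : AnalyticAt ℂ (fun s : ℂ => h (y + s • c)) 0 :=
  AnalyticAt.fun_comp (f := fun s : ℂ => y + s • c) (g := h) (by simpa using hh) (by fun_prop)

theorem IsFirstIntegral.hasResidue_indexQuotient (hf : F.IsFirstIntegral f U)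
    (hg : F.IsFirstIntegral g V) (hyU : y ∈ U) (hyV : y ∈ V) {w' : Fin (n + 1) → ℂ}
    (hw : F.form y w ≠ 0) (hw' : F.form y w' ≠ 0) (hfl : ¬∀ᶠ s in nhds (0:ℂ), f (y + s • c) = f y)
    {r : ℂ} (h : HasResidue (F.indexQuotient b c w f y) 0 r) :
    HasResidue (F.indexQuotient b c w' g y) 0 r := by
  obtain ⟨κ, hκ, hκ', he⟩ := hg.exists_comp hf hyV hyU
  have hκ2 : AnalyticAt ℂ (fun u => κ (u + f y)) 0 :=
    AnalyticAt.fun_comp (f := fun u => u + f y) (g := κ) (by simpa using hκ) (by fun_prop)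
  obtain ⟨G, hG, hG0, hGe⟩ := hκ2.exists_eq_add_mul
  have hG0' : G 0 ≠ 0 := by
    rw [hG0, deriv_comp_add_const, zero_add]
    exact hκ'
  have hGf : ∀ x, κ (f x) = κ (f y) + (f x - f y) * G (f x - f y) := fun x => by
    have := hGe (f x - f y)
    simpa using this
  have hu : Filter.Tendsto (fun x => f x - f y) (nhds y) (nhds 0) := by
    have := (hf.differentiableAt y hyU).continuousAt.tendsto.sub_const (f y)
    rwa [sub_self] at this
  have hua : AnalyticAt ℂ (fun x => f x - f y) y := (hf.analyticAt hyU).sub analyticAt_const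
  have hquot : AnalyticAt ℂ (fun u => deriv G u / G u) 0 := hG.deriv.div hG hG0'
  have hcor : AnalyticAt ℂ (fun x => F.dform x b c * fderiv ℂ f x w / F.form x w *
      (deriv G (f x - f y) / G (f x - f y))) y :=
    (hf.analyticAt_indexFactor hyU hw).mul
      (AnalyticAt.fun_comp (f := fun x => f x - f y) (g := fun u => deriv G u / G u)
        (by simpa using hquot) hua)
  refine h.add_analyticAt (analyticAt_line hcor c) ?_
  have hfne : ∀ᶠ s in nhdsWithin (0:ℂ) {0}ᶜ, f (y + s • c) ≠ f y :=
    ((analyticAt_line (hf.analyticAt hyU) c).eventually_eq_or_eventually_ne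
      analyticAt_const).resolve_left hfl
  have hnear : ∀ᶠ x in nhds y, F.form x w ≠ 0 ∧ F.form x w' ≠ 0 ∧ x ∈ U ∧ G (f x - f y) ≠ 0 ∧
      g x = κ (f x) ∧
      fderiv ℂ g x w' = fderiv ℂ f x w' * (G (f x - f y) + (f x - f y) * deriv G (f x - f y)) := by
    filter_upwards [(analyticAt_form_apply w y).continuousAt.eventually_ne hw,
      (analyticAt_form_apply w' y).continuousAt.eventually_ne hw', hf.isOpen.mem_nhds hyU,
      hu.eventually (hG.continuousAt.eventually_ne hG0'), he.eventually_nhds,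
      hu.eventually hG.eventually_analyticAt] with x h1 h2 h3 h4 h5 h6
    refine ⟨h1, h2, h3, h4, h5.self_of_nhds, ?_⟩
    have h7 : g =ᶠ[nhds x] fun x => κ (f y) + (f x - f y) * G (f x - f y) :=
      h5.mono fun x hx => hx.trans (hGf x)
    have h8 := (hf.differentiableAt x h3).hasFDerivAt.sub_const (f y)
    have h9 : HasFDerivAt (fun x => G (f x - f y)) (deriv G (f x - f y) • fderiv ℂ f x) x :=
      h6.differentiableAt.hasDerivAt.comp_hasFDerivAt x h8
    rw [h7.fderiv_eq, ((h8.fun_mul h9).const_add (κ (f y))).fderiv]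
    simp only [add_apply, smul_apply,
      smul_eq_mul]
    ring
  filter_upwards [hfne, (eventually_line hnear c).filter_mono nhdsWithin_le_nhds] with s h1 h2
  obtain ⟨h3, h4, h5, h6, h7, h8⟩ := h2
  rw [indexQuotient, indexQuotient, h7, he.self_of_nhds, h8, hGf]
  have h9 := hf.fderiv_mul h5 w w'
  set x := y + s • c
  have h10 : f x - f y ≠ 0 := sub_ne_zero.2 h1
  have h11 : fderiv ℂ f x w' = F.form x w' * fderiv ℂ f x w / F.form x w := by
    rw [eq_div_iff h3, ← h9, mul_comm]
  rw [h11, add_sub_cancel_left]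
  field_simp

end

end ProjFoliation

namespace ProjFoliation

section

variable {n d : ℕ} {F : ProjFoliation n d} {M : Set (Fin (n + 1) → ℂ)}
  {b c p v w y z : Fin (n + 1) → ℂ} {f g : (Fin (n + 1) → ℂ) → ℂ} {U V : Set (Fin (n + 1) → ℂ)}

/-- The minimal set is locally a single leaf. -/
def IsLocallyPlaque (F : ProjFoliation n d) (M : Set (Fin (n + 1) → ℂ)) : Prop :=
  ∀ z ∈ M, ∀ g V, F.IsFirstIntegral g V → z ∈ V → ∀ᶠ y in nhds z, y ∈ M ↔ g y = g z

theorem IsLocallyPlaque.not_eventually_line (h : F.IsLocallyPlaque M)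
    (hM : F.IsNontrivialMinimalSet M) (hc0 : c ≠ 0) (hc : c ∉ M) (hy : y ∈ M) :
    ¬∀ᶠ s in nhds (0:ℂ), y + s • c ∈ M := by
  intro hev
  have hne : ∀ s : ℂ, y + s • c ≠ 0 := fun s hs => by
    have hs0 : s ≠ 0 := by
      rintro rfl
      exact hM.2.1 y hy (by simpa using hs)
    refine hc ?_
    have h1 : c = (-s⁻¹) • y := by
      rw [eq_neg_of_add_eq_zero_left hs, smul_neg, neg_smul, neg_neg, inv_smul_smul₀ hs0]
    rw [h1]
    exact hM.2.2.1 _ (neg_ne_zero.2 (inv_ne_zero hs0)) _ hy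
  have hcl := hM.isClosed_line hne
  have hsub : closure (interior {s : ℂ | y + s • c ∈ M}) ⊆ interior {s : ℂ | y + s • c ∈ M} := by
    intro s hs
    have hsM : y + s • c ∈ M := hcl.closure_subset_iff.2 interior_subset hs
    obtain ⟨V, g, hg, hsV, -⟩ := exists_firstIntegral (hM.2.1 _ hsM) (hM.form_ne_zero hsM)
    have h1 := h _ hsM g V hg hsV
    have hcont : ContinuousAt (fun t : ℂ => y + t • c) s := by fun_prop
    have ha : AnalyticAt ℂ (fun t : ℂ => g (y + t • c)) s :=
      AnalyticAt.fun_comp (f := fun t : ℂ => y + t • c) (g := g) (hg.analyticAt hsV) (by fun_prop)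
    have h2 : ∀ᶠ t in nhds s, y + t • c ∈ M ↔ g (y + t • c) = g (y + s • c) := hcont.eventually h1
    rcases ha.eventually_eq_or_eventually_ne (analyticAt_const (v := g (y + s • c))) with h3 | h3
    · have h4 : s ∈ interior {s : ℂ | y + s • c ∈ M} := by
        refine mem_interior_iff_mem_nhds.2 ?_
        filter_upwards [h2, h3] with t ht1 ht2 using ht1.2 ht2
      exact h4
    · by_contra hsi
      have h5 : ∀ᶠ t in nhds s, t ∉ interior {s : ℂ | y + s • c ∈ M} := by
        rw [eventually_nhdsWithin_iff] at h3
        filter_upwards [h2, h3] with t ht1 ht2 ht3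
        have ht4 : t ∈ {s : ℂ | y + s • c ∈ M} := interior_subset ht3
        refine ht2 ?_ (ht1.1 ht4)
        rintro rfl
        exact hsi ht3
      exact mem_closure_iff_frequently.1 hs h5
  have hclopen : IsClopen (interior {s : ℂ | y + s • c ∈ M}) :=
    ⟨closure_subset_iff_isClosed.1 hsub, isOpen_interior⟩
  have h0 : (0:ℂ) ∈ interior {s : ℂ | y + s • c ∈ M} := mem_interior_iff_mem_nhds.2 hev
  have huniv := hclopen.eq_univ ⟨0, h0⟩
  have hall : ∀ s : ℂ, s ∈ {s : ℂ | y + s • c ∈ M} := fun s =>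
    interior_subset (huniv.symm ▸ mem_univ s)
  refine hc (hM.2.2.2.1 c ?_ hc0)
  have h6 : Filter.Tendsto (fun u : ℂ => u • y + c) (nhdsWithin 0 {0}ᶜ) (nhds c) := by
    have : ContinuousAt (fun u : ℂ => u • y + c) 0 := by fun_prop
    have := this.tendsto.mono_left (nhdsWithin_le_nhds (s := {0}ᶜ))
    simpa using this
  refine mem_closure_of_tendsto h6 ?_
  filter_upwards [self_mem_nhdsWithin] with u hu
  have h7 : u • y + c = u • (y + u⁻¹ • c) := by
    rw [smul_add, smul_inv_smul₀ hu]
  rw [h7]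
  exact hM.2.2.1 u hu _ (hall _)

/-- The residue of `indexQuotient`. -/
def indexResidue (F : ProjFoliation n d) (b c y : Fin (n + 1) → ℂ) : ℂ :=
  Classical.epsilon fun r => ∃ f U w, F.IsFirstIntegral f U ∧ y ∈ U ∧ F.form y w ≠ 0 ∧
    HasResidue (F.indexQuotient b c w f y) 0 r

theorem IsFirstIntegral.hasResidue_indexResidue (hf : F.IsFirstIntegral f U) (hy : y ∈ U)
    (hw : F.form y w ≠ 0)
    (hfl : ∀ f U, F.IsFirstIntegral f U → y ∈ U → ¬∀ᶠ s in nhds (0:ℂ), f (y + s • c) = f y) :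
    HasResidue (F.indexQuotient b c w f y) 0 (F.indexResidue b c y) := by
  have hmer : MeromorphicAt (F.indexQuotient b c w f y) 0 :=
    (analyticAt_line (hf.analyticAt_indexFactor hy hw) c).meromorphicAt.div
      ((analyticAt_line (hf.analyticAt hy) c).sub analyticAt_const).meromorphicAt
  obtain ⟨r, hr⟩ := hmer.exists_hasResidue
  obtain ⟨f', U', w', hf', hy', hw', h⟩ := Classical.epsilon_spec
    (p := fun r => ∃ f U w, F.IsFirstIntegral f U ∧ y ∈ U ∧ F.form y w ≠ 0 ∧
      HasResidue (F.indexQuotient b c w f y) 0 r) ⟨r, f, U, w, hf, hy, hw, hr⟩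
  exact hf'.hasResidue_indexQuotient hf hy' hy hw' hw (hfl _ _ hf' hy') h

theorem IsLocallyPlaque.not_eventually_eq (h : F.IsLocallyPlaque M)
    (hM : F.IsNontrivialMinimalSet M) (hc0 : c ≠ 0) (hc : c ∉ M) (hy : y ∈ M)
    (hf : F.IsFirstIntegral f U) (hyU : y ∈ U) : ¬∀ᶠ s in nhds (0:ℂ), f (y + s • c) = f y := by
  intro he
  refine h.not_eventually_line hM hc0 hc hy ?_
  filter_upwards [he, eventually_line (h y hy f U hf hyU) c] with s h1 h2 using h2.2 h1

theorem IsLocallyPlaque.isResidueCone_indexResidue (h : F.IsLocallyPlaque M)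
    (hM : F.IsNontrivialMinimalSet M) (hc0 : c ≠ 0) (hc : c ∉ M) (b : Fin (n + 1) → ℂ) :
    IsResidueCone M c 1 (F.indexResidue b c) where
  isCone := hM.2.2.1
  isClosed := hM.2.2.2.1
  ne_zero := hc0
  notMem := hc
  smul a ha y hy := by
    have hay := hM.2.2.1 a ha y hy
    obtain ⟨U, f, hf, hyU, -⟩ := exists_firstIntegral (hM.2.1 _ hay) (hM.form_ne_zero hay)
    obtain ⟨w, hw⟩ := hf.exists_form_ne_zero hyU
    have hw' : F.form y w ≠ 0 := fun h => hw (by rw [form_smul_left, h, mul_zero])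
    obtain ⟨hfa, hfa'⟩ := hf.comp_smul ha
    have h1 := hf.hasResidue_indexResidue (b := b) hyU hw fun f U hf hU =>
      h.not_eventually_eq hM hc0 hc hay hf hU
    have h2 := hfa.hasResidue_indexResidue (b := b) hyU hw' fun f U hf hU =>
      h.not_eventually_eq hM hc0 hc hy hf hU
    have h3 := (h1.comp_mul ha).const_mul (a ^ 2)
    have h4 := h2.unique (h3.congr ?_)
    · rw [h4]
      field_simp
    · have h5 := eventually_line ((hfa.isOpen.mem_nhds hyU : ∀ᶠ x in nhds y, a • x ∈ U)) c
      filter_upwards [h5.filter_mono nhdsWithin_le_nhds] with s hs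
      rw [indexQuotient, indexQuotient, hfa' _ hs]
      have h6 : a • y + (a * s) • c = a • (y + s • c) := by
        rw [smul_add, smul_smul]
      rw [h6, form_smul_left, dform_smul_left]
      have h7 : a ^ d * F.dform (y + s • c) b c * fderiv ℂ f (a • (y + s • c)) w /
          (a ^ (d + 1) * F.form (y + s • c) w) = a⁻¹ * (F.dform (y + s • c) b c *
            fderiv ℂ f (a • (y + s • c)) w / F.form (y + s • c) w) := by
        rw [pow_succ, inv_mul_eq_div, div_div, mul_assoc, mul_assoc,
          mul_div_mul_left _ _ (pow_ne_zero d ha), mul_comm a]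
      rw [h7]
      field_simp
  residue y hy := by
    obtain ⟨U, f, hf, hyU, -⟩ := exists_firstIntegral (hM.2.1 _ hy) (hM.form_ne_zero hy)
    obtain ⟨w, hw⟩ := hf.exists_form_ne_zero hyU
    refine ⟨_, fun x => f x - f y, hf.analyticAt_indexFactor (b := b) (c := c) hyU hw,
      (hf.analyticAt hyU).sub analyticAt_const, ?_, ?_⟩
    · simp only [sub_eq_zero]
      exact h.not_eventually_eq hM hc0 hc hy hf hyU
    · filter_upwards [h y hy f U hf hyU, hf.isOpen.mem_nhds hyU,
        (analyticAt_form_apply w y).continuousAt.eventually_ne hw] with x hx hxU hxw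
      refine ⟨by rw [hx, sub_eq_zero], fun hxM => ?_⟩
      rw [← hx.1 hxM]
      exact hf.hasResidue_indexResidue hxU hxw fun f U hf hU =>
        h.not_eventually_eq hM hc0 hc hxM hf hU

theorem IsLocallyPlaque.exists_indexResidue_eq (h : F.IsLocallyPlaque M)
    (hM : F.IsNontrivialMinimalSet M) (hc0 : c ≠ 0) (hc : c ∉ M) {s : ℂ}
    (hs : b + s • c ∈ M) :
    ∃ m : ℕ, m ≠ 0 ∧ F.indexResidue b c (b + s • c) = (m : ℂ) := by
  set y := b + s • c with hy
  obtain ⟨U, f, hf, hyU, -⟩ := exists_firstIntegral (hM.2.1 _ hs) (hM.form_ne_zero hs)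
  obtain ⟨w, hw⟩ := hf.exists_form_ne_zero hyU
  have hfl := h.not_eventually_eq hM hc0 hc hs hf hyU
  have h1 := hf.hasResidue_indexResidue (b := b) hyU hw fun f U hf hU =>
    h.not_eventually_eq hM hc0 hc hs hf hU
  have ha : AnalyticAt ℂ (fun u : ℂ => f (y + u • c) - f y) 0 :=
    (analyticAt_line (hf.analyticAt hyU) c).sub analyticAt_const
  have hfl' : ¬∀ᶠ u in nhds (0:ℂ), f (y + u • c) - f y = 0 := by
    simpa only [sub_eq_zero] using hfl
  have h2 := hasResidue_mul_deriv_div (s := 0) (A := fun _ => (d:ℂ) + 2) analyticAt_const ha hfl'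
  refine ⟨analyticOrderNatAt (fun u : ℂ => f (y + u • c) - f y) 0 * (d + 2), ?_, ?_⟩
  · refine mul_ne_zero ?_ (by positivity)
    intro h0
    have h3 : analyticOrderAt (fun u : ℂ => f (y + u • c) - f y) 0 ≠ ⊤ := fun h =>
      hfl' (analyticOrderAt_eq_top.1 h)
    have h4 := Nat.cast_analyticOrderNatAt h3
    rw [h0, Nat.cast_zero] at h4
    refine ha.analyticOrderAt_eq_zero.1 h4.symm ?_
    simp
  · have h5 := h1.unique (h2.congr ?_)
    · rw [h5]
      push_cast
      ring
    · have h6 : ∀ᶠ x in nhds y, x ∈ U ∧ F.form x w ≠ 0 := (hf.isOpen.mem_nhds hyU : _ ∈ nhds y)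
        |> Filter.Eventually.and <|
          (analyticAt_form_apply w y).continuousAt.eventually_ne hw
      filter_upwards [(eventually_line h6 c).filter_mono nhdsWithin_le_nhds] with u hu
      obtain ⟨huU, huw⟩ := hu
      have hd : HasDerivAt (fun u : ℂ => f (y + u • c) - f y) (fderiv ℂ f (y + u • c) c) u := by
        have h7 : HasDerivAt (fun s : ℂ => y + s • c) c u := by
          simpa using ((hasDerivAt_id' u).smul_const c).const_add y
        exact ((hf.differentiableAt _ huU).hasFDerivAt.comp_hasDerivAt u h7).sub_const _
      have h8 : F.dform (y + u • c) b c = (d + 2) * F.form (y + u • c) c := by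
        rw [← dform_self_left]
        have h9 : b = (y + u • c) - (s + u) • c := by
          rw [hy]
          module
        have h10 : F.dform (y + u • c) c c = 0 := by simp [dform]
        have h11 : ∀ z t : Fin (n + 1) → ℂ, ∀ e : ℂ,
            F.dform z (t - e • c) c = F.dform z t c - e * F.dform z c c := fun z t e => by
          simp only [dform, map_sub, map_smul, sub_apply, smul_apply, smul_eq_mul]
          ring
        rw [h9, h11, h10]
        ring
      rw [indexQuotient, h8, hd.deriv]
      congr 1
      rw [div_eq_iff huw]
      linear_combination ((d:ℂ) + 2) * hf.fderiv_mul huU c w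

theorem IsNontrivialMinimalSet.not_isLocallyPlaque (hM : F.IsNontrivialMinimalSet M)
    (hn : 2 ≤ n) : ¬F.IsLocallyPlaque M := by
  intro h
  obtain ⟨c, hc0, hc⟩ : ∃ c, c ≠ 0 ∧ c ∉ M := by
    by_contra! hall
    have h1 : ({0}ᶜ : Set (Fin (n + 1) → ℂ)) ⊆ interior M :=
      interior_maximal (fun x hx => hall x hx) isOpen_compl_singleton
    rw [hM.interior_eq_empty hn] at h1
    obtain ⟨x, hx⟩ := exists_ne (0 : Fin (n + 1) → ℂ)
    exact h1 hx
  obtain ⟨b, hb⟩ := hM.1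
  obtain ⟨e, he⟩ := exists_not_mem_span_pair hn b c
  have hind : ∀ x₀ x₁ s : ℂ, x₀ • b + x₁ • e + s • c = 0 → x₀ = 0 ∧ x₁ = 0 := fun x₀ x₁ s h => by
    have h1 : x₁ = 0 := by
      by_contra h1
      refine he (Submodule.mem_span_pair.2 ⟨-(x₁⁻¹ * x₀), -(x₁⁻¹ * s), ?_⟩)
      have h2 : e = x₁⁻¹ • (x₁ • e) := (inv_smul_smul₀ h1 e).symm
      have h3 : x₁ • e = -(x₀ • b) - s • c := by linear_combination (exp := 1) h
      rw [h2, h3]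
      module
    refine ⟨?_, h1⟩
    by_contra h0
    rw [h1, zero_smul, add_zero] at h
    have hs : s ≠ 0 := by
      rintro rfl
      rw [zero_smul, add_zero] at h
      exact hM.2.1 b hb ((smul_eq_zero.1 h).resolve_left h0)
    refine hc ?_
    have h2 : c = (-(s⁻¹ * x₀)) • b := by
      rw [neg_smul, mul_smul, eq_neg_of_add_eq_zero_left h, smul_neg, neg_neg, inv_smul_smul₀ hs]
    rw [h2]
    exact hM.2.2.1 _ (neg_ne_zero.2 (mul_ne_zero (inv_ne_zero hs) h0)) _ hb
  obtain ⟨hfin, hsum⟩ :=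
    (h.isResidueCone_indexResidue hM hc0 hc b).trace_eq_zero one_ne_zero hind
  have hm : ∀ s : ℂ, ∃ m : ℕ, b + s • c ∈ M →
      m ≠ 0 ∧ F.indexResidue b c (b + s • c) = (m : ℂ) := fun s => by
    by_cases hs : b + s • c ∈ M
    · obtain ⟨m, h1, h2⟩ := h.exists_indexResidue_eq hM hc0 hc hs
      exact ⟨m, fun _ => ⟨h1, h2⟩⟩
    · exact ⟨0, fun h => absurd h hs⟩
  choose m hm using hm
  have hsum' : ∑ s ∈ hfin.toFinset, F.indexResidue b c (b + s • c) = 0 :=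
    (finsum_mem_eq_finite_toFinset_sum _ hfin).symm.trans hsum
  rw [Finset.sum_congr rfl fun s hs => (hm s (hfin.mem_toFinset.1 hs)).2, ← Nat.cast_sum,
    Nat.cast_eq_zero, Finset.sum_eq_zero_iff] at hsum'
  have h0 : b + (0:ℂ) • c ∈ M := by simpa using hb
  exact (hm 0 h0).1 (hsum' 0 (hfin.mem_toFinset.2 h0))

/-- The trace of a nontrivial minimal set on a transversal has no isolated points. -/
theorem IsNontrivialMinimalSet.frequently_mem (hM : F.IsNontrivialMinimalSet M) (hn : 2 ≤ n)
    (hp : p ∈ M) (hv : F.form p v ≠ 0) :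
    ∃ᶠ s in nhdsWithin (0:ℂ) {0}ᶜ, p + s • v ∈ M := by
  intro hiso
  refine hM.not_isLocallyPlaque hn fun z hz g V hg hzV => ?_
  obtain ⟨U, f, hf, hpU, -⟩ := exists_firstIntegral (hM.2.1 p hp) (hM.form_ne_zero hp)
  obtain ⟨N, hN, hNl⟩ := hf.exists_nhds_plaqueRel hpU
  obtain ⟨σ, hσ, hσ0, -, hσ1, -⟩ := hf.exists_section hpU hv
  have hf0 := (hf.differentiableAt p hpU).continuousAt
  have hiff : ∀ᶠ x in nhds p, x ∈ M ↔ f x = f p := by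
    have h1 := (tendsto_section (z := p) hσ.continuousAt hσ0 v).comp hf0.tendsto
    rw [eventually_nhdsWithin_iff] at hiso
    have h2 : Filter.Tendsto (fun x => σ (f x)) (nhds p) (nhds 0) := by
      rw [← hσ0]
      exact hσ.continuousAt.tendsto.comp hf0.tendsto
    filter_upwards [hN, h1.eventually_mem hN, hf0.eventually hσ1, h2.eventually hiso]
      with x h3 h4 h5 h6
    have hxM : x ∈ M ↔ p + σ (f x) • v ∈ M :=
      hM.mem_iff_of_mem_leaf (Relation.ReflTransGen.single (hNl _ h3 _ h4 h5.symm))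
    refine ⟨fun hx => ?_, fun hx => ?_⟩
    · by_contra hne
      refine h6 (fun h0 => hne ?_) (hxM.1 hx)
      have h0 : σ (f x) = 0 := h0
      rw [← h5, h0, zero_smul, add_zero]
    · rw [hxM, hx, hσ0, zero_smul, add_zero]
      exact hp
  obtain ⟨y, hy, hyl⟩ := mem_closure_iff_nhds.1 (hM.subset_closure_leaf hz hp) _
    (Filter.inter_mem hN hiff)
  have hyM : y ∈ M := hM.2.2.2.2.1 z hz hyl
  have hpl : p ∈ F.leaf z := mem_leaf_trans hyl (Relation.ReflTransGen.single
    (hNl _ hy.1 _ (mem_of_mem_nhds hN) (hy.2.1 hyM)))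
  obtain ⟨ψ, hψ, hψ0, hψ', he⟩ := hM.exists_mem_iff_comp (P := fun t => t = f p) hpl hf hpU hg
    hzV hiff
  have hg0 := (hg.differentiableAt z hzV).continuousAt
  have hinj := hψ.eventually_eq_iff hψ'
  have hpair : Filter.Tendsto (fun y => (g y, g z)) (nhds z) (nhds (g z, g z)) := by
    rw [nhds_prod_eq]
    exact hg0.tendsto.prodMk tendsto_const_nhds
  filter_upwards [he, hpair.eventually hinj] with y h1 h2
  rw [h1, ← hψ0, h2]

end

end ProjFoliation

section

variable {m : ℕ} {G : (Fin m → ℂ) → ℂ} {q : Fin m → ℂ}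

theorem AnalyticAt.analyticAt_im (hG : AnalyticAt ℂ G q) : AnalyticAt ℝ (fun x => (G x).im) q :=
  AnalyticAt.fun_comp (f := G) (g := fun z : ℂ => z.im) (Complex.imCLM.analyticAt _)
    hG.restrictScalars

theorem DifferentiableAt.fderiv_im_apply (hG : DifferentiableAt ℂ G q) (w : Fin m → ℂ) :
    fderiv ℝ (fun x => (G x).im) q w = (fderiv ℂ G q w).im := by
  have h : HasFDerivAt (fun x => (G x).im)
      (Complex.imCLM.comp ((fderiv ℂ G q).restrictScalars ℝ)) q :=
    Complex.imCLM.hasFDerivAt.comp q (hG.hasFDerivAt.restrictScalars ℝ)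
  rw [h.fderiv]
  rfl

theorem fderiv_im_ne_zero (hG : DifferentiableAt ℂ G q) (h : fderiv ℂ G q ≠ 0) :
    fderiv ℝ (fun x => (G x).im) q ≠ 0 := by
  obtain ⟨w, hw⟩ := DFunLike.ne_iff.1 h
  have hw : fderiv ℂ G q w ≠ 0 := hw
  intro h0
  have h1 := hG.fderiv_im_apply ((Complex.I * (fderiv ℂ G q w)⁻¹) • w)
  rw [(fderiv ℂ G q).map_smul, smul_eq_mul, mul_assoc, inv_mul_cancel₀ hw, h0] at h1
  simp at h1

theorem AnalyticAt.iteratedFDeriv_two_im (hG : AnalyticAt ℂ G q) (u w : Fin m → ℂ) :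
    iteratedFDeriv ℝ 2 (fun x => (G x).im) q ![u, w] =
      (fderiv ℂ (fun x => fderiv ℂ G x w) q u).im := by
  rw [iteratedFDeriv_two_apply]
  change fderiv ℝ (fderiv ℝ fun x => (G x).im) q u w = _
  have h1 : DifferentiableAt ℝ (fderiv ℝ fun x => (G x).im) q :=
    hG.analyticAt_im.fderiv.differentiableAt
  have h2 : HasFDerivAt (fun x => fderiv ℝ (fun x => (G x).im) x w)
      ((ContinuousLinearMap.apply ℝ ℝ w).comp (fderiv ℝ (fderiv ℝ fun x => (G x).im) q)) q :=
    (ContinuousLinearMap.apply ℝ ℝ w).hasFDerivAt.comp q h1.hasFDerivAt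
  have h3 : (fun x => fderiv ℝ (fun x => (G x).im) x w) =ᶠ[nhds q]
      fun x => (fderiv ℂ G x w).im := by
    filter_upwards [hG.eventually_analyticAt] with x hx
    exact hx.differentiableAt.fderiv_im_apply w
  have h4 := h3.fderiv_eq (𝕜 := ℝ)
  rw [h2.fderiv] at h4
  have h5 := (hG.fderiv.clm_apply_const w).differentiableAt.fderiv_im_apply u
  rw [← h5, ← h4]
  rfl

/-- The imaginary part of a holomorphic function is pluriharmonic. -/
theorem AnalyticAt.leviForm_im (hG : AnalyticAt ℂ G q) (w : Fin m → ℂ) :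
    leviForm (fun x => (G x).im) q w = 0 := by
  rw [leviForm, hG.iteratedFDeriv_two_im, hG.iteratedFDeriv_two_im]
  have h1 : (fun x => fderiv ℂ G x (Complex.I • w)) =
      fun x => Complex.I • fderiv ℂ G x w := by
    ext x
    rw [map_smul]
  rw [h1, fderiv_fun_const_smul (hG.fderiv.clm_apply_const w).differentiableAt, smul_apply,
    map_smul, smul_smul, Complex.I_mul_I, neg_one_smul, Complex.neg_im, add_neg_cancel]

theorem isAnalyticLeviFlatHypersurface_of_im {M : Set (Fin m → ℂ)}
    (h : ∀ z ∈ M, ∃ G : (Fin m → ℂ) → ℂ, AnalyticAt ℂ G z ∧ fderiv ℂ G z ≠ 0 ∧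
      ∀ᶠ x in nhds z, x ∈ M ↔ (G x).im = 0) :
    IsAnalyticLeviFlatHypersurface M := by
  intro z hz
  obtain ⟨G, hG, hG', hGM⟩ := h z hz
  obtain ⟨V, hV, hVo, hzV⟩ := eventually_nhds_iff.1 (hG.eventually_analyticAt.and
    ((hG.fderiv.continuousAt.eventually_ne hG').and hGM))
  exact ⟨V, hVo, hzV, fun x => (G x).im, fun q hq => (hV q hq).1.analyticAt_im,
    fun q hq => fderiv_im_ne_zero (hV q hq).1.differentiableAt (hV q hq).2.1,
    fun q hq => (hV q hq).2.2, fun q hq _ w _ => (hV q hq).1.leviForm_im w⟩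

end

namespace ProjFoliation

section

variable {n d : ℕ} {F : ProjFoliation n d} {M : Set (Fin (n + 1) → ℂ)}
  {p v z : Fin (n + 1) → ℂ} {f g : (Fin (n + 1) → ℂ) → ℂ} {U V : Set (Fin (n + 1) → ℂ)}

theorem IsHolonomyAt.mem_iff {r : ℝ} {h : ℂ → ℂ} (hh : F.IsHolonomyAt p v r h)
    (hM : F.IsNontrivialMinimalSet M) {s : ℂ} (hs : s ∈ Metric.ball (0:ℂ) r) :
    p + s • v ∈ M ↔ p + h s • v ∈ M := by
  obtain ⟨γ, -, -, -, -, H, -, -, h1, h2⟩ := hh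
  have h3 := h2 1 ⟨zero_le_one, le_rfl⟩ s hs
  rw [(h1 s hs).2] at h3
  exact hM.mem_iff_of_mem_leaf h3

theorem add_smul_ne_zero (hp : p ≠ 0) (hv : F.form p v ≠ 0) (s : ℂ) : p + s • v ≠ 0 := by
  intro h
  have h1 := congrArg (F.form p) h
  rw [map_add, map_smul, form_self, zero_add, map_zero, smul_eq_mul] at h1
  rw [(mul_eq_zero.1 h1).resolve_right hv, zero_smul, add_zero] at h
  exact hp h

theorem IsNontrivialMinimalSet.not_eventually_line_mem (hM : F.IsNontrivialMinimalSet M)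
    (hn : 2 ≤ n) (hz : z ≠ 0) (hv : F.form z v ≠ 0) :
    ¬∀ᶠ s in nhds (0:ℂ), z + s • v ∈ M := by
  intro h
  have hz' : F.form z ≠ 0 := fun h => hv (by rw [h]; rfl)
  obtain ⟨U, f, hf, hzU, -⟩ := exists_firstIntegral hz hz'
  obtain ⟨N, hN, hNl⟩ := hf.exists_nhds_mem_iff hM hzU
  obtain ⟨σ, hσ, hσ0, -, hσ1, -⟩ := hf.exists_section hzU hv
  have hf0 := (hf.differentiableAt z hzU).continuousAt
  have h1 := (tendsto_section (z := z) hσ.continuousAt hσ0 v).comp hf0.tendsto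
  have h2 : Filter.Tendsto (fun x => σ (f x)) (nhds z) (nhds 0) := by
    rw [← hσ0]
    exact hσ.continuousAt.tendsto.comp hf0.tendsto
  have h3 : z ∈ interior M := by
    refine mem_interior_iff_mem_nhds.2 ?_
    filter_upwards [hN, h1.eventually_mem hN, hf0.eventually hσ1, h2.eventually h] with x a b c e
    exact (hNl _ a _ b c.symm).2 e
  rw [hM.interior_eq_empty hn] at h3
  exact h3

theorem IsFirstIntegral.exists_transverse_coordinate (hf : F.IsFirstIntegral f U) (hp : p ∈ U)
    (hM : F.IsNontrivialMinimalSet M) (hv : F.form p v ≠ 0) {φ τ : ℂ → ℂ} {K : Set ℂ}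
    (hφ : AnalyticAt ℂ φ 0) (hφ0 : φ 0 = 0) (hφ' : deriv φ 0 ≠ 0)
    (hτφ : ∀ᶠ s in nhds (0:ℂ), τ (φ s) = s)
    (hK : ∀ᶠ t in nhds (0:ℂ), t ∈ K ↔ p + τ t • v ∈ M) :
    ∃ β, AnalyticAt ℂ β (f p) ∧ β (f p) = 0 ∧ deriv β (f p) ≠ 0 ∧
      ∀ᶠ x in nhds p, x ∈ M ↔ β (f x) ∈ K := by
  obtain ⟨σ, hσ, hσ0, hσ', hσ1, -⟩ := hf.exists_section hp hv
  obtain ⟨N, hN, hNl⟩ := hf.exists_nhds_mem_iff hM hp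
  have hf0 := (hf.differentiableAt p hp).continuousAt
  have hφσ : AnalyticAt ℂ φ (σ (f p)) := by rwa [hσ0]
  have h1 := (tendsto_section (z := p) hσ.continuousAt hσ0 v).comp hf0.tendsto
  have h2 : Filter.Tendsto (fun x => σ (f x)) (nhds p) (nhds 0) := by
    rw [← hσ0]
    exact hσ.continuousAt.tendsto.comp hf0.tendsto
  have h3 : Filter.Tendsto (fun x => φ (σ (f x))) (nhds p) (nhds 0) := by
    have := hφ.continuousAt.tendsto.comp h2
    rwa [hφ0] at this
  refine ⟨fun t => φ (σ t), AnalyticAt.fun_comp (g := φ) hφσ hσ, by simp only [hσ0, hφ0], ?_, ?_⟩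
  · have := (hφσ.differentiableAt.hasDerivAt.comp _ hσ.differentiableAt.hasDerivAt).deriv
    change deriv (φ ∘ σ) _ ≠ 0
    rw [this, hσ0]
    exact mul_ne_zero hφ' hσ'
  · filter_upwards [hN, h1.eventually_mem hN, hf0.eventually hσ1, h2.eventually hτφ,
      h3.eventually hK] with x a b c e k
    rw [k, e]
    exact hNl _ a _ b c.symm

/-- If the trace of a minimal set on a transversal is a real analytic curve, the minimal set is a
Levi-flat hypersurface. -/
theorem IsNontrivialMinimalSet.isAnalyticLeviFlatHypersurface (hM : F.IsNontrivialMinimalSet M)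
    (hp : p ∈ M) (hf : F.IsFirstIntegral f U) (hpU : p ∈ U) {χ : ℂ → ℂ}
    (hχ : AnalyticAt ℂ χ (f p)) (hχ' : deriv χ (f p) ≠ 0)
    (h : ∀ᶠ x in nhds p, x ∈ M ↔ (χ (f x)).im = 0) : IsAnalyticLeviFlatHypersurface M := by
  refine isAnalyticLeviFlatHypersurface_of_im fun z hz => ?_
  obtain ⟨V, g, hg, hzV, -⟩ := exists_firstIntegral (hM.2.1 z hz) (hM.form_ne_zero hz)
  have hf0 := (hf.differentiableAt p hpU).continuousAt
  have hev := (h.eventually_nhds.and (hf.isOpen.mem_nhds hpU)).and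
    (hf0.eventually (hχ.eventually_analyticAt.and (hχ.deriv.continuousAt.eventually_ne hχ')))
  obtain ⟨y, ⟨⟨hy, hyU⟩, hy1, hy2⟩, hyl⟩ := mem_closure_iff_nhds.1 (hM.subset_closure_leaf hz hp)
    _ hev
  obtain ⟨ψ, hψ, hψ0, hψ', he⟩ := hM.exists_mem_iff_comp (P := fun t => (χ t).im = 0) hyl hf hyU
    hg hzV hy
  rw [← hψ0] at hy1 hy2
  have hga := hg.analyticAt hzV
  have hχψ : AnalyticAt ℂ (fun t => χ (ψ t)) (g z) := AnalyticAt.fun_comp (g := χ) hy1 hψ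
  refine ⟨fun x => χ (ψ (g x)), AnalyticAt.fun_comp (g := fun t => χ (ψ t)) hχψ hga, ?_, he⟩
  have h1 : HasDerivAt (fun t => χ (ψ t)) (deriv χ (ψ (g z)) * deriv ψ (g z)) (g z) :=
    hy1.differentiableAt.hasDerivAt.comp _ hψ.differentiableAt.hasDerivAt
  have h2 : HasFDerivAt (fun x => χ (ψ (g x)))
      ((deriv χ (ψ (g z)) * deriv ψ (g z)) • fderiv ℂ g z) z :=
    h1.comp_hasFDerivAt z hga.differentiableAt.hasFDerivAt
  rw [h2.fderiv]
  exact smul_ne_zero (mul_ne_zero hy2 hψ') (hg.fderiv_ne_zero z hzV)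

theorem IsNontrivialMinimalSet.isAnalyticLeviFlatHypersurface_of_not_linear
    (hM : F.IsNontrivialMinimalSet M) (hn : 2 ≤ n) (hp : p ∈ M) (hv : F.form p v ≠ 0) {r : ℝ}
    (hr : 0 < r) {h : ℂ → ℂ} (hh : DifferentiableOn ℂ h (Metric.ball 0 r)) (h0 : h 0 = 0)
    (hl0 : deriv h 0 ≠ 0) (hl1 : ‖deriv h 0‖ < 1) (hhol : F.IsHolonomyAt p v r h)
    {φ : ℂ → ℂ} (hφ : AnalyticAt ℂ φ 0) (hφ0 : φ 0 = 0) (hφ' : deriv φ 0 ≠ 0)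
    (hφh : ∀ᶠ s in nhds (0:ℂ), φ (h s) = deriv h 0 * φ s) {r₁ : ℝ} (hr₁ : 0 < r₁) {h₁ : ℂ → ℂ}
    (hh₁ : DifferentiableOn ℂ h₁ (Metric.ball 0 r₁)) (h₁0 : h₁ 0 = 0)
    (hhol₁ : F.IsHolonomyAt p v r₁ h₁)
    (hnl : ¬∃ c, ∀ᶠ s in nhds (0:ℂ), φ (h₁ s) = c * φ s) :
    IsAnalyticLeviFlatHypersurface M := by
  obtain ⟨τ, hτ, hτ0, hτ', hτφ, hφτ⟩ := hφ.exists_local_inverse hφ'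
  rw [hφ0] at hτ hτ0 hτ' hφτ
  have hτc : Filter.Tendsto τ (nhds 0) (nhds 0) := by
    have := hτ.continuousAt.tendsto
    rwa [hτ0] at this
  have hφc : Filter.Tendsto φ (nhds 0) (nhds 0) := by
    have := hφ.continuousAt.tendsto
    rwa [hφ0] at this
  have key : ∀ (r : ℝ) (h : ℂ → ℂ), 0 < r → DifferentiableOn ℂ h (Metric.ball 0 r) → h 0 = 0 →
      F.IsHolonomyAt p v r h → AnalyticAt ℂ (fun t => φ (h (τ t))) 0 ∧ φ (h (τ 0)) = 0 ∧
      ∀ᶠ t in nhds (0:ℂ), p + τ t • v ∈ M ↔ p + τ (φ (h (τ t))) • v ∈ M := by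
    intro r h hr hh h0 hhol
    have hb := Metric.ball_mem_nhds (0:ℂ) hr
    have ha : AnalyticAt ℂ h 0 := hh.analyticAt hb
    have hha : AnalyticAt ℂ (fun t => h (τ t)) 0 :=
      AnalyticAt.fun_comp (g := h) (by rwa [hτ0]) hτ
    have hhc : Filter.Tendsto (fun t => h (τ t)) (nhds 0) (nhds 0) := by
      have := hha.continuousAt.tendsto
      rwa [hτ0, h0] at this
    refine ⟨AnalyticAt.fun_comp (g := φ) (by rwa [hτ0, h0]) hha, by rw [hτ0, h0, hφ0], ?_⟩
    filter_upwards [hτc.eventually_mem hb, hhc.eventually hτφ] with t ht1 ht2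
    rw [ht2]
    exact hhol.mem_iff hM ht1
  obtain ⟨-, -, hQ⟩ := key r h hr hh h0 hhol
  obtain ⟨hg, hg0, hQ₁⟩ := key r₁ h₁ hr₁ hh₁ h₁0 hhol₁
  have hp0 := hM.2.1 p hp
  have hclosed := hM.isClosed_line (c := v) (add_smul_ne_zero hp0 hv)
  have hQl : ∀ᶠ t in nhds (0:ℂ), p + τ (deriv h 0 * t) • v ∈ M ↔ p + τ t • v ∈ M := by
    filter_upwards [hQ, hτc.eventually hφh, hφτ] with t a b c
    rw [a, b, c]
  have hQc : ∀ᶠ t in nhds (0:ℂ), ¬(p + τ t • v ∈ M) → ∀ᶠ w in nhds t, ¬(p + τ w • v ∈ M) := by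
    filter_upwards [hτ.eventually_analyticAt] with t ht hnt
    exact ht.continuousAt.eventually (hclosed.isOpen_compl.mem_nhds hnt)
  obtain ⟨ε, hε, hball⟩ := Metric.eventually_nhds_iff_ball.1 (hQl.and hQc)
  obtain ⟨K, hK, hlK, hKQ⟩ := exists_isClosed_homothety_invariant hl1
    (Q := fun t => p + τ t • v ∈ M) hε (fun t ht => (hball t ht).1) fun t ht => (hball t ht).2
  have hKM : ∀ᶠ t in nhds (0:ℂ), t ∈ K ↔ p + τ t • v ∈ M :=
    Metric.eventually_nhds_iff_ball.2 ⟨ε, hε, hKQ⟩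
  obtain ⟨U, f, hf, hpU, -⟩ := exists_firstIntegral hp0 (hM.form_ne_zero hp)
  have hf0 := (hf.differentiableAt p hpU).continuousAt
  obtain ⟨β, hβ, hβ0, hβ', hβM⟩ := hf.exists_transverse_coordinate hpU hM hv hφ hφ0 hφ' hτφ hKM
  have h0K : (0:ℂ) ∈ K := by
    rw [hKM.self_of_nhds, hτ0, zero_smul, add_zero]
    exact hp
  have hKint : interior K = ∅ := by
    rw [eq_empty_iff_forall_notMem]
    intro t₀ ht₀
    have hpow : Filter.Tendsto (fun k : ℕ => deriv h 0 ^ k * t₀) Filter.atTop (nhds 0) := by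
      simpa using (tendsto_pow_atTop_nhds_zero_of_norm_lt_one hl1).mul_const t₀
    have hline : ContinuousAt (fun s : ℂ => F.form (p + s • v) v) 0 :=
      (analyticAt_line (analyticAt_form_apply v p) v).continuousAt
    have hline0 : ∀ᶠ s in nhds (0:ℂ), F.form (p + s • v) v ≠ 0 :=
      hline.eventually_ne (by simpa using hv)
    have hev := (hφτ.and (hτc.eventually (hτφ.eventually_nhds.and
      (hline0.and hφ.eventually_analyticAt)))).and hKM.eventually_nhds
    obtain ⟨k, ⟨h1, h2, h3, h4⟩, h5⟩ := (hpow.eventually hev).exists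
    set t₁ := deriv h 0 ^ k * t₀ with ht₁
    have hlk := pow_ne_zero k hl0
    have h6 : ∀ᶠ t in nhds t₁, t ∈ K := by
      have h7 : ContinuousAt (fun t => (deriv h 0 ^ k)⁻¹ * t) t₁ := by fun_prop
      have h8 : (deriv h 0 ^ k)⁻¹ * t₁ = t₀ := by rw [ht₁, inv_mul_cancel_left₀ hlk]
      have h9 : ∀ᶠ t in nhds ((deriv h 0 ^ k)⁻¹ * t₁), t ∈ K := by
        rw [h8]
        exact mem_interior_iff_mem_nhds.1 ht₀
      filter_upwards [h7.eventually h9] with t ht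
      have h10 := pow_mul_mem_iff hlK k ((deriv h 0 ^ k)⁻¹ * t)
      rw [mul_inv_cancel_left₀ hlk] at h10
      exact h10.2 ht
    refine hM.not_eventually_line_mem hn (add_smul_ne_zero hp0 hv (τ t₁)) h3 ?_
    have h7 : ∀ᶠ s in nhds (τ t₁), p + s • v ∈ M := by
      have h8 : Filter.Tendsto φ (nhds (τ t₁)) (nhds t₁) := by
        have := h4.continuousAt.tendsto
        rwa [h1] at this
      filter_upwards [h8.eventually (h6.and h5), h2] with s hs hs2
      rw [hs.2, hs2] at hs
      exact hs.1
    have h8 : Filter.Tendsto (fun s => τ t₁ + s) (nhds 0) (nhds (τ t₁)) := by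
      have : ContinuousAt (fun s => τ t₁ + s) 0 := by fun_prop
      simpa [ContinuousAt] using this
    filter_upwards [h8.eventually h7] with s hs
    rwa [add_smul, ← add_assoc] at hs
  have hgc : Filter.Tendsto (fun t => φ (h₁ (τ t))) (nhds 0) (nhds 0) := by
    have := hg.continuousAt.tendsto
    rwa [hg0] at this
  have hgK : ∀ᶠ t in nhds (0:ℂ), t ∈ K ↔ φ (h₁ (τ t)) ∈ K := by
    filter_upwards [hKM, hgc.eventually hKM, hQ₁] with t a b c
    rw [a, b, c]
  have hgl : ¬∃ c, ∀ᶠ t in nhds (0:ℂ), φ (h₁ (τ t)) = c * t := by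
    rintro ⟨c, hc⟩
    refine hnl ⟨c, ?_⟩
    filter_upwards [hφc.eventually hc, hτφ] with s a b
    rwa [b] at a
  -- a germ at `p` of the holonomy pseudogroup moving `p` inside its transversal
  obtain ⟨ψ, hψ, hψ0, hψ', hψK⟩ : ∃ ψ : ℂ → ℂ, AnalyticAt ℂ ψ 0 ∧ ψ 0 ≠ 0 ∧ deriv ψ 0 ≠ 0 ∧
      ∀ᶠ t in nhds (0:ℂ), t ∈ K ↔ ψ t ∈ K := by
    have hβi : ∀ᶠ t in nhds (f p), β t = 0 ↔ t = f p := by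
      have h1 : Filter.Tendsto (fun t => (t, f p)) (nhds (f p)) (nhds (f p, f p)) := by
        rw [nhds_prod_eq]
        exact Filter.tendsto_id.prodMk tendsto_const_nhds
      filter_upwards [h1.eventually (hβ.eventually_eq_iff hβ')] with t ht
      rw [← ht, hβ0]
    have hgood := (hβM.eventually_nhds.and (hf.isOpen.mem_nhds hpU)).and
      (hf0.eventually (hβi.and (hβ.eventually_analyticAt.and
        (hβ.deriv.continuousAt.eventually_ne hβ'))))
    obtain ⟨O, hO, hOo, hpO⟩ := eventually_nhds_iff.1 hgood
    obtain ⟨σ, -, hσ0, -, -, hσ2⟩ := hf.exists_section hpU hv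
    obtain ⟨s₁, hs₁, hs₁M, hs₁O, hs₁σ⟩ : ∃ s : ℂ, s ≠ 0 ∧ p + s • v ∈ M ∧ p + s • v ∈ O ∧
        σ (f (p + s • v)) = s := by
      obtain ⟨s, h1, h2, h3⟩ := ((hM.frequently_mem hn hp hv).and_eventually
        (eventually_nhdsWithin_of_eventually_nhds
          ((eventually_line (hOo.mem_nhds hpO) v).and hσ2) |>.and self_mem_nhdsWithin)).exists
      exact ⟨s, h3, h1, h2.1, h2.2⟩
    have hne : f (p + s₁ • v) ≠ f p := fun h => hs₁ (by rw [← hs₁σ, h, hσ0])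
    have hs₁U := (hO _ hs₁O).1.2
    obtain ⟨q, hq, hql⟩ := mem_closure_iff_nhds.1 (hM.subset_closure_leaf hp hs₁M) _
      (Filter.inter_mem (hOo.mem_nhds hs₁O)
        ((hf.differentiableAt _ hs₁U).continuousAt.eventually_ne hne))
    obtain ⟨⟨hqM, hqU⟩, hq1, hq2, hq3⟩ := hO q hq.1
    obtain ⟨ψ, hψ, hψ0, hψ', he⟩ := hM.exists_mem_iff_comp (P := fun t => β t ∈ K) hql hf hqU hf
      hpU hqM
    have hl0' : HasDerivAt (fun s : ℂ => f (p + s • v)) (fderiv ℂ f p v) (τ 0) := by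
      rw [hτ0, ← hf.deriv_comp_line hpU v]
      exact (hf.analyticAt_comp_line hpU v).differentiableAt.hasDerivAt
    have hla : AnalyticAt ℂ (fun t => f (p + τ t • v)) 0 :=
      AnalyticAt.fun_comp (f := τ) (g := fun s : ℂ => f (p + s • v))
        (by rw [hτ0]; exact hf.analyticAt_comp_line hpU v) hτ
    have hlp : p + τ 0 • v = p := by rw [hτ0, zero_smul, add_zero]
    have hld : HasDerivAt (fun t => f (p + τ t • v)) (fderiv ℂ f p v * deriv τ 0) 0 :=
      hl0'.comp 0 hτ.differentiableAt.hasDerivAt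
    have hψl : AnalyticAt ℂ (fun t => ψ (f (p + τ t • v))) 0 :=
      AnalyticAt.fun_comp (g := ψ) (by rwa [hlp]) hla
    have hψd : HasDerivAt (fun t => ψ (f (p + τ t • v)))
        (deriv ψ (f p) * (fderiv ℂ f p v * deriv τ 0)) 0 :=
      HasDerivAt.comp (h₂ := ψ) 0 (by rw [hlp]; exact hψ.differentiableAt.hasDerivAt) hld
    have hβd : HasDerivAt (fun t => β (ψ (f (p + τ t • v))))
        (deriv β (f q) * (deriv ψ (f p) * (fderiv ℂ f p v * deriv τ 0))) 0 :=
      HasDerivAt.comp (h₂ := β) 0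
        (by rw [hlp, hψ0]; exact hq2.differentiableAt.hasDerivAt) hψd
    refine ⟨fun t => β (ψ (f (p + τ t • v))),
      AnalyticAt.fun_comp (g := β) (by rwa [hlp, hψ0]) hψl, ?_, ?_, ?_⟩
    · simp only [hlp, hψ0]
      exact fun h => hq.2 (hq1.1 h)
    · rw [hβd.deriv]
      exact mul_ne_zero hq3 (mul_ne_zero hψ'
        (mul_ne_zero (mt (hf.fderiv_apply_eq_zero_iff hpU).1 hv) hτ'))
    · have h1 := tendsto_section (z := p) hτ.continuousAt hτ0 v
      filter_upwards [hKM, h1.eventually he] with t a b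
      rw [a, b]
  obtain ⟨χ, hχ, -, hχ', hχK⟩ := exists_im_eq_zero_iff_mem hK hKint hl0 hl1 hlK h0K hg hg0 hgK hgl
    hψ hψ0 hψ' hψK
  have hχβ : AnalyticAt ℂ χ (β (f p)) := by rwa [hβ0]
  refine hM.isAnalyticLeviFlatHypersurface hp hf hpU (χ := fun t => χ (β t))
    (AnalyticAt.fun_comp (g := χ) hχβ hβ) ?_ ?_
  · have := (hχβ.differentiableAt.hasDerivAt.comp _ hβ.differentiableAt.hasDerivAt).deriv
    change deriv (χ ∘ β) _ ≠ 0
    rw [this, hβ0]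
    exact mul_ne_zero hχ' hβ'
  · have h1 : Filter.Tendsto (fun x => β (f x)) (nhds p) (nhds 0) := by
      rw [← hβ0]
      exact hβ.continuousAt.tendsto.comp hf0.tendsto
    filter_upwards [hβM, h1.eventually hχK] with x a b
    rw [a, b]

end

end ProjFoliation

/-- Germs which are linear in a common coordinate commute. -/
theorem AnalyticAt.eventually_comm_of_linear {φ h₁ h₂ : ℂ → ℂ} {a b : ℂ} (hφ : AnalyticAt ℂ φ 0)
    (hφ' : deriv φ 0 ≠ 0) (hc₁ : Filter.Tendsto h₁ (nhds 0) (nhds 0))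
    (hc₂ : Filter.Tendsto h₂ (nhds 0) (nhds 0)) (h₁e : ∀ᶠ s in nhds (0:ℂ), φ (h₁ s) = a * φ s)
    (h₂e : ∀ᶠ s in nhds (0:ℂ), φ (h₂ s) = b * φ s) :
    ∀ᶠ s in nhds (0:ℂ), h₁ (h₂ s) = h₂ (h₁ s) := by
  have hpair : Filter.Tendsto (fun s => (h₁ (h₂ s), h₂ (h₁ s))) (nhds 0) (nhds ((0:ℂ), (0:ℂ))) := by
    rw [nhds_prod_eq]
    exact (hc₁.comp hc₂).prodMk (hc₂.comp hc₁)
  filter_upwards [hpair.eventually (hφ.eventually_eq_iff hφ'), h₁e, h₂e, hc₂.eventually h₁e,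
    hc₁.eventually h₂e] with s e e₁ e₂ e₃ e₄
  refine e.1 ?_
  rw [e₃, e₄, e₁, e₂]
  ring

/-- Cerveau's theorem on nontrivial minimal sets of foliations on `ℂℙⁿ`, `n ≥ 2`. -/
theorem minimal_set_hyperbolic_holonomy_dichotomy (n d : ℕ) (hn : 2 ≤ n)
    (F : ProjFoliation n d) (M : Set (Fin (n + 1) → ℂ))
    (hM : F.IsNontrivialMinimalSet M) :
    ∃ p ∈ M,
      -- the leaf through p has hyperbolic holonomy
      (∃ v : Fin (n + 1) → ℂ, (∑ i, eval p (F.a i) * v i) ≠ 0 ∧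
        ∃ r : ℝ, 0 < r ∧ ∃ h : ℂ → ℂ,
          DifferentiableOn ℂ h (Metric.ball (0:ℂ) r) ∧ h 0 = 0 ∧
          ‖deriv h 0‖ < 1 ∧ F.IsHolonomyAt p v r h) ∧
      -- dichotomy
      (IsAnalyticLeviFlatHypersurface M ∨
        (∃ v : Fin (n + 1) → ℂ, (∑ i, eval p (F.a i) * v i) ≠ 0 ∧
          -- the image of Hol : π₁(L_p, p) → Diff(ℂ, 0) is abelian …
          (∀ (r₁ r₂ : ℝ), 0 < r₁ → 0 < r₂ → ∀ h₁ h₂ : ℂ → ℂ,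
            DifferentiableOn ℂ h₁ (Metric.ball (0:ℂ) r₁) → h₁ 0 = 0 →
            DifferentiableOn ℂ h₂ (Metric.ball (0:ℂ) r₂) → h₂ 0 = 0 →
            F.IsHolonomyAt p v r₁ h₁ → F.IsHolonomyAt p v r₂ h₂ →
            ∀ᶠ s in nhds (0:ℂ), h₁ (h₂ s) = h₂ (h₁ s)) ∧
          -- … and linearizable: simultaneously conjugate to linear germs
          (∃ r₀ : ℝ, 0 < r₀ ∧ ∃ φ : ℂ → ℂ,
            DifferentiableOn ℂ φ (Metric.ball (0:ℂ) r₀) ∧ φ 0 = 0 ∧ deriv φ 0 ≠ 0 ∧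
            ∀ (r : ℝ), 0 < r → ∀ h : ℂ → ℂ,
              DifferentiableOn ℂ h (Metric.ball (0:ℂ) r) → h 0 = 0 →
              F.IsHolonomyAt p v r h →
              ∃ lam : ℂ, ∀ᶠ s in nhds (0:ℂ), φ (h s) = lam * φ s))) := by
  obtain ⟨p, hp, v, hv, r, hr, h, hh, h0, hl0, hl1, hhol⟩ := hM.exists_hyperbolic_holonomy hn
  have hv' : (∑ i, eval p (F.a i) * v i) ≠ 0 := by rwa [← ProjFoliation.form_apply]
  refine ⟨p, hp, ⟨v, hv', r, hr, h, hh, h0, hl1, hhol⟩, ?_⟩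
  obtain ⟨φ, hφ, hφ0, hφ', hφh⟩ :=
    (hh.analyticAt (Metric.ball_mem_nhds _ hr)).exists_koenigs h0 hl0 hl1
  by_cases hlin : ∀ (r : ℝ), 0 < r → ∀ h : ℂ → ℂ, DifferentiableOn ℂ h (Metric.ball (0:ℂ) r) →
      h 0 = 0 → F.IsHolonomyAt p v r h →
      ∃ lam : ℂ, ∀ᶠ s in nhds (0:ℂ), φ (h s) = lam * φ s
  · refine Or.inr ⟨v, hv', ?_, ?_⟩
    · intro r₁ r₂ hr₁ hr₂ h₁ h₂ hh₁ h₁0 hh₂ h₂0 hol₁ hol₂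
      obtain ⟨a, ha⟩ := hlin r₁ hr₁ h₁ hh₁ h₁0 hol₁
      obtain ⟨b, hb⟩ := hlin r₂ hr₂ h₂ hh₂ h₂0 hol₂
      have hc₁ := (hh₁.analyticAt (Metric.ball_mem_nhds _ hr₁)).continuousAt.tendsto
      have hc₂ := (hh₂.analyticAt (Metric.ball_mem_nhds _ hr₂)).continuousAt.tendsto
      rw [h₁0] at hc₁
      rw [h₂0] at hc₂
      exact hφ.eventually_comm_of_linear hφ' hc₁ hc₂ ha hb
    · obtain ⟨r₀, hr₀, hball⟩ := Metric.eventually_nhds_iff_ball.1 hφ.eventually_analyticAt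
      exact ⟨r₀, hr₀, φ, fun s hs => (hball s hs).differentiableAt.differentiableWithinAt, hφ0,
        hφ', hlin⟩
  · push Not at hlin
    obtain ⟨r₁, hr₁, h₁, hh₁, h₁0, hol₁, hnl⟩ := hlin
    exact Or.inl (hM.isAnalyticLeviFlatHypersurface_of_not_linear hn hp hv hr hh h0 hl0 hl1 hhol
      hφ hφ0 hφ' hφh hr₁ hh₁ h₁0 hol₁ fun ⟨c, hc⟩ =>
        hnl c (hc.mono fun _ e e' => e' e))
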